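/- arXiv:2603.05736 — 2 statements merged into one kernel-verified Lean document; each statement's English description precedes it below -/
import Mathlib

section
/- Let s ≥ 0, r ≥ 1 and m ≥ 3 be integers, and let n = s + 2r + m. If m is odd and n ≡ 2r + m (mod 2(2r + m)), then HOP(2^⟨s⟩, 4^⟨r⟩, 2m) has a solution. -/
/-- The vertex set of the complete graph `K_{2n}`: the `n` couples are indexed by `Fin n`,
and the two members of a couple by `Fin 2`. -/
abbrev HOPVertex (n : ℕ) : Type := Fin n × Fin 2

/-- The spouse of a participant: the other member of the same couple. -/
def HOPspouse {n : ℕ} (v : HOPVertex n) : HOPVertex n := (v.1, v.2 + 1)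

/-- An edge of `K_{2n}` is an `I`-edge (an edge of the distinguished perfect matching `I`)
if it joins a participant to their spouse. -/
def IsIEdge {n : ℕ} (e : Sym2 (HOPVertex n)) : Prop :=
  ∃ v, e = s(v, HOPspouse v)

/-- An `I`-alternating `(K_2^⟨s⟩, C_{2m_1}, …, C_{2m_t})`-factor of `K_{2n}`:
a spanning subgraph of `K_{2n}` which is a vertex-disjoint union of `s` edges of `I`
(one for each `a : Fin s`, namely the edge joining `pair a` to its spouse) together with
`t` cycles, the `i`-th of which has length `2 * m i` (given by the cyclic vertex sequence
`cyc i : ZMod (2 * m i) → HOPVertex n`), such that along each cycle the edges alternate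
between `I`-edges (at even positions) and non-`I`-edges (at odd positions).
The field `spanning` says that the listed vertices are pairwise distinct and exhaust the
whole vertex set; in particular each `cyc i` is injective, so it really traces a cycle. -/
structure HOPFactor (n s t : ℕ) (m : Fin t → ℕ) : Type where
  pair : Fin s → HOPVertex n
  cyc : (i : Fin t) → ZMod (2 * m i) → HOPVertex n
  alt_even : ∀ (i : Fin t) (j : ZMod (2 * m i)),
      j.val % 2 = 0 → cyc i (j + 1) = HOPspouse (cyc i j)
  alt_odd : ∀ (i : Fin t) (j : ZMod (2 * m i)),
      j.val % 2 = 1 → ¬ IsIEdge s(cyc i j, cyc i (j + 1))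
  spanning : Function.Bijective
      (Sum.elim
        (fun a : Fin s × Fin 2 => if a.2 = 0 then pair a.1 else HOPspouse (pair a.1))
        (fun x : (i : Fin t) × ZMod (2 * m i) => cyc x.1 x.2))

/-- The edge set of an `I`-alternating `(K_2^⟨s⟩, C_{2m_1}, …, C_{2m_t})`-factor. -/
def HOPFactor.edges {n s t : ℕ} {m : Fin t → ℕ} (F : HOPFactor n s t m) :
    Set (Sym2 (HOPVertex n)) :=
  {e | (∃ a : Fin s, e = s(F.pair a, HOPspouse (F.pair a))) ∨
    ∃ (i : Fin t) (j : ZMod (2 * m i)), e = s(F.cyc i j, F.cyc i (j + 1))}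

/-- A solution to the generalized Honeymoon Oberwolfach Problem
`HOP(2^⟨s⟩, 2 m_1, …, 2 m_t)`: a family of `γ` `I`-alternating
`(K_2^⟨s⟩, C_{2m_1}, …, C_{2m_t})`-factors of `K_{2n}`, where `γ` is the natural number
with `γ * (m_1 + ⋯ + m_t) = 2n(n-1)`, such that every edge of `K_{2n}` that is not an
`I`-edge lies in exactly one factor of the family. -/
def HOPSolution (n s t : ℕ) (m : Fin t → ℕ) : Prop :=
  ∃ γ : ℕ, γ * (∑ i, m i) = 2 * n * (n - 1) ∧
    ∃ F : Fin γ → HOPFactor n s t m,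
      ∀ e : Sym2 (HOPVertex n), ¬ e.IsDiag → ¬ IsIEdge e →
        ∃! k : Fin γ, e ∈ (F k).edges


section part1

/-! ### Part 1: from labelled couple-blocks to factors -/

/-- a table structure on couples: table `i` visits couples `cv i l`, `l < m i`, entering at the
member `cx i l`. -/
structure GBlk (V : Type) (t : ℕ) (m : Fin t → ℕ) where
  cv : Fin t → ℕ → V
  cx : Fin t → ℕ → Bool
  inj : ∀ i l i' l', l < m i → l' < m i' → cv i l = cv i' l' → i = i' ∧ l = l'

def b2f (b : Bool) : Fin 2 := if b then 1 else 0

lemma b2f_inj {a b : Bool} (h : b2f a = b2f b) : a = b := by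
  cases a <;> cases b <;> simp_all [b2f]

lemma b2f_not (a : Bool) : b2f (!a) = b2f a + 1 := by
  cases a <;> rfl

lemma b2f_surj (f : Fin 2) : ∃ b, b2f b = f := by
  fin_cases f
  · exact ⟨false, rfl⟩
  · exact ⟨true, rfl⟩

lemma not_IsIEdge {n : ℕ} {u w : HOPVertex n} (h : u.1 ≠ w.1) : ¬ IsIEdge s(u, w) := by
  rintro ⟨v, hv⟩
  rw [Sym2.eq_iff] at hv
  rcases hv with ⟨rfl, rfl⟩ | ⟨rfl, rfl⟩ <;> simp [HOPspouse] at h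

lemma val_add_one_of_lt' {N : ℕ} (hN : 2 ≤ N) (j : ZMod N) (h : j.val + 1 < N) :
    (j + 1).val = j.val + 1 := by
  have : Fact (1 < N) := ⟨hN⟩
  rw [ZMod.val_add_of_lt]
  · rw [ZMod.val_one]
  · rw [ZMod.val_one]; exact h

lemma val_add_one_of_eq' {N : ℕ} (hN : 2 ≤ N) (j : ZMod N) (h : j.val + 1 = N) :
    (j + 1).val = 0 := by
  have : Fact (1 < N) := ⟨hN⟩
  rw [ZMod.val_add, ZMod.val_one, h, Nat.mod_self]

section
variable {V : Type} {n s t : ℕ} {m : Fin t → ℕ}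

lemma GBlk.next {i : Fin t} (hm : 2 ≤ m i) (j : ZMod (2 * m i)) :
    (j.val % 2 = 0 → (j + 1).val = j.val + 1) ∧
    (j.val % 2 = 1 → (j + 1).val = 2 * ((j.val / 2 + 1) % m i)) := by
  have : NeZero (2 * m i) := ⟨by omega⟩
  have hlt : j.val < 2 * m i := ZMod.val_lt j
  constructor
  · intro h
    exact val_add_one_of_lt' (by omega) j (by omega)
  · intro h
    by_cases h2 : j.val + 1 = 2 * m i
    · rw [val_add_one_of_eq' (by omega) j h2]
      have : j.val / 2 + 1 = m i := by omega
      rw [this]; simp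
    · rw [val_add_one_of_lt' (by omega) j (by omega)]
      rw [Nat.mod_eq_of_lt (by omega)]; omega

/-- position function -/
def GBlk.pos (e : V ≃ Fin n) (B : GBlk V t m) (i : Fin t) (a : ℕ) : HOPVertex n :=
  (e (B.cv i (a / 2)), b2f (xor (B.cx i (a / 2)) (decide (a % 2 = 1))))

lemma GBlk.exists_factor (e : V ≃ Fin n) (hm : ∀ i, 2 ≤ m i) (hn : n = s + ∑ i, m i)
    (B : GBlk V t m) :
    ∃ F : HOPFactor n s t m, ∀ i (j : ZMod (2 * m i)), F.cyc i j = B.pos e i j.val := by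
  classical
  have : ∀ i, NeZero (2 * m i) := fun i => ⟨by have := hm i; omega⟩
  let f : ((i : Fin t) × Fin (m i)) → Fin n := fun x => e (B.cv x.1 x.2)
  have hf : Function.Injective f := by
    rintro ⟨i, l⟩ ⟨i', l'⟩ h
    obtain ⟨h1, h2⟩ := B.inj i l i' l' l.2 l'.2 (e.injective h)
    subst h1
    have : l = l' := Fin.ext h2
    rw [this]
  have hcard : Fintype.card {y : Fin n // ¬ ∃ x, f x = y} = s := by
    have h1 := Fintype.card_subtype_compl (fun y : Fin n => ∃ x, f x = y)
    have h2 : Fintype.card {y : Fin n // ∃ x, f x = y} = ∑ i, m i := by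
      have := Fintype.card_congr (Equiv.ofInjective f hf)
      simp only [Fintype.card_sigma, Fintype.card_fin] at this
      rw [this]; exact Fintype.card_congr (Equiv.refl _)
    rw [h1, h2, Fintype.card_fin]; omega
  let g : Fin s ≃ {y : Fin n // ¬ ∃ x, f x = y} := (Fintype.equivFinOfCardEq hcard).symm
  refine ⟨⟨fun a => ((g a).1, 0), fun i j => B.pos e i j.val, ?_, ?_, ?_⟩, fun i j => rfl⟩
  · intro i j hj
    rw [(GBlk.next (hm i) j).1 hj]
    have h1 : (j.val + 1) / 2 = j.val / 2 := by omega
    have h2 : (j.val + 1) % 2 = 1 := by omega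
    simp only [GBlk.pos, HOPspouse, h1, h2, hj]
    simp [b2f_not]
  · intro i j hj
    apply not_IsIEdge
    rw [(GBlk.next (hm i) j).2 hj]
    simp only [GBlk.pos]
    intro h
    have hlt : j.val < 2 * m i := ZMod.val_lt j
    have h3 := (B.inj i _ i _ (by omega) (by
      rw [Nat.mul_div_cancel_left _ (by norm_num)]; exact Nat.mod_lt _ (by omega)) (e.injective h)).2
    rw [Nat.mul_div_cancel_left _ (by norm_num)] at h3
    by_cases h4 : j.val / 2 + 1 = m i
    · rw [h4, Nat.mod_self] at h3; have := hm i; omega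
    · rw [Nat.mod_eq_of_lt (by omega)] at h3; omega
  · rw [Fintype.bijective_iff_injective_and_card]
    constructor
    · rintro (⟨a, b⟩ | ⟨i, j⟩) (⟨a', b'⟩ | ⟨i', j'⟩) h
      · simp only [Sum.elim_inl] at h
        have h1 : g a = g a' := by
          apply Subtype.ext
          have := congrArg Prod.fst h
          fin_cases b <;> fin_cases b' <;> simpa [HOPspouse] using this
        have h1 := g.injective h1
        subst h1
        have := congrArg Prod.snd h
        fin_cases b <;> fin_cases b' <;> simp_all [HOPspouse]
      · exfalso
        simp only [Sum.elim_inl, Sum.elim_inr] at h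
        apply (g a).2
        have hlt : j'.val < 2 * m i' := ZMod.val_lt j'
        refine ⟨⟨i', ⟨j'.val / 2, by omega⟩⟩, ?_⟩
        have := congrArg Prod.fst h
        fin_cases b <;> simpa [HOPspouse, GBlk.pos, f] using this.symm
      · exfalso
        simp only [Sum.elim_inl, Sum.elim_inr] at h
        apply (g a').2
        have hlt : j.val < 2 * m i := ZMod.val_lt j
        refine ⟨⟨i, ⟨j.val / 2, by omega⟩⟩, ?_⟩
        have := congrArg Prod.fst h
        fin_cases b' <;> simpa [HOPspouse, GBlk.pos, f] using this
      · simp only [Sum.elim_inr, GBlk.pos, Prod.mk.injEq] at h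
        have hlt : j.val < 2 * m i := ZMod.val_lt j
        have hlt' : j'.val < 2 * m i' := ZMod.val_lt j'
        obtain ⟨h1, h2⟩ := B.inj i _ i' _ (by omega) (by omega) (e.injective h.1)
        subst h1
        have h3 := b2f_inj h.2
        rw [← h2] at h3
        have h4 : decide (j.val % 2 = 1) = decide (j'.val % 2 = 1) := by
          revert h3; cases B.cx i (j.val / 2) <;> simp
        have h5 : (j.val % 2 = 1) ↔ (j'.val % 2 = 1) := by simpa using h4
        have : j.val = j'.val := by omega
        have := ZMod.val_injective _ this
        rw [this]
    · simp only [Fintype.card_sum, Fintype.card_prod, Fintype.card_fin, Fintype.card_sigma,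
        ZMod.card]
      rw [← Finset.mul_sum, hn]; ring

/-- oriented coverage by slot `l` of table `i`. -/
def GBlk.Cov (B : GBlk V t m) (u w : V) (a b : Bool) : Prop :=
  ∃ i : Fin t, ∃ l < m i, u = B.cv i l ∧ a = (!B.cx i l) ∧
    w = B.cv i ((l + 1) % m i) ∧ b = B.cx i ((l + 1) % m i)

theorem GBlk.solution (e : V ≃ Fin n) (hm : ∀ i, 2 ≤ m i) (hn : n = s + ∑ i, m i)
    {ι : Type} [Fintype ι] (hι : Fintype.card ι * (∑ i, m i) = 2 * n * (n - 1))
    (B : ι → GBlk V t m)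
    (hB : ∀ u w a b, u ≠ w → ∃ k, (B k).Cov u w a b ∨ (B k).Cov w u b a) :
    HOPSolution n s t m := by
  classical
  have : ∀ i, NeZero (2 * m i) := fun i => ⟨by have := hm i; omega⟩
  let E := Fintype.equivFin ι
  choose F hF using fun k : ι => (B k).exists_factor (s := s) e hm hn
  refine ⟨Fintype.card ι, hι, fun k => F (E.symm k), ?_⟩
  -- slots
  let fwd : (ι × ((i : Fin t) × Fin (m i))) → (HOPVertex n × HOPVertex n) := fun x =>
    ((B x.1).pos e x.2.1 (2 * x.2.2 + 1), (B x.1).pos e x.2.1 (2 * ((x.2.2 + 1) % m x.2.1)))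
  have hne : ∀ x, (fwd x).1.1 ≠ (fwd x).2.1 := by
    rintro ⟨k, i, l⟩ h
    simp only [fwd, GBlk.pos] at h
    have hl := l.2
    have h3 := ((B k).inj i _ i _ (by omega) (by
      rw [Nat.mul_div_cancel_left _ (by norm_num)]; exact Nat.mod_lt _ (by omega)) (e.injective h)).2
    rw [Nat.mul_div_cancel_left _ (by norm_num)] at h3
    have h5 : (2 * l.val + 1) / 2 = l.val := by omega
    rw [h5] at h3
    by_cases h4 : l.val + 1 = m i
    · rw [h4, Nat.mod_self] at h3; have := hm i; omega
    · rw [Nat.mod_eq_of_lt (by omega)] at h3; omega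
  let P := {p : HOPVertex n × HOPVertex n // p.1.1 ≠ p.2.1}
  let G : (ι × ((i : Fin t) × Fin (m i))) × Bool → P := fun x =>
    if x.2 then ⟨fwd x.1, hne x.1⟩ else ⟨(fwd x.1).swap, (hne x.1).symm⟩
  have hPcard : Fintype.card P = 2 * (2 * n * (n - 1)) := by
    have h1 : Fintype.card P = Fintype.card {p : (Fin n × Fin n) // p.1 ≠ p.2} * 4 := by
      have : Fintype.card P = Fintype.card ({p : (Fin n × Fin n) // p.1 ≠ p.2} × (Fin 2 × Fin 2)) := by
        apply Fintype.card_congr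
        exact
          { toFun := fun p => (⟨(p.1.1.1, p.1.2.1), p.2⟩, (p.1.1.2, p.1.2.2))
            invFun := fun q => ⟨((q.1.1.1, q.2.1), (q.1.1.2, q.2.2)), q.1.2⟩
            left_inv := fun p => rfl
            right_inv := fun q => rfl }
      rw [this]; simp
    have h2 : Fintype.card {p : (Fin n × Fin n) // p.1 ≠ p.2} = n * (n - 1) := by
      rw [Fintype.card_subtype]
      have := Finset.offDiag_card (Finset.univ : Finset (Fin n))
      rw [Finset.card_univ, Fintype.card_fin] at this
      rw [Nat.mul_sub, mul_one, ← this]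
      congr 1
      ext p; simp
    rw [h1, h2]; ring
  have hSurj : Function.Surjective G := by
    have key : ∀ k u w a b, (B k).Cov u w a b → ∃ x, fwd x = ((e u, b2f a), (e w, b2f b)) := by
      rintro k u w a b ⟨i, l, hl, rfl, rfl, rfl, rfl⟩
      refine ⟨(k, ⟨i, ⟨l, hl⟩⟩), ?_⟩
      simp only [fwd, GBlk.pos]
      have h5 : (2 * l + 1) / 2 = l := by omega
      have h6 : (2 * l + 1) % 2 = 1 := by omega
      rw [h5, h6, Nat.mul_div_cancel_left _ (by norm_num), Nat.mul_mod_right]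
      simp
    rintro ⟨⟨⟨u, a⟩, ⟨w, b⟩⟩, h⟩
    obtain ⟨u, rfl⟩ := e.surjective u
    obtain ⟨w, rfl⟩ := e.surjective w
    obtain ⟨a, rfl⟩ := b2f_surj a
    obtain ⟨b, rfl⟩ := b2f_surj b
    have h' : u ≠ w := fun h2 => h (by simp [h2])
    obtain ⟨k, hk | hk⟩ := hB u w a b h'
    · obtain ⟨x, hx⟩ := key k _ _ _ _ hk
      exact ⟨(x, true), by apply Subtype.ext; simp only [G, if_true]; exact hx⟩
    · obtain ⟨x, hx⟩ := key k _ _ _ _ hk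
      exact ⟨(x, false), by apply Subtype.ext; simp [G]; rw [hx]; rfl⟩
  have hInj : Function.Injective G := by
    have : Function.Bijective G := by
      rw [Fintype.bijective_iff_surjective_and_card]
      refine ⟨hSurj, ?_⟩
      rw [hPcard]
      simp only [Fintype.card_prod, Fintype.card_sigma, Fintype.card_fin, Fintype.card_bool]
      rw [hι]; ring
    exact this.1
  -- edges of a factor are slots
  have hedge : ∀ k x, s((fwd (k, x)).1, (fwd (k, x)).2) ∈ (F k).edges := by
    rintro k ⟨i, l⟩
    right
    refine ⟨i, ((2 * l.val + 1 : ℕ) : ZMod (2 * m i)), ?_⟩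
    have hl := l.2
    have hv : (((2 * l.val + 1 : ℕ) : ZMod (2 * m i))).val = 2 * l.val + 1 := by
      rw [ZMod.val_natCast, Nat.mod_eq_of_lt (by omega)]
    rw [hF, hF, (GBlk.next (hm i) _).2 (by rw [hv]; omega), hv]
    have h5 : (2 * l.val + 1) / 2 = l.val := by omega
    rw [h5]
  have hedge' : ∀ k ed, ¬ IsIEdge ed → ed ∈ (F k).edges →
      ∃ x, ed = s((fwd (k, x)).1, (fwd (k, x)).2) := by
    rintro k ed hI (⟨a, rfl⟩ | ⟨i, j, rfl⟩)
    · exact absurd ⟨_, rfl⟩ hI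
    · rcases Nat.mod_two_eq_zero_or_one j.val with h | h
      · rw [(F k).alt_even i j h] at hI
        exact absurd ⟨_, rfl⟩ hI
      · have hlt : j.val < 2 * m i := ZMod.val_lt j
        refine ⟨⟨i, ⟨j.val / 2, by omega⟩⟩, ?_⟩
        simp only [fwd]
        rw [hF, hF, (GBlk.next (hm i) _).2 h]
        have : 2 * (j.val / 2) + 1 = j.val := by omega
        rw [this]
  intro ed
  induction ed with
  | _ p q =>
  intro hd hI
  have hpq : p.1 ≠ q.1 := by
    intro h
    apply hI
    refine ⟨p, ?_⟩
    have : q = HOPspouse p := by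
      rcases p with ⟨p1, p2⟩
      rcases q with ⟨q1, q2⟩
      simp only at h
      subst h
      simp only [Sym2.mk_isDiag_iff, Prod.mk.injEq, true_and] at hd
      simp only [HOPspouse, Prod.mk.injEq, true_and]
      fin_cases p2 <;> fin_cases q2 <;> simp_all
    rw [this]
  obtain ⟨⟨⟨k, x⟩, b⟩, hx⟩ := hSurj ⟨(p, q), hpq⟩
  have hxe : s((fwd (k, x)).1, (fwd (k, x)).2) = s(p, q) := by
    have := congrArg Subtype.val hx
    cases b
    · simp only [G, Bool.false_eq_true, if_false] at this
      rw [Prod.ext_iff] at this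
      rw [Sym2.eq_swap]
      exact congrArg₂ _ this.1 this.2
    · simp only [G, if_true] at this
      rw [Prod.ext_iff] at this
      exact congrArg₂ _ this.1 this.2
  refine ⟨E k, ?_, ?_⟩
  · simp only [Equiv.symm_apply_apply]
    rw [← hxe]; exact hedge k x
  · intro k' hk'
    obtain ⟨x', hx'⟩ := hedge' _ _ hI hk'
    rw [← hxe, Sym2.eq_iff] at hx'
    have : (E.symm k', x') = (k, x) := by
      rcases hx' with ⟨h1, h2⟩ | ⟨h1, h2⟩
      · have : G ((E.symm k', x'), true) = G ((k, x), true) := by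
          apply Subtype.ext; simp only [G, if_true]; exact (Prod.ext h1 h2).symm
        exact congrArg Prod.fst (hInj this)
      · have : G ((E.symm k', x'), false) = G ((k, x), true) := by
          apply Subtype.ext; simp [G]; exact Prod.ext h1.symm h2.symm
        have := hInj this
        simp at this
    have := congrArg Prod.fst this
    simp only at this
    rw [← this]; simp

end

end part1

section part2

/-! ### Part 2: blocks consisting of one `m`-cycle and `r` two-cycles of couples -/

structure Blk (V : Type) (m r : ℕ) where
  v : ℕ → V
  x : ℕ → Bool
  c : ℕ → Bool
  inj : ∀ i < m + 2 * r, ∀ j < m + 2 * r, v i = v j → i = j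

def Blk.Cov {V : Type} {m r : ℕ} (B : Blk V m r) (u w : V) (a b : Bool) : Prop :=
  (∃ i < m, u = B.v i ∧ a = (!B.x i) ∧ w = B.v ((i + 1) % m) ∧ b = B.x ((i + 1) % m)) ∨
  (∃ j < r, u = B.v (m + 2 * j) ∧ w = B.v (m + 2 * j + 1) ∧ B.c j = (a == b))

def Covers {V ι : Type} {m r : ℕ} (B : ι → Blk V m r) : Prop :=
  ∀ u w a b, u ≠ w → ∃ k, (B k).Cov u w a b ∨ (B k).Cov w u b a

def Blk.toG {V : Type} {m r : ℕ} (B : Blk V m r) :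
    GBlk V (r + 1) (fun i => if (i : ℕ) < r then 2 else m) where
  cv i l := if (i : ℕ) < r then B.v (m + 2 * i + l) else B.v l
  cx i l := if (i : ℕ) < r then (if l = 0 then false else B.c i) else B.x l
  inj := by
    rintro i l i' l' hl hl' h
    have hi := i.2
    have hi' := i'.2
    by_cases h1 : (i : ℕ) < r <;> by_cases h2 : (i' : ℕ) < r <;>
      simp only [h1, h2, if_true, if_false] at hl hl' h <;>
      have := B.inj _ (by omega) _ (by omega) h <;> simp only [Fin.ext_iff] <;> omega

theorem Blk.solution {V : Type} {n s m r : ℕ} (e : V ≃ Fin n) (hm : 3 ≤ m)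
    (hn : n = s + 2 * r + m) {ι : Type} [Fintype ι]
    (hι : Fintype.card ι * (2 * r + m) = 2 * n * (n - 1))
    (B : ι → Blk V m r) (hB : Covers B) :
    HOPSolution n s (r + 1) (fun i => if (i : ℕ) < r then 2 else m) := by
  have hsum : ∑ i : Fin (r + 1), (if (i : ℕ) < r then 2 else m) = 2 * r + m := by
    rw [Fin.sum_univ_castSucc]
    simp [mul_comm]
  refine GBlk.solution e ?_ ?_ (ι := ι) ?_ (fun k => (B k).toG) ?_
  · intro i; split_ifs <;> omega
  · rw [hsum]; omega
  · rw [hsum]; exact hι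
  · have key : ∀ k u w a b, (B k).Cov u w a b → (B k).toG.Cov u w a b ∨ (B k).toG.Cov w u b a := by
      rintro k u w a b (⟨i, hi, rfl, rfl, rfl, rfl⟩ | ⟨j, hj, rfl, rfl, hc⟩)
      · left
        refine ⟨Fin.last r, i, ?_, ?_⟩
        · simpa using hi
        · simp [Blk.toG]
      · cases a
        · right
          refine ⟨⟨j, by omega⟩, 1, ?_, ?_⟩
          · simp [hj]
          · simp [Blk.toG, hj, hc]
        · left
          refine ⟨⟨j, by omega⟩, 0, ?_, ?_⟩
          · simp [hj]
          · simp [Blk.toG, hj, hc]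
    intro u w a b huw
    obtain ⟨k, h | h⟩ := hB u w a b huw
    · exact ⟨k, key k _ _ _ _ h⟩
    · exact ⟨k, (key k _ _ _ _ h).symm⟩

/-- transport along an injective map -/
def Blk.map {V W : Type} {m r : ℕ} (f : V → W) (hf : Function.Injective f) (B : Blk V m r) :
    Blk W m r where
  v i := f (B.v i)
  x := B.x
  c := B.c
  inj i hi j hj h := B.inj i hi j hj (hf h)

lemma Blk.Cov.map {V W : Type} {m r : ℕ} {f : V → W} (hf : Function.Injective f) {B : Blk V m r}
    {u w : V} {a b : Bool} (h : B.Cov u w a b) : (B.map f hf).Cov (f u) (f w) a b := by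
  rcases h with ⟨i, hi, rfl, rfl, rfl, rfl⟩ | ⟨j, hj, rfl, rfl, hc⟩
  · exact Or.inl ⟨i, hi, rfl, rfl, rfl, rfl⟩
  · exact Or.inr ⟨j, hj, rfl, rfl, hc⟩

/-! ### Part 3: pieces -/

structure Piece (V : Type) (q r : ℕ) where
  v : ℕ → V
  v' : ℕ → V
  agree : ∀ i < 2 * q, v' i = v i
  inj : ∀ i < 2 * q + 2 * r, ∀ j < 2 * q + 2 * r, v i = v j → i = j
  inj' : ∀ i < 2 * q + 2 * r, ∀ j < 2 * q + 2 * r, v' i = v' j → i = j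
  cP : ℕ → Bool
  cM : ℕ → Bool
  cM' : ℕ → Bool

section
variable {V : Type} {q r : ℕ}

def Piece.X (P : Piece V q r) : ℕ → Bool
  | 0 => false
  | i + 1 => xor (P.X i) (P.cP i)

def Piece.w (P : Piece V q r) (b : Bool) : ℕ → V := if b then P.v' else P.v

lemma Piece.w_eq (P : Piece V q r) (b : Bool) {i : ℕ} (hi : i < 2 * q) : P.w b i = P.v i := by
  cases b
  · rfl
  · exact P.agree i hi

def Piece.row (P : Piece V q r) (b : Bool) : Blk (Option V) (2 * q + 1) r where
  v i := if i = 0 then none else some (P.w b (i - 1))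
  x i := if i = 0 then false else xor b (P.X (i - 1))
  c := if b then P.cM' else P.cM
  inj := by
    intro i hi j hj h
    by_cases h1 : i = 0 <;> by_cases h2 : j = 0 <;> simp [h1, h2] at h ⊢
    cases b
    · have := P.inj _ (by omega) _ (by omega) h; omega
    · have := P.inj' _ (by omega) _ (by omega) h; omega

lemma Piece.cov_path (P : Piece V q r) {i : ℕ} (hi : i + 1 < 2 * q) {a b : Bool}
    (hc : P.cP i = (a == b)) : ∃ k, (P.row k).Cov (some (P.v i)) (some (P.v (i + 1))) a b := by
  refine ⟨xor a (!P.X i), Or.inl ⟨i + 1, by omega, ?_, ?_, ?_, ?_⟩⟩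
  · simp [Piece.row, P.w_eq _ (show i < 2 * q by omega)]
  · have : ¬ (i + 1 = 0) := by omega
    simp only [Piece.row, this, if_false, Nat.add_sub_cancel]
    cases a <;> cases P.X i <;> rfl
  · rw [Nat.mod_eq_of_lt (by omega)]
    simp [Piece.row, P.w_eq _ hi]
  · rw [Nat.mod_eq_of_lt (by omega)]
    simp [Piece.row, Piece.X, hc]
    cases a <;> cases b <;> cases P.X i <;> rfl

lemma Piece.cov_start (P : Piece V q r) (hq : 1 ≤ q) (b : Bool) :
    ∃ k, (P.row k).Cov none (some (P.v 0)) true b := by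
  refine ⟨b, Or.inl ⟨0, by omega, ?_, ?_, ?_, ?_⟩⟩
  · simp [Piece.row]
  · simp [Piece.row]
  · rw [Nat.mod_eq_of_lt (by omega)]
    simp [Piece.row, P.w_eq _ (show 0 < 2 * q by omega)]
  · rw [Nat.mod_eq_of_lt (by omega)]
    simp [Piece.row, Piece.X]

lemma Piece.cov_end (P : Piece V q r) (hq : 1 ≤ q) (a : Bool) :
    ∃ k, (P.row k).Cov (some (P.v (2 * q - 1))) none a false := by
  refine ⟨xor (!a) (P.X (2 * q - 1)), Or.inl ⟨2 * q, by omega, ?_, ?_, ?_, ?_⟩⟩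
  · have : ¬ (2 * q = 0) := by omega
    simp only [Piece.row, this, if_false]
    rw [P.w_eq _ (by omega)]
  · have : ¬ (2 * q = 0) := by omega
    simp only [Piece.row, this, if_false]
    cases a <;> cases P.X (2 * q - 1) <;> rfl
  · simp [Piece.row]
  · simp [Piece.row]

lemma Piece.cov_M (P : Piece V q r) {j : ℕ} (hj : j < r) {a b : Bool} (hc : P.cM j = (a == b)) :
    (P.row false).Cov (some (P.v (2 * q + 2 * j))) (some (P.v (2 * q + 2 * j + 1))) a b := by
  refine Or.inr ⟨j, hj, ?_, ?_, ?_⟩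
  · have : 2 * q + 1 + 2 * j - 1 = 2 * q + 2 * j := by omega
    simp [Piece.row, this, Piece.w]
  · have : 2 * q + 1 + 2 * j + 1 - 1 = 2 * q + 2 * j + 1 := by omega
    simp [Piece.row, this, Piece.w]
  · simpa [Piece.row] using hc

lemma Piece.cov_M' (P : Piece V q r) {j : ℕ} (hj : j < r) {a b : Bool} (hc : P.cM' j = (a == b)) :
    (P.row true).Cov (some (P.v' (2 * q + 2 * j))) (some (P.v' (2 * q + 2 * j + 1))) a b := by
  refine Or.inr ⟨j, hj, ?_, ?_, ?_⟩
  · have : 2 * q + 1 + 2 * j - 1 = 2 * q + 2 * j := by omega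
    simp [Piece.row, this, Piece.w]
  · have : 2 * q + 1 + 2 * j + 1 - 1 = 2 * q + 2 * j + 1 := by omega
    simp [Piece.row, this, Piece.w]
  · simpa [Piece.row] using hc

/-- a piece whose edges are oriented -/
structure OPiece (V : Type) (q r : ℕ) where
  v : ℕ → V
  v' : ℕ → V
  agree : ∀ i < 2 * q, v' i = v i
  inj : ∀ i < 2 * q + 2 * r, ∀ j < 2 * q + 2 * r, v i = v j → i = j
  inj' : ∀ i < 2 * q + 2 * r, ∀ j < 2 * q + 2 * r, v' i = v' j → i = j
  o : ℕ → Bool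

def OPiece.Cov (P : OPiece V q r) (u w : V) : Prop :=
  (∃ i, i + 1 < 2 * q ∧ ((P.o i = true ∧ u = P.v i ∧ w = P.v (i + 1)) ∨
    (P.o i = false ∧ w = P.v i ∧ u = P.v (i + 1)))) ∨
  (∃ j < r, u = P.v (2 * q + 2 * j) ∧ w = P.v (2 * q + 2 * j + 1)) ∨
  (∃ j < r, u = P.v' (2 * q + 2 * j) ∧ w = P.v' (2 * q + 2 * j + 1))

/-- colour the oriented edges by comparison with a linear order -/
def OPiece.toPiece (P : OPiece V q r) (f : V → ℕ) : Piece V q r where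
  v := P.v
  v' := P.v'
  agree := P.agree
  inj := P.inj
  inj' := P.inj'
  cP i := if P.o i then decide (f (P.v i) < f (P.v (i + 1))) else decide (f (P.v (i + 1)) < f (P.v i))
  cM j := decide (f (P.v (2 * q + 2 * j)) < f (P.v (2 * q + 2 * j + 1)))
  cM' j := decide (f (P.v' (2 * q + 2 * j)) < f (P.v' (2 * q + 2 * j + 1)))

lemma OPiece.cov_row (P : OPiece V q r) (f : V → ℕ) {u w : V} (h : P.Cov u w) {a b : Bool}
    (hc : decide (f u < f w) = (a == b)) :
    ∃ k, ((P.toPiece f).row k).Cov (some u) (some w) a b ∨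
      ((P.toPiece f).row k).Cov (some w) (some u) b a := by
  rcases h with ⟨i, hi, ⟨ho, rfl, rfl⟩ | ⟨ho, rfl, rfl⟩⟩ | ⟨j, hj, rfl, rfl⟩ | ⟨j, hj, rfl, rfl⟩
  · obtain ⟨k, hk⟩ := (P.toPiece f).cov_path hi (a := a) (b := b) (by
      simp only [OPiece.toPiece, ho, if_true]; exact hc)
    exact ⟨k, Or.inl hk⟩
  · obtain ⟨k, hk⟩ := (P.toPiece f).cov_path hi (a := b) (b := a) (by
      simp only [OPiece.toPiece, ho]; rw [Bool.beq_comm]; exact hc)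
    exact ⟨k, Or.inr hk⟩
  · exact ⟨_, Or.inl ((P.toPiece f).cov_M hj hc)⟩
  · exact ⟨_, Or.inl ((P.toPiece f).cov_M' hj hc)⟩

theorem core_of_pieces [Finite V] {ι : Type} (hq : 1 ≤ q) (P : ι → OPiece V q r)
    (hcov : ∀ u w, u ≠ w → ∃ k, (P k).Cov u w)
    (hs : ∀ u, ∃ k, (P k).v 0 = u) (ht : ∀ u, ∃ k, (P k).v (2 * q - 1) = u) :
    ∃ B : ι × Bool → Blk (Option V) (2 * q + 1) r, Covers B := by
  obtain ⟨f, hf⟩ : ∃ f : V → ℕ, Function.Injective f := by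
    obtain ⟨n, ⟨e⟩⟩ := Finite.exists_equiv_fin V
    exact ⟨fun u => (e u : ℕ), fun a b h => e.injective (Fin.ext h)⟩
  refine ⟨fun k => ((P k.1).toPiece f).row k.2, ?_⟩
  have hinf : ∀ u a b, ∃ k : ι × Bool, (((P k.1).toPiece f).row k.2).Cov none (some u) a b ∨
      (((P k.1).toPiece f).row k.2).Cov (some u) none b a := by
    intro u a b
    cases a
    · obtain ⟨k, rfl⟩ := ht u
      obtain ⟨k', h⟩ := ((P k).toPiece f).cov_end hq b
      exact ⟨(k, k'), Or.inr h⟩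
    · obtain ⟨k, rfl⟩ := hs u
      obtain ⟨k', h⟩ := ((P k).toPiece f).cov_start hq b
      exact ⟨(k, k'), Or.inl h⟩
  rintro (_ | u) (_ | w) a b huw
  · exact absurd rfl huw
  · exact hinf w a b
  · obtain ⟨k, hk⟩ := hinf u b a
    exact ⟨k, hk.symm⟩
  · have huw' : u ≠ w := fun h => huw (by rw [h])
    have hfne : f u ≠ f w := fun h => huw' (hf h)
    by_cases h : decide (f u < f w) = (a == b)
    · obtain ⟨k, hk⟩ := hcov u w huw'
      obtain ⟨k', hk'⟩ := (P k).cov_row f hk h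
      exact ⟨(k, k'), hk'⟩
    · obtain ⟨k, hk⟩ := hcov w u huw'.symm
      have h' : decide (f w < f u) = (b == a) := by
        rw [Bool.beq_comm]
        rcases lt_or_gt_of_ne hfne with h1 | h1
        · have h2 : ¬ f w < f u := by omega
          simp only [h1, h2, decide_true, decide_false] at h ⊢
          revert h; cases (a == b) <;> simp
        · have h2 : ¬ f u < f w := by omega
          simp only [h1, h2, decide_true, decide_false] at h ⊢
          revert h; cases (a == b) <;> simp
      obtain ⟨k', hk'⟩ := (P k).cov_row f hk h'
      exact ⟨(k, k'), hk'.symm⟩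

end

end part2

section part3

/-! ### Part 4: the core statement and cyclic constructions -/

def Core (q r : ℕ) : Prop :=
  ∃ (V ι : Type) (_ : Fintype V) (_ : Fintype ι) (B : ι → Blk V (2 * q + 1) r),
    Fintype.card V = 2 * r + (2 * q + 1) ∧ Fintype.card ι = 2 * (2 * r + 2 * q) ∧ Covers B

theorem core_cyclic {q r : ℕ} (hq : 1 ≤ q) (P : OPiece ℕ q r)
    (hlt : ∀ i < 2 * q + 2 * r, P.v i < 2 * q + 2 * r)
    (hlt' : ∀ i < 2 * q + 2 * r, P.v' i < 2 * q + 2 * r)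
    (hd : ∀ d, 0 < d → d < 2 * q + 2 * r →
      ∃ u w, P.Cov u w ∧ (w = u + d ∨ w + (2 * q + 2 * r) = u + d)) : Core q r := by
  have : NeZero (2 * q + 2 * r) := ⟨by omega⟩
  have hcast : ∀ a < 2 * q + 2 * r, ∀ b < 2 * q + 2 * r,
      ((a : ℕ) : ZMod (2 * q + 2 * r)) = (b : ℕ) → a = b := by
    intro a ha b hb h
    rw [ZMod.natCast_eq_natCast_iff'] at h
    rwa [Nat.mod_eq_of_lt ha, Nat.mod_eq_of_lt hb] at h
  let Q : ZMod (2 * q + 2 * r) → OPiece (ZMod (2 * q + 2 * r)) q r := fun k =>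
    { v := fun i => k + (P.v i : ℕ)
      v' := fun i => k + (P.v' i : ℕ)
      agree := fun i hi => by rw [P.agree i hi]
      inj := fun i hi j hj h => P.inj i hi j hj
        (hcast _ (hlt i hi) _ (hlt j hj) (add_left_cancel h))
      inj' := fun i hi j hj h => P.inj' i hi j hj
        (hcast _ (hlt' i hi) _ (hlt' j hj) (add_left_cancel h))
      o := P.o }
  have hQ : ∀ k u w, P.Cov u w → (Q k).Cov (k + (u : ℕ)) (k + (w : ℕ)) := by
    rintro k u w (⟨i, hi, ⟨ho, rfl, rfl⟩ | ⟨ho, rfl, rfl⟩⟩ | ⟨j, hj, rfl, rfl⟩ | ⟨j, hj, rfl, rfl⟩)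
    · exact Or.inl ⟨i, hi, Or.inl ⟨ho, rfl, rfl⟩⟩
    · exact Or.inl ⟨i, hi, Or.inr ⟨ho, rfl, rfl⟩⟩
    · exact Or.inr (Or.inl ⟨j, hj, rfl, rfl⟩)
    · exact Or.inr (Or.inr ⟨j, hj, rfl, rfl⟩)
  obtain ⟨B, hB⟩ := core_of_pieces hq Q
    (by
      intro u w huw
      obtain ⟨a, b, hab, h⟩ := hd (w - u).val
        (by
          rw [Nat.pos_iff_ne_zero, Ne, ZMod.val_eq_zero, sub_eq_zero]
          exact fun h => huw h.symm)
        (ZMod.val_lt _)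
      refine ⟨u - (a : ℕ), ?_⟩
      have h1 := hQ (u - (a : ℕ)) a b hab
      have h2 : (b : ZMod (2 * q + 2 * r)) = (a : ℕ) + (w - u) := by
        rcases h with h | h
        · rw [h]; push_cast; simp
        · have := congrArg (Nat.cast : ℕ → ZMod (2 * q + 2 * r)) h
          rw [Nat.cast_add b, ZMod.natCast_self, add_zero] at this
          rw [this]; push_cast; simp
      rw [h2] at h1
      convert h1 using 1 <;> ring)
    (fun u => ⟨u - (P.v 0 : ℕ), by simp [Q]⟩)
    (fun u => ⟨u - (P.v (2 * q - 1) : ℕ), by simp [Q]⟩)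
  refine ⟨_, _, inferInstance, inferInstance, B, ?_, ?_, hB⟩
  · simp [ZMod.card]; omega
  · simp [ZMod.card]; omega

/-- The gap lemma: a short path together with two matchings, extended by a graceful path. -/
theorem core_gap {q r k L : ℕ} (hq : 1 ≤ q) (hk : 1 ≤ k) (hkL : 2 * q = k + L) (F F' : ℕ → ℕ)
    (hag : ∀ i < k, F' i = F i)
    (hlt : ∀ i < k + 2 * r, F i < k + 2 * r) (hlt' : ∀ i < k + 2 * r, F' i < k + 2 * r)
    (hinj : ∀ i < k + 2 * r, ∀ j < k + 2 * r, F i = F j → i = j)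
    (hinj' : ∀ i < k + 2 * r, ∀ j < k + 2 * r, F' i = F' j → i = j)
    (hd : ∀ u, 0 < u → u < k + 2 * r →
      (∃ i, i + 1 < k ∧ (F (i + 1) = F i + u ∨ F i = F (i + 1) + u)) ∨
      (∃ j < r, F (k + 2 * j + 1) = F (k + 2 * j) + u) ∨
      (∃ j < r, F' (k + 2 * j + 1) = F' (k + 2 * j) + u))
    (g : ℕ → ℕ) (hg0 : 0 < L → g 0 = F (k - 1)) (hglt : ∀ i < L, g i < L)
    (hginj : ∀ i < L, ∀ j < L, g i = g j → i = j)
    (hgd : ∀ u, 0 < u → u < L → ∃ i, i + 1 < L ∧ (g (i + 1) = g i + u ∨ g i = g (i + 1) + u)) :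
    Core q r := by
  let W : (ℕ → ℕ) → ℕ → ℕ := fun F i =>
    if i < k then F i else if i < 2 * q then 2 * r + k + g (i - k) else F (i - 2 * q + k)
  have hW : ∀ F : ℕ → ℕ, (∀ i < k + 2 * r, F i < k + 2 * r) →
      (∀ i < k + 2 * r, ∀ j < k + 2 * r, F i = F j → i = j) →
      (∀ i < 2 * q + 2 * r, W F i < 2 * q + 2 * r) ∧
      ∀ i < 2 * q + 2 * r, ∀ j < 2 * q + 2 * r, W F i = W F j → i = j := by
    intro F hlt hinj
    have b1 : ∀ i, i < k → W F i = F i := fun i hi => by simp [W, hi]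
    have b2 : ∀ i, ¬ i < k → i < 2 * q → W F i = 2 * r + k + g (i - k) := fun i hi h => by
      simp [W, hi, h]
    have b3 : ∀ i, ¬ i < 2 * q → W F i = F (i - 2 * q + k) := fun i h => by
      have hi : ¬ i < k := by omega
      simp [W, hi, h]
    refine ⟨fun i hi => ?_, fun i hi j hj h => ?_⟩
    · by_cases h1 : i < k
      · rw [b1 i h1]; have := hlt i (by omega); omega
      · by_cases h2 : i < 2 * q
        · rw [b2 i h1 h2]; have := hglt (i - k) (by omega); omega
        · rw [b3 i h2]; have := hlt (i - 2 * q + k) (by omega); omega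
    · by_cases h1 : i < k
      · rw [b1 i h1] at h
        have l1 := hlt i (by omega)
        by_cases h3 : j < k
        · rw [b1 j h3] at h; exact hinj i (by omega) j (by omega) h
        · by_cases h4 : j < 2 * q
          · rw [b2 j h3 h4] at h; omega
          · rw [b3 j h4] at h; have := hinj i (by omega) _ (by omega) h; omega
      · by_cases h2 : i < 2 * q
        · rw [b2 i h1 h2] at h
          by_cases h3 : j < k
          · rw [b1 j h3] at h; have := hlt j (by omega); omega
          · by_cases h4 : j < 2 * q
            · rw [b2 j h3 h4] at h
              have := hginj (i - k) (by omega) (j - k) (by omega) (by omega); omega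
            · rw [b3 j h4] at h; have := hlt (j - 2 * q + k) (by omega); omega
        · rw [b3 i h2] at h
          have l1 := hlt (i - 2 * q + k) (by omega)
          by_cases h3 : j < k
          · rw [b1 j h3] at h; have := hinj _ (by omega) j (by omega) h; omega
          · by_cases h4 : j < 2 * q
            · rw [b2 j h3 h4] at h; omega
            · rw [b3 j h4] at h; have := hinj _ (by omega) _ (by omega) h; omega
  let P : OPiece ℕ q r :=
    { v := W F
      v' := W F'
      agree := by
        intro i hi
        by_cases h1 : i < k
        · simp only [W, h1, if_true]; exact hag i h1
        · simp only [W, h1, hi, if_true, if_false]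
      inj := (hW F hlt hinj).2
      inj' := (hW F' hlt' hinj').2
      o := fun i => if i + 1 < k then decide (F i < F (i + 1)) else
        if i + 1 = k then true else decide (W F (i + 1) < W F i) }
  refine core_cyclic hq P (hW F hlt hinj).1 (hW F' hlt' hinj').1 ?_
  intro d hd0 hd1
  rcases lt_trichotomy d (k + 2 * r) with h | h | h
  · rcases hd d hd0 h with ⟨i, hi, h1⟩ | ⟨j, hj, h1⟩ | ⟨j, hj, h1⟩
    · have e1 : W F i = F i := by simp [W, show i < k by omega]
      have e2 : W F (i + 1) = F (i + 1) := by simp [W, hi]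
      rcases h1 with h1 | h1
      · refine ⟨F i, F (i + 1), Or.inl ⟨i, by omega, Or.inl ⟨?_, e1.symm, e2.symm⟩⟩, Or.inl h1⟩
        have : F i < F (i + 1) := by omega
        simp [P, hi, this]
      · refine ⟨F (i + 1), F i, Or.inl ⟨i, by omega, Or.inr ⟨?_, e1.symm, e2.symm⟩⟩, Or.inl h1⟩
        have : ¬ F i < F (i + 1) := by omega
        simp only [P, hi, this, if_true]; rfl
    · refine ⟨F (k + 2 * j), F (k + 2 * j + 1), Or.inr (Or.inl ⟨j, hj, ?_, ?_⟩), Or.inl h1⟩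
      · have a1 : ¬ 2 * q + 2 * j < k := by omega
        have a2 : ¬ 2 * q + 2 * j < 2 * q := by omega
        simp only [P, W, a1, a2, if_false]; congr 1; omega
      · have a1 : ¬ 2 * q + 2 * j + 1 < k := by omega
        have a2 : ¬ 2 * q + 2 * j + 1 < 2 * q := by omega
        simp only [P, W, a1, a2, if_false]; congr 1; omega
    · refine ⟨F' (k + 2 * j), F' (k + 2 * j + 1), Or.inr (Or.inr ⟨j, hj, ?_, ?_⟩), Or.inl h1⟩
      · have a1 : ¬ 2 * q + 2 * j < k := by omega
        have a2 : ¬ 2 * q + 2 * j < 2 * q := by omega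
        simp only [P, W, a1, a2, if_false]; congr 1; omega
      · have a1 : ¬ 2 * q + 2 * j + 1 < k := by omega
        have a2 : ¬ 2 * q + 2 * j + 1 < 2 * q := by omega
        simp only [P, W, a1, a2, if_false]; congr 1; omega
  · refine ⟨W F (k - 1), W F k, Or.inl ⟨k - 1, by omega, Or.inl ⟨?_, rfl, ?_⟩⟩, Or.inl ?_⟩
    · have a1 : ¬ k - 1 + 1 < k := by omega
      have a2 : k - 1 + 1 = k := by omega
      simp only [P, a1, a2, if_true, if_false, lt_irrefl]
    · show W F k = W F (k - 1 + 1)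
      congr 1; omega
    · have a1 : k - 1 < k := by omega
      have a2 : k < 2 * q := by omega
      simp only [W, a1, a2, if_true, if_false, lt_irrefl, Nat.sub_self]
      rw [hg0 (by omega)]; omega
  · obtain ⟨i, hi, h1⟩ := hgd (2 * q + 2 * r - d) (by omega) (by omega)
    have e1 : W F (k + i) = 2 * r + k + g i := by
      have a1 : ¬ k + i < k := by omega
      have a2 : k + i < 2 * q := by omega
      simp only [W, a1, a2, if_true, if_false, Nat.add_sub_cancel_left]
    have e2 : W F (k + i + 1) = 2 * r + k + g (i + 1) := by
      have a1 : ¬ k + (i + 1) < k := by omega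
      have a2 : k + (i + 1) < 2 * q := by omega
      rw [add_assoc]
      simp only [W, a1, a2, if_true, if_false, Nat.add_sub_cancel_left]
    have a1 : ¬ k + i + 1 < k := by omega
    have a2 : ¬ k + i + 1 = k := by omega
    rcases h1 with h1 | h1
    · refine ⟨W F (k + i + 1), W F (k + i), Or.inl ⟨k + i, by omega, Or.inr ⟨?_, rfl, rfl⟩⟩,
        Or.inr ?_⟩
      · have : ¬ W F (k + i + 1) < W F (k + i) := by omega
        simp only [P, a1, a2, this, if_false]; rfl
      · omega
    · refine ⟨W F (k + i), W F (k + i + 1), Or.inl ⟨k + i, by omega, Or.inl ⟨?_, rfl, rfl⟩⟩,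
        Or.inr ?_⟩
      · have : W F (k + i + 1) < W F (k + i) := by omega
        simp only [P, a1, a2, this, if_false]; rfl
      · omega

end part3

section part4

/-! ### Part 5: graceful paths with a prescribed end -/

structure AP (L x : ℕ) (g : ℕ → ℕ) : Prop where
  g0 : g 0 = x
  lt : ∀ i < L, g i < L
  inj : ∀ i < L, ∀ j < L, g i = g j → i = j
  low : ∀ i < L, i % 2 = 0 → 2 * g i < L
  high : ∀ i < L, i % 2 = 1 → L ≤ 2 * g i
  val : ∀ u, 0 < u → u < L → ∃ i, i + 1 < L ∧ (g (i + 1) = g i + u ∨ g i = g (i + 1) + u)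

lemma AP.dual {L x : ℕ} {g : ℕ → ℕ} (h : AP L x g) (hx : 2 * x < L) :
    ∃ g', AP L ((L + 1) / 2 - 1 - x) g' := by
  refine ⟨fun i => if i % 2 = 0 then (L + 1) / 2 - 1 - g i else L - 1 + (L + 1) / 2 - g i,
    ⟨?_, ?_, ?_, ?_, ?_, ?_⟩⟩
  · simp [h.g0]
  · intro i hi
    have := h.low i hi
    have := h.high i hi
    have := h.lt i hi
    split_ifs <;> omega
  · intro i hi j hj hij
    have := h.low i hi
    have := h.high i hi
    have := h.lt i hi
    have := h.low j hj
    have := h.high j hj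
    have := h.lt j hj
    apply h.inj i hi j hj
    split_ifs at hij <;> omega
  · intro i hi h0
    have := h.low i hi h0
    simp only [h0, if_true]; omega
  · intro i hi h1
    have := h.high i hi h1
    have := h.lt i hi
    have h0 : ¬ i % 2 = 0 := by omega
    simp only [h0, if_false]; omega
  · intro u hu huL
    obtain ⟨i, hi, hv⟩ := h.val (L - u) (by omega) (by omega)
    refine ⟨i, hi, ?_⟩
    have := h.low i (by omega)
    have := h.high i (by omega)
    have := h.lt i (by omega)
    have := h.low (i + 1) hi
    have := h.high (i + 1) hi
    have := h.lt (i + 1) hi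
    split_ifs <;> omega

lemma AP.step2 {L x : ℕ} (hL : 4 * x + 2 ≤ L) {g : ℕ → ℕ} (h : AP (L - 2 * x - 1) x g) :
    ∃ g', AP L x g' := by
  refine ⟨fun i => if i < 2 * x + 1 then (if i % 2 = 0 then x - i / 2 else L - x + i / 2)
    else L - x - 1 - g (i - (2 * x + 1)), ⟨?_, ?_, ?_, ?_, ?_, ?_⟩⟩
  · simp
  · intro i hi
    split_ifs <;> omega
  · intro i hi j hj hij
    by_cases h1 : i < 2 * x + 1
    · by_cases h2 : j < 2 * x + 1
      · simp only [h1, h2, if_true] at hij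
        split_ifs at hij <;> omega
      · have := h.lt (j - (2 * x + 1)) (by omega)
        simp only [h1, h2, if_true, if_false] at hij
        split_ifs at hij <;> omega
    · have := h.lt (i - (2 * x + 1)) (by omega)
      by_cases h2 : j < 2 * x + 1
      · simp only [h1, h2, if_true, if_false] at hij
        split_ifs at hij <;> omega
      · have := h.lt (j - (2 * x + 1)) (by omega)
        simp only [h1, h2, if_false] at hij
        have := h.inj (i - (2 * x + 1)) (by omega) (j - (2 * x + 1)) (by omega) (by omega)
        omega
  · intro i hi h0
    by_cases h1 : i < 2 * x + 1
    · simp only [h1, h0, if_true]; omega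
    · have := h.high (i - (2 * x + 1)) (by omega) (by omega)
      simp only [h1, if_false]; omega
  · intro i hi h0
    have h00 : ¬ i % 2 = 0 := by omega
    by_cases h1 : i < 2 * x + 1
    · simp only [h1, h00, if_true, if_false]; omega
    · have := h.low (i - (2 * x + 1)) (by omega) (by omega)
      simp only [h1, if_false]; omega
  · intro u hu huL
    rcases lt_trichotomy u (L - 2 * x - 1) with hc | hc | hc
    · obtain ⟨i, hi, hv⟩ := h.val u hu hc
      have := h.lt i (by omega)
      have := h.lt (i + 1) (by omega)
      refine ⟨i + (2 * x + 1), by omega, ?_⟩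
      have a1 : ¬ i + (2 * x + 1) + 1 < 2 * x + 1 := by omega
      have a2 : ¬ i + (2 * x + 1) < 2 * x + 1 := by omega
      have a3 : i + (2 * x + 1) + 1 - (2 * x + 1) = i + 1 := by omega
      simp only [a1, a2, if_false, a3, Nat.add_sub_cancel]
      omega
    · refine ⟨2 * x, by omega, ?_⟩
      have a1 : ¬ 2 * x + 1 < 2 * x + 1 := by omega
      have a2 : 2 * x < 2 * x + 1 := by omega
      have a3 : 2 * x % 2 = 0 := by omega
      simp only [a1, a2, a3, if_true, if_false, Nat.sub_self, h.g0]
      omega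
    · refine ⟨u - (L - 2 * x), by omega, ?_⟩
      have a1 : u - (L - 2 * x) + 1 < 2 * x + 1 := by omega
      have a2 : u - (L - 2 * x) < 2 * x + 1 := by omega
      simp only [a1, a2, if_true]
      split_ifs <;> omega

lemma AP.step1 {L x : ℕ} (hL : L = 6 * x + 2) (hx : 1 ≤ x) {g : ℕ → ℕ} (h : AP (4 * x) x g) :
    ∃ g', AP L x g' := by
  refine ⟨fun i => if i < 2 * x + 2 then (if i % 2 = 0 then x - i / 2 else L - 1 - x + i / 2)
    else x + 1 + g (i - (2 * x + 2)), ⟨?_, ?_, ?_, ?_, ?_, ?_⟩⟩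
  · simp
  · intro i hi
    by_cases h1 : i < 2 * x + 2
    · simp only [h1, if_true]
      split_ifs <;> omega
    · have := h.lt (i - (2 * x + 2)) (by omega)
      simp only [h1, if_false]; omega
  · intro i hi j hj hij
    by_cases h1 : i < 2 * x + 2
    · by_cases h2 : j < 2 * x + 2
      · simp only [h1, h2, if_true] at hij
        split_ifs at hij <;> omega
      · have := h.lt (j - (2 * x + 2)) (by omega)
        simp only [h1, h2, if_true, if_false] at hij
        split_ifs at hij <;> omega
    · have := h.lt (i - (2 * x + 2)) (by omega)
      by_cases h2 : j < 2 * x + 2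
      · simp only [h1, h2, if_true, if_false] at hij
        split_ifs at hij <;> omega
      · have := h.lt (j - (2 * x + 2)) (by omega)
        simp only [h1, h2, if_false] at hij
        have := h.inj (i - (2 * x + 2)) (by omega) (j - (2 * x + 2)) (by omega) (by omega)
        omega
  · intro i hi h0
    by_cases h1 : i < 2 * x + 2
    · simp only [h1, h0, if_true]; omega
    · have := h.low (i - (2 * x + 2)) (by omega) (by omega)
      simp only [h1, if_false]; omega
  · intro i hi h0
    have h00 : ¬ i % 2 = 0 := by omega
    by_cases h1 : i < 2 * x + 2
    · simp only [h1, h00, if_true, if_false]; omega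
    · have := h.high (i - (2 * x + 2)) (by omega) (by omega)
      simp only [h1, if_false]; omega
  · intro u hu huL
    rcases lt_trichotomy u (4 * x) with hc | hc | hc
    · obtain ⟨i, hi, hv⟩ := h.val u hu hc
      refine ⟨i + (2 * x + 2), by omega, ?_⟩
      have a1 : ¬ i + (2 * x + 2) + 1 < 2 * x + 2 := by omega
      have a2 : ¬ i + (2 * x + 2) < 2 * x + 2 := by omega
      have a3 : i + (2 * x + 2) + 1 - (2 * x + 2) = i + 1 := by omega
      simp only [a1, a2, if_false, a3, Nat.add_sub_cancel]
      omega
    · refine ⟨2 * x + 1, by omega, ?_⟩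
      have a1 : ¬ 2 * x + 1 + 1 < 2 * x + 2 := by omega
      have a2 : 2 * x + 1 < 2 * x + 2 := by omega
      have a3 : ¬ (2 * x + 1) % 2 = 0 := by omega
      have a4 : 2 * x + 1 + 1 - (2 * x + 2) = 0 := by omega
      simp only [a1, a2, a3, a4, if_true, if_false, h.g0]
      omega
    · refine ⟨u - (4 * x + 1), by omega, ?_⟩
      have a1 : u - (4 * x + 1) + 1 < 2 * x + 2 := by omega
      have a2 : u - (4 * x + 1) < 2 * x + 2 := by omega
      simp only [a1, a2, if_true]
      split_ifs <;> omega

theorem AP.exists (L : ℕ) : ∀ x, 2 * x < L → (L ≠ 4 * x + 1 ∨ x = 0) → ∃ g, AP L x g := by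
  induction L using Nat.strong_induction_on with
  | _ L ih =>
    have main : ∀ x, 4 * x + 2 ≤ L → ∃ g, AP L x g := by
      intro x hx
      by_cases h : L = 6 * x + 2 ∧ 1 ≤ x
      · obtain ⟨g, hg⟩ := ih (4 * x) (by omega) x (by omega) (by omega)
        exact AP.step1 h.1 h.2 hg
      · obtain ⟨g, hg⟩ := ih (L - 2 * x - 1) (by omega) x (by omega) (by omega)
        exact AP.step2 hx hg
    intro x hx hne
    by_cases h1 : L = 1
    · subst h1
      obtain rfl : x = 0 := by omega
      exact ⟨fun _ => 0, ⟨rfl, by intros; omega, by intros; omega, by intros; omega,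
        by intros; omega, by intros; omega⟩⟩
    by_cases h : 4 * x + 2 ≤ L
    · exact main x h
    · obtain ⟨g, hg⟩ := main ((L + 1) / 2 - 1 - x) (by omega)
      have := hg.dual (by omega)
      have e : (L + 1) / 2 - 1 - ((L + 1) / 2 - 1 - x) = x := by omega
      rwa [e] at this

theorem graceful_even {L x : ℕ} (hL : L % 2 = 0) (hx : x < L) :
    ∃ g : ℕ → ℕ, g 0 = x ∧ (∀ i < L, g i < L) ∧
      (∀ i < L, ∀ j < L, g i = g j → i = j) ∧
      (∀ u, 0 < u → u < L → ∃ i, i + 1 < L ∧ (g (i + 1) = g i + u ∨ g i = g (i + 1) + u)) := by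
  by_cases h : 2 * x < L
  · obtain ⟨g, hg⟩ := AP.exists L x h (by omega)
    exact ⟨g, hg.g0, hg.lt, hg.inj, hg.val⟩
  · obtain ⟨g, hg⟩ := AP.exists L (L - 1 - x) (by omega) (by omega)
    refine ⟨fun i => L - 1 - g i, ?_, ?_, ?_, ?_⟩
    · have := hg.g0
      try dsimp only
      omega
    · intro i hi
      try dsimp only
      omega
    · intro i hi j hj hij
      have := hg.lt i hi
      have := hg.lt j hj
      exact hg.inj i hi j hj (by simp only at hij; omega)
    · intro u hu huL
      obtain ⟨i, hi, hv⟩ := hg.val u hu huL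
      have := hg.lt i (by omega)
      have := hg.lt (i + 1) hi
      refine ⟨i, hi, ?_⟩
      try dsimp only
      omega

end part4

section part5

/-! ### Part 6: the cases `r = 2`, and `r ≥ 3` with `2 q > r` -/

theorem core_C {q : ℕ} (hq : 2 ≤ q) : Core q 2 := by
  obtain ⟨g, h0, h1, h2, h3⟩ : ∃ g : ℕ → ℕ, (0 < 2 * q - 4 → g 0 = 1) ∧
      (∀ i < 2 * q - 4, g i < 2 * q - 4) ∧
      (∀ i < 2 * q - 4, ∀ j < 2 * q - 4, g i = g j → i = j) ∧
      (∀ u, 0 < u → u < 2 * q - 4 → ∃ i, i + 1 < 2 * q - 4 ∧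
        (g (i + 1) = g i + u ∨ g i = g (i + 1) + u)) := by
    by_cases h : q = 2
    · subst h
      exact ⟨id, by intros; omega, by intros; omega, by intros; omega, by intros; omega⟩
    · obtain ⟨g, h0, h1, h2, h3⟩ := graceful_even (L := 2 * q - 4) (x := 1) (by omega) (by omega)
      exact ⟨g, fun _ => h0, h1, h2, h3⟩
  refine core_gap (k := 4) (L := 2 * q - 4) (by omega) (by omega) (by omega)
    (fun i => [5, 3, 4, 1, 0, 6, 2, 7].getD i 0) (fun i => [5, 3, 4, 1, 2, 6, 0, 7].getD i 0)
    (by decide) (by decide) (by decide) (by decide) (by decide) ?_ g h0 h1 h2 h3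
  intro u hu hu8
  have : u < 8 := hu8
  interval_cases u
  · exact Or.inl ⟨1, by decide⟩
  · exact Or.inl ⟨0, by decide⟩
  · exact Or.inl ⟨2, by decide⟩
  · exact Or.inr (Or.inr ⟨0, by decide⟩)
  · exact Or.inr (Or.inl ⟨1, by decide⟩)
  · exact Or.inr (Or.inl ⟨0, by decide⟩)
  · exact Or.inr (Or.inr ⟨1, by decide⟩)

/-- A two-regular bipartite graph splits into two perfect matchings. -/
theorem split_two (S : Finset ℕ) (f g A B : ℕ → ℕ) (hf : ∀ x ∈ S, f x ∈ S) (hg : ∀ x ∈ S, g x ∈ S)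
    (hne : ∀ x ∈ S, f x ≠ g x)
    (hA : ∀ x ∈ S, ∀ y, (y = f x ∨ y = g x) → x = A y ∨ x = B y) :
    ∃ σ τ : ℕ → ℕ, (∀ x ∈ S, (σ x = f x ∧ τ x = g x) ∨ (σ x = g x ∧ τ x = f x)) ∧
      (∀ x ∈ S, ∀ y ∈ S, σ x = σ y → x = y) ∧ (∀ x ∈ S, ∀ y ∈ S, τ x = τ y → x = y) := by
  classical
  let t : S → Finset ℕ := fun x => {f x, g x}
  have hall : ∀ s : Finset S, s.card ≤ (s.biUnion t).card := by
    intro s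
    have := Finset.card_mul_le_card_mul (s := s) (t := s.biUnion t) (m := 2) (n := 2)
      (fun (x : S) (y : ℕ) => y ∈ t x)
      (by
        intro x hx
        have : t x ⊆ (s.biUnion t).bipartiteAbove (fun (x : S) (y : ℕ) => y ∈ t x) x := by
          intro y hy
          simp only [Finset.mem_bipartiteAbove, Finset.mem_biUnion]
          exact ⟨⟨x, hx, hy⟩, hy⟩
        have h2 := Finset.card_le_card this
        rwa [Finset.card_pair (hne x x.2)] at h2)
      (by
        intro y hy
        have : (s.bipartiteBelow (fun (x : S) (y : ℕ) => y ∈ t x) y).map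
            (Function.Embedding.subtype _) ⊆ {A y, B y} := by
          intro x hx
          simp only [Finset.mem_map, Finset.mem_bipartiteBelow] at hx
          obtain ⟨z, ⟨-, hz⟩, rfl⟩ := hx
          have := hA z z.2 y (by simpa [t] using hz)
          simpa using this
        have h2 := Finset.card_le_card this
        rw [Finset.card_map] at h2
        exact h2.trans Finset.card_le_two)
    omega
  obtain ⟨s, hs, hst⟩ := (Finset.all_card_le_biUnion_card_iff_exists_injective t).1 hall
  have hst' : ∀ x : S, s x = f x ∨ s x = g x := fun x => by simpa [t] using hst x
  have hsS : ∀ x : S, s x ∈ S := fun x => by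
    rcases hst' x with h | h <;> rw [h]
    · exact hf _ x.2
    · exact hg _ x.2
  have hsurj : ∀ y ∈ S, ∃ x : S, s x = y := by
    have hinj : Function.Injective (fun x : S => (⟨s x, hsS x⟩ : S)) := by
      intro x y h
      exact hs (Subtype.ext_iff.1 h)
    have hsur := Finite.surjective_of_injective hinj
    intro y hy
    obtain ⟨x, hx⟩ := hsur ⟨y, hy⟩
    exact ⟨x, Subtype.ext_iff.1 hx⟩
  refine ⟨fun x => if h : x ∈ S then s ⟨x, h⟩ else 0,
    fun x => if h : x ∈ S then (if s ⟨x, h⟩ = f x then g x else f x) else 0, ?_, ?_, ?_⟩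
  · intro x hx
    have h1 := hst' ⟨x, hx⟩
    have h2 := hne x hx
    simp only [hx, dif_pos]
    by_cases h : s ⟨x, hx⟩ = f x
    · left; simp [h]
    · right; simp only [h, if_false]
      exact ⟨h1.resolve_left h, trivial⟩
  · intro x hx y hy h
    simp only [hx, hy, dif_pos] at h
    exact Subtype.ext_iff.1 (hs h)
  · intro x hx y hy h
    simp only [hx, hy, dif_pos] at h
    have key : ∀ x (hx : x ∈ S), ∃ z, z = (if s ⟨x, hx⟩ = f x then g x else f x) ∧
        (z = f x ∨ z = g x) ∧ s ⟨x, hx⟩ ≠ z ∧ z ∈ S := by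
      intro x hx
      have h1 := hst' ⟨x, hx⟩
      have h2 := hne x hx
      by_cases h : s ⟨x, hx⟩ = f x
      · exact ⟨g x, by simp [h], Or.inr rfl, by rw [h]; exact h2, hg x hx⟩
      · have h3 := h1.resolve_left h
        exact ⟨f x, by simp [h], Or.inl rfl, h, hf x hx⟩
    obtain ⟨z, hz, z1, z2, z3⟩ := key x hx
    obtain ⟨z', hz', z1', z2', -⟩ := key y hy
    obtain rfl : z = z' := by rw [hz, hz', h]
    obtain ⟨⟨w, hw⟩, hwz⟩ := hsurj z z3
    have hwx : w ≠ x := by rintro rfl; exact z2 hwz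
    have hwy : w ≠ y := by rintro rfl; exact z2' hwz
    have c1 := hA x hx z z1
    have c2 := hA y hy z z1'
    have c3 := hA w hw z (by rw [← hwz]; exact hst' ⟨w, hw⟩)
    omega

theorem core_B_aux {q r p : ℕ} (hq : 2 ≤ q) (hr : 1 ≤ r) (hp : p ≤ r) (hpL : p < 2 * q - 2)
    (f g A B : ℕ → ℕ)
    (hf : ∀ x, x ≤ r → x ≠ p → f x ≤ r ∧ f x ≠ p) (hg : ∀ x, x ≤ r → x ≠ p → g x ≤ r ∧ g x ≠ p)
    (hne : ∀ x, x ≤ r → x ≠ p → f x ≠ g x)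
    (hA : ∀ x, x ≤ r → x ≠ p → ∀ y, (y = f x ∨ y = g x) → x = A y ∨ x = B y)
    (hd : ∀ d, 0 < d → d < 2 * r + 2 → d ≠ r + 1 → ∃ x, x ≤ r ∧ x ≠ p ∧
      (r + 1 + f x = x + d ∨ r + 1 + g x = x + d)) : Core q r := by
  obtain ⟨σ, τ, h1, h2, h3⟩ := split_two ((Finset.range (r + 1)).erase p) f g A B
    (by
      intro x hx
      simp only [Finset.mem_erase, Finset.mem_range] at hx ⊢
      have := hf x (by omega) hx.1; omega)
    (by
      intro x hx
      simp only [Finset.mem_erase, Finset.mem_range] at hx ⊢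
      have := hg x (by omega) hx.1; omega)
    (by
      intro x hx
      simp only [Finset.mem_erase, Finset.mem_range] at hx
      exact hne x (by omega) hx.1)
    (by
      intro x hx
      simp only [Finset.mem_erase, Finset.mem_range] at hx
      exact hA x (by omega) hx.1)
  simp only [Finset.mem_erase, Finset.mem_range] at h1 h2 h3
  obtain ⟨G, g0, g1, g2, g3⟩ := graceful_even (L := 2 * q - 2) (x := p) (by omega) hpL
  let e : ℕ → ℕ := fun j => if j < p then j else j + 1
  have he : ∀ j < r, e j ≠ p ∧ e j < r + 1 := by
    intro j hj; simp only [e]; split_ifs <;> omega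
  have heinj : ∀ i j, e i = e j → i = j := by
    intro i j h; simp only [e] at h; split_ifs at h <;> omega
  have hesurj : ∀ x, x ≤ r → x ≠ p → ∃ j < r, e j = x := by
    intro x hx hxp
    by_cases h : x < p
    · exact ⟨x, by omega, by simp [e, h]⟩
    · refine ⟨x - 1, by omega, ?_⟩
      have : ¬ x - 1 < p := by omega
      simp only [e, this, if_false]; omega
  let F : (ℕ → ℕ) → ℕ → ℕ := fun σ i => if i = 0 then p + r + 1 else if i = 1 then p else
    if i % 2 = 0 then e ((i - 2) / 2) else r + 1 + σ (e ((i - 2) / 2))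
  have F0 : ∀ σ, F σ 0 = p + r + 1 := fun σ => by simp [F]
  have F1 : ∀ σ, F σ 1 = p := fun σ => by simp [F]
  have Fe : ∀ σ j, F σ (2 + 2 * j) = e j := fun σ j => by
    have a1 : ¬ 2 + 2 * j = 0 := by omega
    have a2 : ¬ 2 + 2 * j = 1 := by omega
    have a3 : (2 + 2 * j) % 2 = 0 := by omega
    have a4 : (2 + 2 * j - 2) / 2 = j := by omega
    simp only [F, a1, a2, a3, a4, if_true, if_false]
  have Fo : ∀ σ j, F σ (2 + 2 * j + 1) = r + 1 + σ (e j) := fun σ j => by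
    have a1 : ¬ 2 + 2 * j + 1 = 0 := by omega
    have a2 : ¬ 2 + 2 * j + 1 = 1 := by omega
    have a3 : ¬ (2 + 2 * j + 1) % 2 = 0 := by omega
    have a4 : (2 + 2 * j + 1 - 2) / 2 = j := by omega
    simp only [F, a1, a2, a3, a4, if_false]
  have hcase : ∀ i < 2 + 2 * r, i = 0 ∨ i = 1 ∨ (∃ j < r, i = 2 + 2 * j) ∨
      (∃ j < r, i = 2 + 2 * j + 1) := by
    intro i hi
    by_cases h0 : i = 0
    · exact Or.inl h0
    by_cases h1 : i = 1
    · exact Or.inr (Or.inl h1)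
    rcases Nat.mod_two_eq_zero_or_one i with h | h
    · exact Or.inr (Or.inr (Or.inl ⟨(i - 2) / 2, by omega, by omega⟩))
    · exact Or.inr (Or.inr (Or.inr ⟨(i - 2) / 2, by omega, by omega⟩))
  have hFlt : ∀ σ : ℕ → ℕ, (∀ x, x ≠ p ∧ x < r + 1 → σ x < r + 1) →
      ∀ i < 2 + 2 * r, F σ i < 2 + 2 * r := by
    intro σ hσ i hi
    rcases hcase i hi with rfl | rfl | ⟨j, hj, rfl⟩ | ⟨j, hj, rfl⟩
    · rw [F0]; omega
    · rw [F1]; omega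
    · rw [Fe]; have := he j hj; omega
    · rw [Fo]; have := hσ _ (he j hj); omega
  have hFinj : ∀ σ : ℕ → ℕ, (∀ x, x ≠ p ∧ x < r + 1 → σ x < r + 1 ∧ σ x ≠ p) →
      (∀ x, x ≠ p ∧ x < r + 1 → ∀ y, y ≠ p ∧ y < r + 1 → σ x = σ y → x = y) →
      ∀ i < 2 + 2 * r, ∀ j < 2 + 2 * r, F σ i = F σ j → i = j := by
    intro σ hσ hσi i hi j hj h
    rcases hcase i hi with rfl | rfl | ⟨i, hi, rfl⟩ | ⟨i, hi, rfl⟩ <;>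
    rcases hcase j hj with rfl | rfl | ⟨j, hj, rfl⟩ | ⟨j, hj, rfl⟩ <;>
    simp only [F0, F1, Fe, Fo] at h <;>
    (try have b1 := he i (by assumption)) <;>
    (try have b2 := he j (by assumption)) <;>
    (try have b3 := hσ _ b1) <;>
    (try have b4 := hσ _ b2) <;>
    first
    | omega
    | (have := heinj _ _ h; omega)
    | (have := heinj _ _ (hσi _ b1 _ b2 (by omega)); omega)
  have hσ : ∀ x, x ≠ p ∧ x < r + 1 → σ x < r + 1 ∧ σ x ≠ p := by
    intro x hx
    have := hf x (by omega) hx.1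
    have := hg x (by omega) hx.1
    have := h1 x hx
    omega
  have hτ : ∀ x, x ≠ p ∧ x < r + 1 → τ x < r + 1 ∧ τ x ≠ p := by
    intro x hx
    have := hf x (by omega) hx.1
    have := hg x (by omega) hx.1
    have := h1 x hx
    omega
  refine core_gap (k := 2) (L := 2 * q - 2) (by omega) (by omega) (by omega) (F σ) (F τ) ?_
    (hFlt σ fun x hx => (hσ x hx).1) (hFlt τ fun x hx => (hτ x hx).1)
    (hFinj σ hσ h2) (hFinj τ hτ h3) ?_ G (fun _ => by rw [g0]; exact (F1 σ).symm) g1 g2 g3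
  · intro i hi
    rcases (show i = 0 ∨ i = 1 by omega) with rfl | rfl
    · rw [F0, F0]
    · rw [F1, F1]
  · intro u hu hu2
    by_cases hur : u = r + 1
    · refine Or.inl ⟨0, by omega, Or.inr ?_⟩
      rw [F0, F1]; omega
    · obtain ⟨x, hx, hxp, h⟩ := hd u hu (by omega) hur
      obtain ⟨j, hj, rfl⟩ := hesurj x hx hxp
      have c := h1 _ (he j hj)
      have : r + 1 + σ (e j) = e j + u ∨ r + 1 + τ (e j) = e j + u := by omega
      rcases this with h | h
      · exact Or.inr (Or.inl ⟨j, hj, by rw [Fe, Fo]; exact h⟩)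
      · exact Or.inr (Or.inr ⟨j, hj, by rw [Fe, Fo]; exact h⟩)

theorem core_B {q r : ℕ} (hr : 3 ≤ r) (hqr : r < 2 * q) : Core q r := by
  obtain ⟨a, ha | ha⟩ : ∃ a, r = 2 * a + 1 ∨ r = 2 * a := ⟨r / 2, by omega⟩
  · refine core_B_aux (p := a) (by omega) (by omega) (by omega) (by omega)
      (fun x => if x < a then r - 1 - x else if x ≤ r - 2 then r - 2 - x else
        if x = r - 1 then r else 0)
      (fun x => if x < a then r - x else if x = a + 1 then a - 1 else
        if x = a + 2 then a + 1 else r + 1 - x)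
      (fun y => if y < a then (if y = a - 1 then a + 1 else r - 2 - y) else
        if y = r then r - 1 else r - 1 - y)
      (fun y => if y < a then (if y = 0 then r else r + 1 - y) else
        if y = a + 1 then a + 2 else r - y) ?_ ?_ ?_ ?_ ?_
    · intro x hx hxp; split_ifs <;> omega
    · intro x hx hxp; split_ifs <;> omega
    · intro x hx hxp; split_ifs <;> omega
    · intro x hx hxp y hy
      rcases hy with hy | hy <;> split_ifs at hy <;> split_ifs <;> omega
    · intro d hd0 hd1 hd2
      -- displacement `d - (r + 1)`
      rcases lt_or_gt_of_ne hd2 with h | h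
      · obtain ⟨t, ht⟩ : ∃ t, t + d = r + 1 := ⟨r + 1 - d, by omega⟩
        by_cases t1 : t = 1
        · refine ⟨a + 2, by omega, by omega, Or.inr ?_⟩
          split_ifs <;> omega
        by_cases t2 : t = 2
        · refine ⟨a + 1, by omega, by omega, Or.inr ?_⟩
          split_ifs <;> omega
        by_cases t3 : t = r
        · refine ⟨r, by omega, by omega, Or.inl ?_⟩
          split_ifs <;> omega
        rcases Nat.mod_two_eq_zero_or_one t with h2 | h2
        · refine ⟨(r + 1 + t) / 2, by omega, by omega, Or.inr ?_⟩
          split_ifs <;> omega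
        · refine ⟨(r - 2 + t) / 2, by omega, by omega, Or.inl ?_⟩
          split_ifs <;> omega
      · obtain ⟨t, ht⟩ : ∃ t, d = r + 1 + t := ⟨d - (r + 1), by omega⟩
        by_cases t1 : t = 1
        · refine ⟨r - 1, by omega, by omega, Or.inl ?_⟩
          split_ifs <;> omega
        rcases Nat.mod_two_eq_zero_or_one t with h2 | h2
        · refine ⟨(r - 1 - t) / 2, by omega, by omega, Or.inl ?_⟩
          split_ifs <;> omega
        · refine ⟨(r - t) / 2, by omega, by omega, Or.inr ?_⟩
          split_ifs <;> omega
  · refine core_B_aux (p := a) (by omega) (by omega) (by omega) (by omega)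
      (fun x => if x < a - 1 then r - 1 - x else if x = a - 1 then a - 2 else
        if x ≤ r - 2 then r - 2 - x else if x = r - 1 then r else 0)
      (fun x => if x < a then r - x else if x = a + 1 then a - 1 else r + 1 - x)
      (fun y => if y < a then (if y = a - 2 then a - 1 else if y = a - 1 then a + 1 else r - 2 - y)
        else if y = r then r - 1 else r - 1 - y)
      (fun y => if y < a then (if y = 0 then r else r + 1 - y) else r - y) ?_ ?_ ?_ ?_ ?_
    · intro x hx hxp; split_ifs <;> omega
    · intro x hx hxp; split_ifs <;> omega
    · intro x hx hxp; split_ifs <;> omega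
    · intro x hx hxp y hy
      rcases hy with hy | hy <;> split_ifs at hy <;> split_ifs <;> omega
    · intro d hd0 hd1 hd2
      rcases lt_or_gt_of_ne hd2 with h | h
      · obtain ⟨t, ht⟩ : ∃ t, t + d = r + 1 := ⟨r + 1 - d, by omega⟩
        by_cases t1 : t = 1
        · refine ⟨a - 1, by omega, by omega, Or.inl ?_⟩
          split_ifs <;> omega
        by_cases t2 : t = 2
        · refine ⟨a + 1, by omega, by omega, Or.inr ?_⟩
          split_ifs <;> omega
        by_cases t3 : t = r
        · refine ⟨r, by omega, by omega, Or.inl ?_⟩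
          split_ifs <;> omega
        rcases Nat.mod_two_eq_zero_or_one t with h2 | h2
        · refine ⟨(r - 2 + t) / 2, by omega, by omega, Or.inl ?_⟩
          split_ifs <;> omega
        · refine ⟨(r + 1 + t) / 2, by omega, by omega, Or.inr ?_⟩
          split_ifs <;> omega
      · obtain ⟨t, ht⟩ : ∃ t, d = r + 1 + t := ⟨d - (r + 1), by omega⟩
        by_cases t1 : t = 1
        · refine ⟨r - 1, by omega, by omega, Or.inl ?_⟩
          split_ifs <;> omega
        rcases Nat.mod_two_eq_zero_or_one t with h2 | h2
        · refine ⟨(r - t) / 2, by omega, by omega, Or.inr ?_⟩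
          split_ifs <;> omega
        · refine ⟨(r - 1 - t) / 2, by omega, by omega, Or.inl ?_⟩
          split_ifs <;> omega

end part5

section part6

/-! ### Part 7: the zigzag and the case `r = 1` -/

lemma int_cast_inj {p : ℕ} {a b : ℤ} (h : (a : ZMod p) = b) (h1 : a - b < p) (h2 : b - a < p) :
    a = b := by
  rw [ZMod.intCast_eq_intCast_iff_dvd_sub] at h
  have := Int.eq_zero_of_abs_lt_dvd h (abs_lt.2 ⟨by omega, by omega⟩)
  omega

def zz (j : ℕ) : ℤ := if j % 2 = 0 then ((j / 2 : ℕ) : ℤ) else -(((j + 1) / 2 : ℕ) : ℤ)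

lemma zz_even {j : ℕ} (h : j % 2 = 0) : zz (j + 1) = zz j - (j + 1) := by
  have : ¬ (j + 1) % 2 = 0 := by omega
  simp only [zz, h, this, if_true, if_false]; omega

lemma zz_odd {j : ℕ} (h : j % 2 = 1) : zz (j + 1) = zz j + (j + 1) := by
  have h0 : ¬ j % 2 = 0 := by omega
  have : (j + 1) % 2 = 0 := by omega
  simp only [zz, h0, this, if_true, if_false]; omega

lemma zz_inj {p i j : ℕ} (hi : i < p) (hj : j < p) (h : (zz i : ZMod p) = zz j) : i = j := by
  have : zz i = zz j := by
    apply int_cast_inj h <;> (simp only [zz]; split_ifs <;> omega)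
  simp only [zz] at this
  split_ifs at this <;> omega

def pieceD (q : ℕ) (i : ZMod (2 * q + 1)) : Piece (Option (ZMod (2 * q + 1))) q 1 where
  v j := if j = 2 * q + 1 then none else some (i + (zz j : ℤ))
  v' j := if j = 2 * q + 1 then none else some (i + (zz j : ℤ))
  agree _ _ := rfl
  inj := by
    intro a ha b hb h
    by_cases h1 : a = 2 * q + 1 <;> by_cases h2 : b = 2 * q + 1 <;> simp [h1, h2] at h ⊢
    exact zz_inj (by omega) (by omega) h
  inj' := by
    intro a ha b hb h
    by_cases h1 : a = 2 * q + 1 <;> by_cases h2 : b = 2 * q + 1 <;> simp [h1, h2] at h ⊢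
    exact zz_inj (by omega) (by omega) h
  cP j := decide (j % 2 = 0)
  cM _ := true
  cM' _ := false

def specD (q : ℕ) (b : Bool) : Blk (Option (Option (ZMod (2 * q + 1)))) (2 * q + 1) 1 where
  v j := if j = 2 * q + 1 then none else if j = 2 * q + 2 then some none else
    some (some ((j : ℕ) : ZMod (2 * q + 1)))
  x _ := b
  c _ := b
  inj := by
    intro i hi j hj h
    by_cases h1 : i = 2 * q + 1 <;> by_cases h2 : j = 2 * q + 1 <;>
    by_cases h3 : i = 2 * q + 2 <;> by_cases h4 : j = 2 * q + 2 <;> simp [h1, h2, h3, h4] at h ⊢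
    rw [ZMod.natCast_eq_natCast_iff'] at h
    rwa [Nat.mod_eq_of_lt (by omega), Nat.mod_eq_of_lt (by omega)] at h

theorem core_D {q : ℕ} (hq : 1 ≤ q) : Core q 1 := by
  have : NeZero (2 * q + 1) := ⟨by omega⟩
  let B : (ZMod (2 * q + 1) × Bool) ⊕ Bool →
      Blk (Option (Option (ZMod (2 * q + 1)))) (2 * q + 1) 1 :=
    Sum.elim (fun k => (pieceD q k.1).row k.2) (specD q)
  refine ⟨_, _, inferInstance, inferInstance, B, ?_, ?_, ?_⟩
  · simp only [Fintype.card_option, ZMod.card]; omega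
  · simp only [Fintype.card_sum, Fintype.card_prod, ZMod.card, Fintype.card_bool]; omega
  -- the point at infinity and a finite point
  have hinf : ∀ u a b, ∃ k, (B k).Cov none (some (some u)) a b ∨ (B k).Cov (some (some u)) none b a := by
    intro u a b
    cases a
    · obtain ⟨k, hk⟩ := (pieceD q (u - (zz (2 * q - 1) : ℤ))).cov_end hq b
      refine ⟨Sum.inl (u - (zz (2 * q - 1) : ℤ), k), Or.inr ?_⟩
      have e : (pieceD q (u - (zz (2 * q - 1) : ℤ))).v (2 * q - 1) = some u := by
        have : ¬ 2 * q - 1 = 2 * q + 1 := by omega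
        simp [pieceD, this]
      rw [e] at hk
      exact hk
    · obtain ⟨k, hk⟩ := (pieceD q u).cov_start hq b
      refine ⟨Sum.inl (u, k), Or.inl ?_⟩
      have e : (pieceD q u).v 0 = some u := by
        simp [pieceD, zz]
      rw [e] at hk
      exact hk
  have hinf' : ∀ u a b, ∃ k, (B k).Cov (some (some u)) (some none) a b := by
    intro u a b
    have e : (pieceD q (u - (zz (2 * q) : ℤ))).v (2 * q + 2 * 0) = some u := by
      simp [pieceD]
    have e' : (pieceD q (u - (zz (2 * q) : ℤ))).v (2 * q + 2 * 0 + 1) = none := by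
      simp [pieceD]
    by_cases h : true = (a == b)
    · have := (pieceD q (u - (zz (2 * q) : ℤ))).cov_M (j := 0) (by omega) (a := a) (b := b) h
      rw [e, e'] at this
      exact ⟨Sum.inl (_, false), this⟩
    · have := (pieceD q (u - (zz (2 * q) : ℤ))).cov_M' (j := 0) (by omega) (a := a) (b := b)
        (by revert h; simp [pieceD])
      change (Piece.row _ true).Cov (some ((pieceD q (u - (zz (2 * q) : ℤ))).v (2 * q + 2 * 0)))
        (some ((pieceD q (u - (zz (2 * q) : ℤ))).v (2 * q + 2 * 0 + 1))) a b at this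
      rw [e, e'] at this
      exact ⟨Sum.inl (_, true), this⟩
  have hii : ∀ a b, ∃ k, (B k).Cov none (some none) a b := by
    intro a b
    refine ⟨Sum.inr (a == b), Or.inr ⟨0, by omega, ?_, ?_, rfl⟩⟩
    · simp [B, specD]
    · simp [B, specD]
  have hspec : ∀ (u : ZMod (2 * q + 1)) b,
      ∃ k, (B k).Cov (some (some u)) (some (some (u + 1))) (!b) b := by
    intro u b
    have hu := ZMod.val_lt u
    refine ⟨Sum.inr b, Or.inl ⟨u.val, hu, ?_, rfl, ?_, rfl⟩⟩
    · have h1 : ¬ u.val = 2 * q + 1 := by omega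
      have h2 : ¬ u.val = 2 * q + 2 := by omega
      simp [B, specD, h1, h2]
    · have hm := Nat.mod_lt (u.val + 1) (show 0 < 2 * q + 1 by omega)
      have h1 : ¬ (u.val + 1) % (2 * q + 1) = 2 * q + 1 := by omega
      have h2 : ¬ (u.val + 1) % (2 * q + 1) = 2 * q + 2 := by omega
      simp [B, specD, h1, h2]
  have hpath : ∀ (u w : ZMod (2 * q + 1)) (j : ℕ) a b, j + 1 < 2 * q →
      ((j + 1 : ℕ) : ZMod (2 * q + 1)) = w - u → decide (j % 2 = 0) = (a == b) →
      ∃ k, (B k).Cov (some (some u)) (some (some w)) a b ∨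
        (B k).Cov (some (some w)) (some (some u)) b a := by
    intro u w j a b hj hd hc
    have n1 : ¬ j = 2 * q + 1 := by omega
    have n2 : ¬ j = 2 * q := by omega
    rcases Nat.mod_two_eq_zero_or_one j with h | h
    · -- forward edge goes from `w` to `u`
      obtain ⟨k, hk⟩ := (pieceD q (w - (zz j : ℤ))).cov_path hj (a := b) (b := a) (by
        rw [Bool.beq_comm]; exact hc)
      refine ⟨Sum.inl (w - (zz j : ℤ), k), Or.inr ?_⟩
      have e1 : (pieceD q (w - (zz j : ℤ))).v j = some w := by simp [pieceD, n1]
      have e2 : (pieceD q (w - (zz j : ℤ))).v (j + 1) = some u := by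
        simp only [pieceD, Nat.add_right_cancel_iff, n2, if_false, zz_even h]
        congr 1
        push_cast at hd ⊢
        linear_combination -hd
      rw [e1, e2] at hk
      exact hk
    · obtain ⟨k, hk⟩ := (pieceD q (u - (zz j : ℤ))).cov_path hj (a := a) (b := b) hc
      refine ⟨Sum.inl (u - (zz j : ℤ), k), Or.inl ?_⟩
      have e1 : (pieceD q (u - (zz j : ℤ))).v j = some u := by simp [pieceD, n1]
      have e2 : (pieceD q (u - (zz j : ℤ))).v (j + 1) = some w := by
        simp only [pieceD, Nat.add_right_cancel_iff, n2, if_false, zz_odd h]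
        congr 1
        push_cast at hd ⊢
        linear_combination hd
      rw [e1, e2] at hk
      exact hk
  have hfin : ∀ (u w : ZMod (2 * q + 1)) a b, u ≠ w →
      ∃ k, (B k).Cov (some (some u)) (some (some w)) a b ∨
        (B k).Cov (some (some w)) (some (some u)) b a := by
    intro u w a b huw
    have hd0 : 0 < (w - u).val := by
      rw [Nat.pos_iff_ne_zero, Ne, ZMod.val_eq_zero, sub_eq_zero]
      exact fun h => huw h.symm
    have hd1 := ZMod.val_lt (w - u)
    have hv : (((w - u).val : ℕ) : ZMod (2 * q + 1)) = w - u := by simp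
    have hv' : ((2 * q + 1 - (w - u).val : ℕ) : ZMod (2 * q + 1)) = u - w := by
      rw [Nat.cast_sub hd1.le, hv, ZMod.natCast_self]; ring
    generalize (w - u).val = d at *
    by_cases hab : (a == b) = true
    · rcases Nat.mod_two_eq_zero_or_one d with h | h
      · obtain ⟨k, hk⟩ := hpath w u (2 * q - d) b a (by omega) (by rw [← hv']; congr 1; omega)
          (by rw [Bool.beq_comm, hab, decide_eq_true_iff]; omega)
        exact ⟨k, hk.symm⟩
      · exact hpath u w (d - 1) a b (by omega) (by rw [← hv]; congr 1; omega)
          (by rw [hab, decide_eq_true_iff]; omega)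
    · have hab' : (a == b) = false := by simpa using hab
      by_cases d1 : d = 1
      · have : w = u + 1 := by rw [d1] at hv; push_cast at hv; linear_combination -hv
        subst this
        obtain ⟨k, hk⟩ := hspec u b
        have : a = !b := by revert hab'; cases a <;> cases b <;> simp
        rw [this]
        exact ⟨k, Or.inl hk⟩
      by_cases d2 : d = 2 * q
      · have : u = w + 1 := by
          rw [d2, show 2 * q + 1 - 2 * q = 1 by omega] at hv'
          push_cast at hv'; linear_combination -hv'
        subst this
        obtain ⟨k, hk⟩ := hspec w a
        have : b = !a := by revert hab'; cases a <;> cases b <;> simp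
        rw [this]
        exact ⟨k, Or.inr hk⟩
      rcases Nat.mod_two_eq_zero_or_one d with h | h
      · exact hpath u w (d - 1) a b (by omega) (by rw [← hv]; congr 1; omega)
          (by rw [hab', decide_eq_false_iff_not]; omega)
      · obtain ⟨k, hk⟩ := hpath w u (2 * q - d) b a (by omega) (by rw [← hv']; congr 1; omega)
          (by rw [Bool.beq_comm, hab', decide_eq_false_iff_not]; omega)
        exact ⟨k, hk.symm⟩
  rintro (_ | _ | u) (_ | _ | w) a b huw
  · exact absurd rfl huw
  · obtain ⟨k, hk⟩ := hii a b; exact ⟨k, Or.inl hk⟩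
  · exact hinf w a b
  · obtain ⟨k, hk⟩ := hii b a; exact ⟨k, Or.inr hk⟩
  · exact absurd rfl huw
  · obtain ⟨k, hk⟩ := hinf' w b a; exact ⟨k, Or.inr hk⟩
  · obtain ⟨k, hk⟩ := hinf u b a; exact ⟨k, hk.symm⟩
  · obtain ⟨k, hk⟩ := hinf' u a b; exact ⟨k, Or.inl hk⟩
  · exact hfin u w a b (fun h => huw (by rw [h]))

end part6

section part7

/-! ### Part 8: the case `2 q ≤ r` -/

def zfA (q r i : ℕ) : ℕ :=
  if i ≤ 2 * q - 2 then (if i % 2 = 0 then i else 2 * r - 3 - i) else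
    if i % 2 = 0 then i / 2 + q - 1 else 2 * r - q - 3 - i / 2

def pathA (q r t : ℕ) : ℕ :=
  if t < 2 * q - 2 then (if t % 2 = 0 then t + 1 else 2 * r + t / 2) else
    if t = 2 * q - 2 then 2 * r - 1 else 2 * r - 3

def codeA (q r t : ℕ) : ℕ :=
  if t < 2 * q then pathA q r t else if t < 2 * r - 2 then zfA q r (t - 2 * q) else
    if t % 2 = 0 then 2 * r + (q - 1 + (t - (2 * r - 2)) / 2) else
      if t = 2 * r + 2 * q - 1 then r - 2 else if t = 2 * r + 2 * q - 3 then 2 * r - 2 else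
        2 * r - 5 - (t - (2 * r - 1))

def codeA' (q r t : ℕ) : ℕ :=
  if t < 2 * q then pathA q r t else if t < 2 * r - 2 then
      zfA q r (if t % 2 = 0 then t - 2 * q + 2 else t - 2 * q) else
    if t % 2 = 1 then 2 * r + (q - 1 + (t - (2 * r - 2)) / 2) else
      if t = 2 * r + 2 * q - 2 then 0 else if t = 2 * r + 2 * q - 4 then 2 * r - 2 else
        2 * r - 5 - (t - (2 * r - 2))

lemma pathA_inj {q r : ℕ} (hq : 1 ≤ q) (h : 2 * q ≤ r) : ∀ i < 2 * q, ∀ j < 2 * q,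
    pathA q r i = pathA q r j → i = j := by
  intro i hi j hj h
  simp only [pathA] at h
  split_ifs at h <;> omega

lemma zfA_inj {q r : ℕ} (hq : 1 ≤ q) (h : 2 * q ≤ r) : ∀ i ≤ 2 * r - 2 * q - 2,
    ∀ j ≤ 2 * r - 2 * q - 2, zfA q r i = zfA q r j → i = j := by
  intro i hi j hj h
  simp only [zfA] at h
  split_ifs at h <;> omega

/-- the values of the zigzag -/
lemma zfA_mem {q r : ℕ} (hq : 1 ≤ q) (h : 2 * q ≤ r) (i : ℕ) (hi : i ≤ 2 * r - 2 * q - 2) :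
    (zfA q r i ≤ 2 * q - 2 ∧ zfA q r i % 2 = 0) ∨
    (2 * q - 1 ≤ zfA q r i ∧ zfA q r i ≤ 2 * r - 2 * q - 2) ∨
    (2 * r - 2 * q ≤ zfA q r i ∧ zfA q r i ≤ 2 * r - 4 ∧ zfA q r i % 2 = 0) := by
  simp only [zfA]
  split_ifs <;> omega

/-- the values of the path -/
lemma pathA_mem {q r : ℕ} (hq : 1 ≤ q) (h : 2 * q ≤ r) (i : ℕ) (hi : i < 2 * q) :
    (pathA q r i + 3 ≤ 2 * q ∧ pathA q r i % 2 = 1) ∨ pathA q r i = 2 * r - 1 ∨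
    pathA q r i = 2 * r - 3 ∨ (2 * r ≤ pathA q r i ∧ pathA q r i + 2 ≤ 2 * r + q) := by
  simp only [pathA]
  split_ifs <;> omega

lemma zfA_last {q r : ℕ} (hq : 1 ≤ q) (h : 2 * q ≤ r) : zfA q r (2 * r - 2 * q - 2) = r - 2 := by
  simp only [zfA]
  split_ifs <;> omega

lemma zfA_zero {q r : ℕ} : zfA q r 0 = 0 := by simp [zfA]

/-- the cross part: index `t ≥ 2 r - 2` -/
lemma codeA_lt {q r : ℕ} (hq : 1 ≤ q) (h : 2 * q ≤ r) (t : ℕ) (ht : t < 2 * q + 2 * r) :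
    codeA q r t < 2 * q + 2 * r := by
  simp only [codeA]
  split_ifs with h1 h2
  · have := pathA_mem hq h t h1; omega
  · have := zfA_mem hq h (t - 2 * q) (by omega); omega
  all_goals omega

lemma codeA'_lt {q r : ℕ} (hq : 1 ≤ q) (h : 2 * q ≤ r) (t : ℕ) (ht : t < 2 * q + 2 * r) :
    codeA' q r t < 2 * q + 2 * r := by
  simp only [codeA']
  split_ifs with h1 h2 h3
  · have := pathA_mem hq h t h1; omega
  · have := zfA_mem hq h (t - 2 * q + 2) (by omega); omega
  · have := zfA_mem hq h (t - 2 * q) (by omega); omega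
  all_goals omega

lemma codeA_cases {q r : ℕ} (hq : 1 ≤ q) (h : 2 * q ≤ r) (t : ℕ) (ht : t < 2 * q + 2 * r) :
    (t < 2 * q ∧ codeA q r t = pathA q r t) ∨
    (2 * q ≤ t ∧ t < 2 * r - 2 ∧ codeA q r t = zfA q r (t - 2 * q)) ∨
    (t = 2 * r + 2 * q - 1 ∧ codeA q r t = zfA q r (2 * r - 2 * q - 2)) ∨
    (2 * r - 2 ≤ t ∧ t < 2 * r + 2 * q - 1 ∧ 2 * r - 2 * q - 1 ≤ codeA q r t ∧
      ((t % 2 = 0 ∧ 2 * codeA q r t + 2 * r = 2 * q + 4 * r + t) ∨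
      (t % 2 = 1 ∧ t = 2 * r + 2 * q - 3 ∧ codeA q r t = 2 * r - 2) ∨
      (t % 2 = 1 ∧ t < 2 * r + 2 * q - 3 ∧ codeA q r t + 6 + t = 4 * r))) := by
  by_cases h1 : t < 2 * q
  · left; simp [codeA, h1]
  by_cases h2 : t < 2 * r - 2
  · right; left; exact ⟨by omega, h2, by simp [codeA, h1, h2]⟩
  by_cases h3 : t = 2 * r + 2 * q - 1
  · right; right; left
    have h4 : ¬ t % 2 = 0 := by omega
    refine ⟨h3, ?_⟩
    rw [zfA_last hq h]
    simp only [codeA, h1, h2, h4, if_false]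
    simp [h3]
  · right; right; right
    refine ⟨by omega, by omega, ?_⟩
    simp only [codeA, h1, h2, h3, if_false]
    split_ifs <;> omega

lemma codeA'_cases {q r : ℕ} (hq : 1 ≤ q) (h : 2 * q ≤ r) (t : ℕ) (ht : t < 2 * q + 2 * r) :
    (t < 2 * q ∧ codeA' q r t = pathA q r t) ∨
    (2 * q ≤ t ∧ t < 2 * r - 2 ∧ t % 2 = 0 ∧ codeA' q r t = zfA q r (t - 2 * q + 2)) ∨
    (2 * q ≤ t ∧ t < 2 * r - 2 ∧ t % 2 = 1 ∧ codeA' q r t = zfA q r (t - 2 * q)) ∨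
    (t = 2 * r + 2 * q - 2 ∧ codeA' q r t = zfA q r 0) ∨
    (2 * r - 2 ≤ t ∧ t ≠ 2 * r + 2 * q - 2 ∧ 2 * r - 2 * q - 1 ≤ codeA' q r t ∧
      ((t % 2 = 1 ∧ 2 * codeA' q r t + 2 * r + 1 = 2 * q + 4 * r + t) ∨
      (t % 2 = 0 ∧ t = 2 * r + 2 * q - 4 ∧ codeA' q r t = 2 * r - 2) ∨
      (t % 2 = 0 ∧ t < 2 * r + 2 * q - 4 ∧ codeA' q r t + 7 + t = 4 * r))) := by
  by_cases h1 : t < 2 * q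
  · left; simp [codeA', h1]
  by_cases h2 : t < 2 * r - 2
  · right
    by_cases h3 : t % 2 = 0
    · left; exact ⟨by omega, h2, h3, by simp [codeA', h1, h2, h3]⟩
    · right; left; exact ⟨by omega, h2, by omega, by simp [codeA', h1, h2, h3]⟩
  by_cases h3 : t = 2 * r + 2 * q - 2
  · right; right; right; left
    have h4 : ¬ t % 2 = 1 := by omega
    refine ⟨h3, ?_⟩
    rw [zfA_zero]
    simp only [codeA', h1, h2, h4, if_false]
    simp [h3]
  · right; right; right; right
    refine ⟨by omega, by omega, ?_⟩
    simp only [codeA', h1, h2, h3, if_false]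
    split_ifs <;> omega

lemma codeA_inj {q r : ℕ} (hq : 1 ≤ q) (h : 2 * q ≤ r) : ∀ i < 2 * q + 2 * r,
    ∀ j < 2 * q + 2 * r, codeA q r i = codeA q r j → i = j := by
  intro i hi j hj hij
  rcases codeA_cases hq h i hi with ⟨a1, a2⟩ | ⟨a1, a2, a3⟩ | ⟨a1, a2⟩ | a1 <;>
  rcases codeA_cases hq h j hj with ⟨b1, b2⟩ | ⟨b1, b2, b3⟩ | ⟨b1, b2⟩ | b1
  · exact pathA_inj hq h i a1 j b1 (by omega)
  · have := pathA_mem hq h i a1; have := zfA_mem hq h (j - 2 * q) (by omega); omega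
  · have := pathA_mem hq h i a1; have := zfA_mem hq h (2 * r - 2 * q - 2) (by omega); omega
  · have := pathA_mem hq h i a1; omega
  · have := pathA_mem hq h j b1; have := zfA_mem hq h (i - 2 * q) (by omega); omega
  · have := zfA_inj hq h (i - 2 * q) (by omega) (j - 2 * q) (by omega) (by omega); omega
  · have := zfA_inj hq h (i - 2 * q) (by omega) (2 * r - 2 * q - 2) (by omega) (by omega); omega
  · have := zfA_mem hq h (i - 2 * q) (by omega); omega
  · have := pathA_mem hq h j b1; have := zfA_mem hq h (2 * r - 2 * q - 2) (by omega); omega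
  · have := zfA_inj hq h (2 * r - 2 * q - 2) (by omega) (j - 2 * q) (by omega) (by omega); omega
  · omega
  · have := zfA_mem hq h (2 * r - 2 * q - 2) (by omega); omega
  · have := pathA_mem hq h j b1; omega
  · have := zfA_mem hq h (j - 2 * q) (by omega); omega
  · have := zfA_mem hq h (2 * r - 2 * q - 2) (by omega); omega
  · omega

lemma codeA'_inj {q r : ℕ} (hq : 1 ≤ q) (h : 2 * q ≤ r) : ∀ i < 2 * q + 2 * r,
    ∀ j < 2 * q + 2 * r, codeA' q r i = codeA' q r j → i = j := by
  have key : ∀ i < 2 * q + 2 * r,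
      (i < 2 * q ∧ codeA' q r i = pathA q r i) ∨
      (∃ s ≤ 2 * r - 2 * q - 2, codeA' q r i = zfA q r s ∧ 2 * q ≤ i ∧
        ((s = 0 ∧ i = 2 * r + 2 * q - 2) ∨ (s % 2 = 1 ∧ i = s + 2 * q) ∨
          (s % 2 = 0 ∧ i + 2 = s + 2 * q))) ∨
      (2 * r - 2 ≤ i ∧ i ≠ 2 * r + 2 * q - 2 ∧ 2 * r - 2 * q - 1 ≤ codeA' q r i ∧
      ((i % 2 = 1 ∧ 2 * codeA' q r i + 2 * r + 1 = 2 * q + 4 * r + i) ∨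
      (i % 2 = 0 ∧ i = 2 * r + 2 * q - 4 ∧ codeA' q r i = 2 * r - 2) ∨
      (i % 2 = 0 ∧ i < 2 * r + 2 * q - 4 ∧ codeA' q r i + 7 + i = 4 * r))) := by
    intro i hi
    rcases codeA'_cases hq h i hi with a | ⟨a1, a2, a3, a4⟩ | ⟨a1, a2, a3, a4⟩ | ⟨a1, a2⟩ | a
    · exact Or.inl a
    · exact Or.inr (Or.inl ⟨i - 2 * q + 2, by omega, a4, a1, by omega⟩)
    · exact Or.inr (Or.inl ⟨i - 2 * q, by omega, a4, a1, by omega⟩)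
    · exact Or.inr (Or.inl ⟨0, by omega, a2, by omega, by omega⟩)
    · exact Or.inr (Or.inr a)
  intro i hi j hj hij
  rcases key i hi with ⟨a1, a2⟩ | ⟨s, hs, a1, a2, a3⟩ | a <;>
  rcases key j hj with ⟨b1, b2⟩ | ⟨s', hs', b1, b2, b3⟩ | b
  · exact pathA_inj hq h i a1 j b1 (by omega)
  · have := pathA_mem hq h i a1; have := zfA_mem hq h s' hs'; omega
  · have := pathA_mem hq h i a1; omega
  · have := pathA_mem hq h j b1; have := zfA_mem hq h s hs; omega
  · have := zfA_inj hq h s hs s' hs' (by omega); omega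
  · have := zfA_mem hq h s hs; omega
  · have := pathA_mem hq h j b1; omega
  · have := zfA_mem hq h s' hs'; omega
  · omega

lemma baseA {q r : ℕ} (hq : 1 ≤ q) (h : 2 * q ≤ r) :
    ∃ P : OPiece ℕ q r, (∀ i < 2 * q + 2 * r, P.v i < 2 * q + 2 * r) ∧
      (∀ i < 2 * q + 2 * r, P.v' i < 2 * q + 2 * r) ∧
      P.v 0 < 2 * r ∧ P.v (2 * q - 1) < 2 * r ∧
      (∀ x < 2 * q, (∃ y < 2 * r, P.Cov (2 * r + x) y) ∧ (∃ y < 2 * r, P.Cov y (2 * r + x))) ∧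
      (∀ d, 0 < d → d < 2 * r → (∃ i < 2 * q, d + 1 + 2 * i = 2 * r) ∨
        ∃ y y', y < 2 * r ∧ y' < 2 * r ∧ P.Cov y y' ∧ (y' = y + d ∨ y' + 2 * r = y + d)) := by
  let P : OPiece ℕ q r :=
    { v := codeA q r
      v' := codeA' q r
      agree := fun i hi => by simp [codeA, codeA', hi]
      inj := codeA_inj hq h
      inj' := codeA'_inj hq h
      o := fun _ => true }
  have hpv : ∀ i, i < 2 * q → P.v i = pathA q r i := fun i hi => by simp [P, codeA, hi]
  have cpath : ∀ i, i + 1 < 2 * q → P.Cov (pathA q r i) (pathA q r (i + 1)) := fun i hi =>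
    Or.inl ⟨i, hi, Or.inl ⟨rfl, (hpv i (by omega)).symm, (hpv (i + 1) hi).symm⟩⟩
  have cM : ∀ t, 2 * q ≤ t → t % 2 = 0 → t < 2 * q + 2 * r →
      P.Cov (codeA q r t) (codeA q r (t + 1)) := fun t h1 h2 h3 =>
    Or.inr (Or.inl ⟨(t - 2 * q) / 2, by omega, by
      show codeA q r t = codeA q r _
      congr 1; omega, by
      show codeA q r (t + 1) = codeA q r _
      congr 1; omega⟩)
  have cM' : ∀ t, 2 * q ≤ t → t % 2 = 0 → t < 2 * q + 2 * r →
      P.Cov (codeA' q r t) (codeA' q r (t + 1)) := fun t h1 h2 h3 =>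
    Or.inr (Or.inr ⟨(t - 2 * q) / 2, by omega, by
      show codeA' q r t = codeA' q r _
      congr 1; omega, by
      show codeA' q r (t + 1) = codeA' q r _
      congr 1; omega⟩)
  refine ⟨P, codeA_lt hq h, codeA'_lt hq h, ?_, ?_, ?_, ?_⟩
  · rw [hpv 0 (by omega)]; simp only [pathA]; split_ifs <;> omega
  · rw [hpv _ (by omega)]; simp only [pathA]; split_ifs <;> omega
  · intro x hx
    by_cases hxq : x < q - 1
    · have e1 : pathA q r (2 * x + 1) = 2 * r + x := by
        simp only [pathA]; split_ifs <;> omega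
      have e2 : pathA q r (2 * x + 1 + 1) < 2 * r := by
        simp only [pathA]; split_ifs <;> omega
      have e3 : pathA q r (2 * x) < 2 * r := by
        simp only [pathA]; split_ifs <;> omega
      have c1 := cpath (2 * x + 1) (by omega)
      have c2 := cpath (2 * x) (by omega)
      rw [e1] at c1 c2
      exact ⟨⟨_, e2, c1⟩, ⟨_, e3, c2⟩⟩
    · obtain ⟨l, rfl⟩ : ∃ l, x = q - 1 + l := ⟨x - (q - 1), by omega⟩
      have e1 : codeA q r (2 * r - 2 + 2 * l) = 2 * r + (q - 1 + l) := by
        simp only [codeA]; split_ifs <;> omega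
      have e2 : codeA q r (2 * r - 2 + 2 * l + 1) < 2 * r := by
        simp only [codeA]; split_ifs <;> omega
      have e3 : codeA' q r (2 * r - 2 + 2 * l + 1) = 2 * r + (q - 1 + l) := by
        simp only [codeA']; split_ifs <;> omega
      have e4 : codeA' q r (2 * r - 2 + 2 * l) < 2 * r := by
        simp only [codeA']; split_ifs <;> omega
      have c1 := cM (2 * r - 2 + 2 * l) (by omega) (by omega) (by omega)
      have c2 := cM' (2 * r - 2 + 2 * l) (by omega) (by omega) (by omega)
      rw [e1] at c1
      rw [e3] at c2
      exact ⟨⟨_, e2, c1⟩, ⟨_, e4, c2⟩⟩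
  · -- differences
    have hz : ∀ s, s + 1 ≤ 2 * r - 2 * q - 2 → ∀ d, (s % 2 = 0 → zfA q r (s + 1) = zfA q r s + d) →
        (s % 2 = 1 → zfA q r s = zfA q r (s + 1) + d) →
        ∃ y y', y < 2 * r ∧ y' < 2 * r ∧ P.Cov y y' ∧ (y' = y + d ∨ y' + 2 * r = y + d) := by
      intro s hs d h0 h1
      have m1 := zfA_mem hq h s (by omega)
      have m2 := zfA_mem hq h (s + 1) (by omega)
      rcases Nat.mod_two_eq_zero_or_one s with hp | hp
      · have c := cM (2 * q + s) (by omega) (by omega) (by omega)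
        have e1 : codeA q r (2 * q + s) = zfA q r s := by
          have a1 : ¬ 2 * q + s < 2 * q := by omega
          have a2 : 2 * q + s < 2 * r - 2 := by omega
          simp only [codeA, a1, a2, if_true, if_false]; congr 1; omega
        have e2 : codeA q r (2 * q + s + 1) = zfA q r (s + 1) := by
          have a1 : ¬ 2 * q + s + 1 < 2 * q := by omega
          have a2 : 2 * q + s + 1 < 2 * r - 2 := by omega
          simp only [codeA, a1, a2, if_true, if_false]; congr 1; omega
        rw [e1, e2] at c
        exact ⟨_, _, by omega, by omega, c, Or.inl (h0 hp)⟩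
      · have c := cM' (2 * q + (s - 1)) (by omega) (by omega) (by omega)
        have e1 : codeA' q r (2 * q + (s - 1)) = zfA q r (s + 1) := by
          have a1 : ¬ 2 * q + (s - 1) < 2 * q := by omega
          have a2 : 2 * q + (s - 1) < 2 * r - 2 := by omega
          have a3 : (2 * q + (s - 1)) % 2 = 0 := by omega
          simp only [codeA', a1, a2, a3, if_true, if_false]; congr 1; omega
        have e2 : codeA' q r (2 * q + (s - 1) + 1) = zfA q r s := by
          have a1 : ¬ 2 * q + (s - 1) + 1 < 2 * q := by omega
          have a2 : 2 * q + (s - 1) + 1 < 2 * r - 2 := by omega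
          have a3 : ¬ (2 * q + (s - 1) + 1) % 2 = 0 := by omega
          simp only [codeA', a1, a2, a3, if_true, if_false]; congr 1; omega
        rw [e1, e2] at c
        exact ⟨_, _, by omega, by omega, c, Or.inl (h1 hp)⟩
    intro d hd0 hd1
    by_cases c1 : d % 2 = 1 ∧ 2 * r + 1 ≤ d + 4 * q
    · exact Or.inl ⟨(2 * r - 1 - d) / 2, by omega, by omega⟩
    right
    by_cases c2 : d = 2 * r - 2
    · have c := cpath (2 * q - 2) (by omega)
      have e1 : pathA q r (2 * q - 2) = 2 * r - 1 := by
        simp only [pathA]; split_ifs <;> omega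
      have e2 : pathA q r (2 * q - 2 + 1) = 2 * r - 3 := by
        simp only [pathA]; split_ifs <;> omega
      rw [e1, e2] at c
      exact ⟨_, _, by omega, by omega, c, by omega⟩
    by_cases c3 : 2 * r ≤ d + 4 * q
    · apply hz ((2 * r - 4 - d) / 2) (by omega)
      · intro hp; simp only [zfA]; split_ifs <;> omega
      · intro hp; simp only [zfA]; split_ifs <;> omega
    · apply hz (2 * r - 2 * q - 2 - d) (by omega)
      · intro hp; simp only [zfA]; split_ifs <;> omega
      · intro hp; simp only [zfA]; split_ifs <;> omega

end part7

section part8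

def specA_y (q r : ℕ) (c : ℕ) (e : ℕ) (t : ℕ) : ℤ :=
  if (t - 2 * q) % 2 = 0 then (e : ℤ) + (t - 2 * q : ℕ) else
    (e : ℤ) + (t - 2 * q : ℕ) - 2 - 2 * c

lemma specA_inj {q r c e i j : ℕ} (hi : i < 2 * q + 2 * r) (hj : j < 2 * q + 2 * r)
    (hi' : 2 * q ≤ i) (hj' : 2 * q ≤ j)
    (h : ((specA_y q r c e i : ℤ) : ZMod (2 * r)) = (specA_y q r c e j : ℤ)) : i = j := by
  by_cases hp : (i - 2 * q) % 2 = (j - 2 * q) % 2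
  · have := int_cast_inj h
      (by simp only [specA_y]; split_ifs <;> omega) (by simp only [specA_y]; split_ifs <;> omega)
    simp only [specA_y] at this
    split_ifs at this <;> omega
  · exfalso
    rw [ZMod.intCast_eq_intCast_iff_dvd_sub] at h
    obtain ⟨x, hx⟩ := h
    have : (specA_y q r c e j - specA_y q r c e i) = 2 * ((r : ℤ) * x) := by
      rw [hx]; push_cast; ring
    simp only [specA_y] at this
    split_ifs at this <;> omega

def specA (q r : ℕ) (i : ZMod (2 * q)) : OPiece (ZMod (2 * q) ⊕ ZMod (2 * r)) q r where
  v t := if t < 2 * q then Sum.inl (i + (zz t : ℤ)) else Sum.inr ((specA_y q r i.val 0 t : ℤ))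
  v' t := if t < 2 * q then Sum.inl (i + (zz t : ℤ)) else Sum.inr ((specA_y q r i.val 1 t : ℤ))
  agree t ht := by simp [ht]
  inj := by
    intro a ha b hb h
    by_cases h1 : a < 2 * q <;> by_cases h2 : b < 2 * q <;> simp [h1, h2] at h
    · exact zz_inj h1 h2 h
    · exact specA_inj ha hb (by omega) (by omega) h
  inj' := by
    intro a ha b hb h
    by_cases h1 : a < 2 * q <;> by_cases h2 : b < 2 * q <;> simp [h1, h2] at h
    · exact zz_inj h1 h2 h
    · exact specA_inj ha hb (by omega) (by omega) h
  o _ := true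

theorem core_A {q r : ℕ} (hq : 1 ≤ q) (h : 2 * q ≤ r) : Core q r := by
  have nq : NeZero (2 * q) := ⟨by omega⟩
  have nr : NeZero (2 * r) := ⟨by omega⟩
  obtain ⟨P, hlt, hlt', hs, ht, hx, hd⟩ := baseA hq h
  let φ : ZMod (2 * r) → ℕ → ZMod (2 * q) ⊕ ZMod (2 * r) := fun g n =>
    if n < 2 * r then Sum.inr (g + (n : ℕ)) else Sum.inl ((n - 2 * r : ℕ))
  have φY : ∀ g n, n < 2 * r → φ g n = Sum.inr (g + (n : ℕ)) := fun g n hn => by simp [φ, hn]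
  have φX : ∀ g n, φ g (2 * r + n) = Sum.inl (n : ZMod (2 * q)) := fun g n => by simp [φ]
  have φinj : ∀ g, ∀ a < 2 * q + 2 * r, ∀ b < 2 * q + 2 * r, φ g a = φ g b → a = b := by
    intro g a ha b hb hab
    by_cases h1 : a < 2 * r <;> by_cases h2 : b < 2 * r <;> simp [φ, h1, h2] at hab
    · rw [ZMod.natCast_eq_natCast_iff'] at hab
      rwa [Nat.mod_eq_of_lt h1, Nat.mod_eq_of_lt h2] at hab
    · rw [ZMod.natCast_eq_natCast_iff'] at hab
      rw [Nat.mod_eq_of_lt (by omega), Nat.mod_eq_of_lt (by omega)] at hab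
      omega
  let Q : ZMod (2 * r) → OPiece (ZMod (2 * q) ⊕ ZMod (2 * r)) q r := fun g =>
    { v := fun i => φ g (P.v i)
      v' := fun i => φ g (P.v' i)
      agree := fun i hi => by rw [P.agree i hi]
      inj := fun i hi j hj hij => P.inj i hi j hj (φinj g _ (hlt i hi) _ (hlt j hj) hij)
      inj' := fun i hi j hj hij => P.inj' i hi j hj (φinj g _ (hlt' i hi) _ (hlt' j hj) hij)
      o := P.o }
  have hQ : ∀ g u w, P.Cov u w → (Q g).Cov (φ g u) (φ g w) := by
    rintro k u w (⟨i, hi, ⟨ho, rfl, rfl⟩ | ⟨ho, rfl, rfl⟩⟩ | ⟨j, hj, rfl, rfl⟩ | ⟨j, hj, rfl, rfl⟩)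
    · exact Or.inl ⟨i, hi, Or.inl ⟨ho, rfl, rfl⟩⟩
    · exact Or.inl ⟨i, hi, Or.inr ⟨ho, rfl, rfl⟩⟩
    · exact Or.inr (Or.inl ⟨j, hj, rfl, rfl⟩)
    · exact Or.inr (Or.inr ⟨j, hj, rfl, rfl⟩)
  let R : ZMod (2 * q) ⊕ ZMod (2 * r) → OPiece (ZMod (2 * q) ⊕ ZMod (2 * r)) q r :=
    Sum.elim (specA q r) Q
  have hval : ∀ {n : ℕ} [NeZero n] (u w : ZMod n), u ≠ w → 0 < (w - u).val := by
    intro n _ u w huw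
    rw [Nat.pos_iff_ne_zero, Ne, ZMod.val_eq_zero, sub_eq_zero]
    exact fun h => huw h.symm
  obtain ⟨B, hB⟩ := core_of_pieces hq R
    (by
      rintro (u | u) (w | w) huw
      · -- two points of `X`
        have huw' : u ≠ w := fun h => huw (by rw [h])
        have d0 := hval u w huw'
        have d1 := ZMod.val_lt (w - u)
        have hv : (((w - u).val : ℕ) : ZMod (2 * q)) = w - u := by simp
        generalize (w - u).val = d at d0 d1 hv
        have key : ∀ j, j + 1 < 2 * q → ((zz (j + 1) - zz j : ℤ) : ZMod (2 * q)) = w - u →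
            ∃ k, (R k).Cov (Sum.inl u) (Sum.inl w) := by
          intro j hj hjd
          refine ⟨Sum.inl (u - (zz j : ℤ)), Or.inl ⟨j, hj, Or.inl ⟨rfl, ?_, ?_⟩⟩⟩
          · simp [R, specA, show j < 2 * q by omega]
          · simp only [R, specA, hj, Sum.elim_inl, if_true]
            congr 1
            push_cast at hjd ⊢
            linear_combination -hjd
        rcases Nat.mod_two_eq_zero_or_one d with hp | hp
        · refine key (d - 1) (by omega) ?_
          rw [zz_odd (by omega), ← hv]
          have : ((d - 1 : ℕ) : ℤ) + 1 = d := by omega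
          rw [show zz (d - 1) + (((d - 1 : ℕ) : ℤ) + 1) - zz (d - 1) = (d : ℤ) by omega]
          simp
        · refine key (2 * q - d - 1) (by omega) ?_
          rw [zz_even (by omega), ← hv]
          rw [show zz (2 * q - d - 1) - (((2 * q - d - 1 : ℕ) : ℤ) + 1) - zz (2 * q - d - 1)
            = (d : ℤ) - ((2 * q : ℕ) : ℤ) by omega]
          rw [Int.cast_sub, Int.cast_natCast, Int.cast_natCast, ZMod.natCast_self, sub_zero]
      · obtain ⟨y, hy, hc⟩ := (hx u.val (ZMod.val_lt u)).1
        have c := hQ (w - (y : ℕ)) _ _ hc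
        rw [φX, φY _ _ hy] at c
        refine ⟨Sum.inr (w - (y : ℕ)), ?_⟩
        simpa [R] using c
      · obtain ⟨y, hy, hc⟩ := (hx w.val (ZMod.val_lt w)).2
        have c := hQ (u - (y : ℕ)) _ _ hc
        rw [φX, φY _ _ hy] at c
        refine ⟨Sum.inr (u - (y : ℕ)), ?_⟩
        simpa [R] using c
      · have huw' : u ≠ w := fun h => huw (by rw [h])
        have d0 := hval u w huw'
        have d1 := ZMod.val_lt (w - u)
        have hv : (((w - u).val : ℕ) : ZMod (2 * r)) = w - u := by simp
        generalize (w - u).val = d at d0 d1 hv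
        rcases hd d d0 d1 with ⟨i, hi, hdi⟩ | ⟨y, y', hy, hy', hc, hyy⟩
        · have hiv : ((i : ℕ) : ZMod (2 * q)).val = i := ZMod.val_natCast_of_lt hi
          have hw : w = u - 1 - 2 * (i : ZMod (2 * r)) := by
            have := congrArg (Nat.cast : ℕ → ZMod (2 * r)) hdi
            rw [ZMod.natCast_self] at this
            push_cast at this
            linear_combination this - hv
          have hu := ZMod.val_lt u
          have huv : ((u.val : ℕ) : ZMod (2 * r)) = u := by simp
          refine ⟨Sum.inl (i : ℕ), ?_⟩
          rcases Nat.mod_two_eq_zero_or_one u.val with hp | hp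
          · refine Or.inr (Or.inl ⟨u.val / 2, by omega, ?_, ?_⟩)
            · have a1 : ¬ 2 * q + 2 * (u.val / 2) < 2 * q := by omega
              have a2 : 2 * q + 2 * (u.val / 2) - 2 * q = u.val := by omega
              simp only [R, specA, Sum.elim_inl, a1, if_false, specA_y, a2, hp, if_true]
              simp
            · have a1 : ¬ 2 * q + 2 * (u.val / 2) + 1 < 2 * q := by omega
              have a2 : 2 * q + 2 * (u.val / 2) + 1 - 2 * q = u.val + 1 := by omega
              have a3 : ¬ (u.val + 1) % 2 = 0 := by omega
              simp only [R, specA, Sum.elim_inl, a1, if_false, specA_y, a2, a3, hiv]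
              congr 1
              rw [hw]; push_cast; rw [huv]; ring
          · refine Or.inr (Or.inr ⟨u.val / 2, by omega, ?_, ?_⟩)
            · have a1 : ¬ 2 * q + 2 * (u.val / 2) < 2 * q := by omega
              have a2 : 2 * q + 2 * (u.val / 2) - 2 * q = u.val - 1 := by omega
              have a3 : (u.val - 1) % 2 = 0 := by omega
              have a4 : ((1 : ℕ) : ℤ) + ((u.val - 1 : ℕ) : ℤ) = (u.val : ℕ) := by omega
              simp only [R, specA, Sum.elim_inl, a1, if_false, specA_y, a2, a3, if_true, a4]
              simp
            · have a1 : ¬ 2 * q + 2 * (u.val / 2) + 1 < 2 * q := by omega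
              have a2 : 2 * q + 2 * (u.val / 2) + 1 - 2 * q = u.val := by omega
              have a3 : ¬ u.val % 2 = 0 := by omega
              simp only [R, specA, Sum.elim_inl, a1, if_false, specA_y, a2, a3, hiv]
              congr 1
              rw [hw]; push_cast; rw [huv]; ring
        · have c := hQ (u - (y : ℕ)) _ _ hc
          rw [φY _ _ hy, φY _ _ hy'] at c
          refine ⟨Sum.inr (u - (y : ℕ)), ?_⟩
          have e : (y' : ZMod (2 * r)) = y + (w - u) := by
            rcases hyy with h | h
            · rw [h]; push_cast; rw [hv]
            · have := congrArg (Nat.cast : ℕ → ZMod (2 * r)) h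
              rw [Nat.cast_add y', ZMod.natCast_self, add_zero] at this
              rw [this]; push_cast; rw [hv]
          rw [e, show u - (y : ℕ) + ((y : ZMod (2 * r)) + (w - u)) = w by ring,
            sub_add_cancel] at c
          exact c)
    (by
      rintro (u | u)
      · refine ⟨Sum.inl u, ?_⟩
        simp [R, specA, zz, show 0 < q by omega]
      · refine ⟨Sum.inr (u - (P.v 0 : ℕ)), ?_⟩
        show φ _ (P.v 0) = _
        rw [φY _ _ hs]; simp)
    (by
      rintro (u | u)
      · refine ⟨Sum.inl (u - (zz (2 * q - 1) : ℤ)), ?_⟩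
        simp [R, specA, show 0 < q by omega]
      · refine ⟨Sum.inr (u - (P.v (2 * q - 1) : ℕ)), ?_⟩
        show φ _ (P.v (2 * q - 1)) = _
        rw [φY _ _ ht]; simp)
  refine ⟨_, _, inferInstance, inferInstance, B, ?_, ?_, hB⟩
  · simp only [Fintype.card_option, Fintype.card_sum, ZMod.card]; omega
  · simp only [Fintype.card_prod, Fintype.card_bool, Fintype.card_sum, ZMod.card]; omega

theorem core_all {q r : ℕ} (hq : 1 ≤ q) (hr : 1 ≤ r) : Core q r := by
  by_cases h : 2 * q ≤ r
  · exact core_A hq h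
  by_cases h1 : r = 1
  · subst h1; exact core_D hq
  by_cases h2 : r = 2
  · subst h2; exact core_C (by omega)
  · exact core_B (by omega) (by omega)

end part8

section part9

/-! ### Part 9: developing base blocks in an abelian group -/

lemma place {G : Type} [AddCommGroup G] [Fintype G] {m : ℕ} (r : ℕ)
    (cyc : ℕ → G) (hc : ∀ i < m, ∀ j < m, cyc i = cyc j → i = j)
    (d : ℕ → G) (hd : ∀ j, d j ≠ 0) (hcard : 2 * (m + 2 * r) ≤ Fintype.card G) :
    ∃ v : ℕ → G, (∀ i < m, v i = cyc i) ∧ (∀ j < r, v (m + 2 * j + 1) = v (m + 2 * j) + d j) ∧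
      (∀ i < m + 2 * r, ∀ j < m + 2 * r, v i = v j → i = j) := by
  classical
  induction r with
  | zero => exact ⟨cyc, fun _ _ => rfl, by intros; omega, by simpa using hc⟩
  | succ r ih =>
    obtain ⟨v, h1, h2, h3⟩ := ih (by omega)
    let U : Finset G := (Finset.range (m + 2 * r)).image v
    have hU : U.card ≤ m + 2 * r := by simpa [U] using Finset.card_image_le (s := Finset.range (m + 2 * r)) (f := v)
    have hU2 : (U.image (fun x => x - d r)).card ≤ m + 2 * r := Finset.card_image_le.trans hU
    obtain ⟨t, ht⟩ : ∃ t, t ∉ U ∪ U.image (fun x => x - d r) := by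
      by_contra hcon
      push Not at hcon
      have : (U ∪ U.image (fun x => x - d r)) = Finset.univ := Finset.eq_univ_of_forall hcon
      have h4 := Finset.card_union_le U (U.image (fun x => x - d r))
      rw [this, Finset.card_univ] at h4
      omega
    have t1 : ∀ i < m + 2 * r, v i ≠ t := by
      intro i hi h
      apply ht
      rw [Finset.mem_union]; left
      exact Finset.mem_image.2 ⟨i, Finset.mem_range.2 hi, h⟩
    have t2 : ∀ i < m + 2 * r, v i ≠ t + d r := by
      intro i hi h
      apply ht
      rw [Finset.mem_union]; right
      exact Finset.mem_image.2 ⟨v i, Finset.mem_image.2 ⟨i, Finset.mem_range.2 hi, rfl⟩,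
        by rw [h]; simp⟩
    have t3 : t ≠ t + d r := by
      intro h; exact hd r (by simpa using h)
    let v' : ℕ → G := fun i => if i < m + 2 * r then v i else if i = m + 2 * r then t else t + d r
    have e1 : ∀ i < m + 2 * r, v' i = v i := fun i hi => by simp [v', hi]
    have e2 : v' (m + 2 * r) = t := by simp [v']
    have e3 : v' (m + 2 * r + 1) = t + d r := by simp [v']
    refine ⟨v', ?_, ?_, ?_⟩
    · intro i hi; rw [e1 i (by omega), h1 i hi]
    · intro j hj
      rcases (show j < r ∨ j = r by omega) with h | rfl
      · rw [e1 _ (by omega), e1 _ (by omega), h2 j h]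
      · rw [e2, e3]
    · intro i hi j hj hij
      rcases (show i < m + 2 * r ∨ i = m + 2 * r ∨ i = m + 2 * r + 1 by omega) with a | rfl | rfl <;>
      rcases (show j < m + 2 * r ∨ j = m + 2 * r ∨ j = m + 2 * r + 1 by omega) with b | rfl | rfl
      · rw [e1 i a, e1 j b] at hij; exact h3 i a j b hij
      · rw [e1 i a, e2] at hij; exact absurd hij (t1 i a)
      · rw [e1 i a, e3] at hij; exact absurd hij (t2 i a)
      · rw [e1 j b, e2] at hij; exact absurd hij.symm (t1 j b)
      · rfl
      · rw [e2, e3] at hij; exact absurd hij t3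
      · rw [e1 j b, e3] at hij; exact absurd hij.symm (t2 j b)
      · rw [e2, e3] at hij; exact absurd hij.symm t3
      · rfl

/-- all pairs with difference `D` are covered -/
def CC {G ι : Type} [AddCommGroup G] {m r : ℕ} (B : ι → Blk G m r) (D : G) : Prop :=
  ∀ u a b, ∃ k, (B k).Cov u (u + D) a b ∨ (B k).Cov (u + D) u b a

lemma CC.neg {G ι : Type} [AddCommGroup G] {m r : ℕ} {B : ι → Blk G m r} {D : G} (h : CC B D) :
    CC B (-D) := by
  intro u a b
  obtain ⟨k, hk⟩ := h (u - D) b a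
  refine ⟨k, ?_⟩
  rw [sub_add_cancel] at hk
  rw [← sub_eq_add_neg]
  exact hk.symm

def labelM (q : ℕ) (w1 w2 : Bool) (i : ℕ) : Bool :=
  if i = 2 * q then xor w1 w2 else if i % 2 = 0 then w1 else w2

lemma labelM_surj {q : ℕ} (hq : 1 ≤ q) {i : ℕ} (hi : i < 2 * q + 1) (a b : Bool) :
    ∃ w1 w2, labelM q w1 w2 i = a ∧ labelM q w1 w2 ((i + 1) % (2 * q + 1)) = b := by
  by_cases h1 : i = 2 * q
  · refine ⟨b, xor a b, ?_, ?_⟩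
    · simp only [labelM, h1, if_true]; cases a <;> cases b <;> rfl
    · have : ¬ 0 = 2 * q := by omega
      simp [labelM, h1, this]
  · rw [Nat.mod_eq_of_lt (by omega)]
    by_cases h2 : i + 1 = 2 * q
    · have h3 : ¬ i % 2 = 0 := by omega
      refine ⟨xor a b, a, ?_, ?_⟩
      · simp [labelM, h1, h3]
      · simp only [labelM, h2, if_true]; cases a <;> cases b <;> rfl
    · rcases Nat.mod_two_eq_zero_or_one i with h3 | h3
      · have h4 : ¬ (i + 1) % 2 = 0 := by omega
        exact ⟨a, b, by simp [labelM, h1, h3], by simp [labelM, h2, h4]⟩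
      · have h4 : (i + 1) % 2 = 0 := by omega
        have h5 : ¬ i % 2 = 0 := by omega
        exact ⟨b, a, by simp [labelM, h1, h5], by simp [labelM, h2, h4]⟩

theorem develop {G : Type} [AddCommGroup G] [Fintype G] {q r : ℕ} (hq : 1 ≤ q)
    (cyc : ℕ → G) (hc : ∀ i < 2 * q + 1, ∀ j < 2 * q + 1, cyc i = cyc j → i = j)
    (d : Bool → ℕ → G) (hd : ∀ w j, d w j ≠ 0)
    (hcard : 2 * (2 * q + 1 + 2 * r) ≤ Fintype.card G) :
    ∃ B : Bool × Bool × G → Blk G (2 * q + 1) r,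
      (∀ i < 2 * q + 1, CC B (cyc ((i + 1) % (2 * q + 1)) - cyc i)) ∧
      (∀ w, ∀ j < r, CC B (d w j)) := by
  choose v h1 h2 h3 using fun w => place r cyc hc (d w) (hd w) hcard
  let B : Bool × Bool × G → Blk G (2 * q + 1) r := fun k =>
    { v := fun i => k.2.2 + v k.2.1 i
      x := labelM q k.1 k.2.1
      c := fun _ => k.1
      inj := fun i hi j hj h => h3 k.2.1 i hi j hj (add_left_cancel h) }
  refine ⟨B, ?_, ?_⟩
  · intro i hi u a b
    obtain ⟨w1, w2, e1, e2⟩ := labelM_surj hq hi (!a) b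
    refine ⟨(w1, w2, u - cyc i), Or.inl (Or.inl ⟨i, hi, ?_, ?_, ?_, ?_⟩)⟩
    · simp [B, h1 _ i hi]
    · simp [B, e1]
    · simp only [B]
      rw [h1 _ _ (Nat.mod_lt _ (by omega))]; abel
    · simp [B, e2]
  · intro w j hj u a b
    refine ⟨((a == b), w, u - v w (2 * q + 1 + 2 * j)), Or.inl (Or.inr ⟨j, hj, ?_, ?_, rfl⟩)⟩
    · simp [B]
    · simp only [B]
      rw [h2 w j hj]; abel

end part9

section part10

/-! ### Part 10: the multipartite part and the conclusion -/

lemma finset_enum {α : Type} [Inhabited α] (T : Finset α) {k : ℕ} (hT : T.card ≤ k) :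
    ∃ f : ℕ → α, ∀ y ∈ T, ∃ j < k, f j = y := by
  refine ⟨fun j => T.toList.getD j default, fun y hy => ?_⟩
  obtain ⟨i, hi, h⟩ := List.mem_iff_getElem.1 (Finset.mem_toList.2 hy)
  refine ⟨i, ?_, ?_⟩
  · rw [Finset.length_toList] at hi; omega
  · show T.toList.getD i default = y
    rw [List.getD_eq_getElem _ _ hi, h]

lemma complement_enum {N r h : ℕ} [NeZero N] (hr : 1 ≤ r) (hN : N = 2 * r + 2 * h + 3) {δ κ : ℤ}
    (h1 : (h : ℤ) < δ) (h2 : δ ≤ h + 2)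
    (h3 : ((h : ℤ) < κ ∧ κ ≤ h + 2 ∧ κ ≠ δ) ∨ (κ < -(h : ℤ) ∧ -(h : ℤ) - 2 ≤ κ)) :
    ∃ f : ℕ → ZMod N, ∀ y : ZMod N, (∀ z : ℤ, -(h : ℤ) ≤ z → z ≤ h → y ≠ z) → y ≠ δ → y ≠ κ →
      ∃ j < 2 * r, f j = y := by
  classical
  let S0 : Finset ℤ := insert δ (insert κ (Finset.Icc (-(h : ℤ)) h))
  have hS0 : S0.card = 2 * h + 3 := by
    rw [Finset.card_insert_of_notMem, Finset.card_insert_of_notMem, Int.card_Icc]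
    · omega
    · simp only [Finset.mem_Icc]; omega
    · simp only [Finset.mem_insert, Finset.mem_Icc]; omega
  let S : Finset (ZMod N) := S0.image (fun z : ℤ => (z : ZMod N))
  have hS : S.card = 2 * h + 3 := by
    rw [← hS0]
    apply Finset.card_image_of_injOn
    intro a ha b hb hab
    simp only [S0, Finset.coe_insert, Finset.coe_Icc, Set.mem_insert_iff, Set.mem_Icc] at ha hb
    refine int_cast_inj hab ?_ ?_ <;> (subst hN; push_cast; omega)
  have hT : (Finset.univ \ S).card ≤ 2 * r := by
    rw [Finset.card_univ_sdiff, ZMod.card]; omega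
  obtain ⟨f, hf⟩ := finset_enum _ hT
  refine ⟨f, fun y y1 y2 y3 => hf y ?_⟩
  simp only [Finset.mem_sdiff, Finset.mem_univ, true_and, S, S0, Finset.mem_image,
    Finset.mem_insert, Finset.mem_Icc]
  rintro ⟨z, (rfl | rfl | hz), rfl⟩
  · exact y2 rfl
  · exact y3 rfl
  · exact y1 z hz.1 hz.2 rfl

def mcyc {K N : ℕ} (h : ℕ) (e : ZMod K) (δ : ℤ) (i : ℕ) : ZMod K × ZMod N :=
  if i = 2 * (h + 1) then (e + e, ((δ : ℤ) : ZMod N))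
  else if i % 2 = 0 then (0, ((-((i / 2 : ℕ) : ℤ) : ℤ) : ZMod N))
  else (e, (((i / 2 : ℕ) : ℤ) - h : ℤ))

lemma mcyc_inj {K N r h : ℕ} (hN : N = 2 * r + 2 * h + 3) {e : ZMod K} (he : e ≠ 0)
    (he2 : e + e ≠ 0) (δ : ℤ) :
    ∀ i < 2 * (h + 1) + 1, ∀ j < 2 * (h + 1) + 1,
      mcyc (N := N) h e δ i = mcyc (N := N) h e δ j → i = j := by
  intro i hi j hj hij
  unfold mcyc at hij
  split_ifs at hij with a b c d f g k
  · omega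
  · simp [he2] at hij
  · simp [he] at hij
  · simp [Ne.symm he2] at hij
  · have := int_cast_inj (Prod.ext_iff.1 hij).2 (by omega) (by omega)
    omega
  · simp [Ne.symm he] at hij
  · simp [he] at hij
  · simp [he] at hij
  · have := int_cast_inj (Prod.ext_iff.1 hij).2 (by omega) (by omega)
    omega

theorem multi_one {K N r h : ℕ} [NeZero K] [NeZero N] (hK : 3 ≤ K) (hr : 1 ≤ r)
    (hN : N = 2 * r + 2 * h + 3)
    {e : ZMod K} (he : e ≠ 0) (he2 : e + e ≠ 0) {δ κ : ℤ}
    (h1 : (h : ℤ) < δ) (h2 : δ ≤ h + 2)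
    (h3 : ((h : ℤ) < κ ∧ κ ≤ h + 2 ∧ κ ≠ δ) ∨ (κ < -(h : ℤ) ∧ -(h : ℤ) - 2 ≤ κ)) :
    ∃ B : Bool × Bool × (ZMod K × ZMod N) → Blk (ZMod K × ZMod N) (2 * (h + 1) + 1) r,
      (∀ y : ZMod N, y ≠ κ → CC B (e, y)) ∧ CC B (e + e, (δ : ZMod N)) := by
  obtain ⟨f, hf⟩ := complement_enum hr hN h1 h2 h3
  obtain ⟨B, hB1, hB2⟩ := develop (q := h + 1) (r := r) (by omega) (mcyc (N := N) h e δ)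
    (mcyc_inj hN he he2 δ) (fun w j => (e, f (j + if w then r else 0)))
    (fun w j hj => he (Prod.ext_iff.1 hj).1)
    (by rw [Fintype.card_prod, ZMod.card, ZMod.card]; nlinarith)
  refine ⟨B, fun y hy => ?_, ?_⟩
  · by_cases hyδ : y = δ
    · have := hB1 (2 * h + 1) (by omega)
      rw [Nat.mod_eq_of_lt (by omega)] at this
      convert this using 1
      have a : ¬ (2 * h + 1 = 2 * (h + 1)) := by omega
      have b : ¬ ((2 * h + 1) % 2 = 0) := by omega
      have c : (2 * h + 1) / 2 = h := by omega
      have d : 2 * h + 1 + 1 = 2 * (h + 1) := by omega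
      simp [mcyc, a, b, c, d, hyδ]
    · by_cases hz : ∃ z : ℤ, -(h : ℤ) ≤ z ∧ z ≤ h ∧ y = z
      · obtain ⟨z, z1, z2, rfl⟩ := hz
        obtain ⟨i, rfl⟩ : ∃ i : ℕ, z = i - h := ⟨(z + h).toNat, by omega⟩
        have := hB1 i (by omega)
        rw [Nat.mod_eq_of_lt (by omega)] at this
        have a : ¬ (i = 2 * (h + 1)) := by omega
        have a' : ¬ (i + 1 = 2 * (h + 1)) := by omega
        rcases Nat.mod_two_eq_zero_or_one i with b | b
        · obtain ⟨l, rfl⟩ : ∃ l, i = 2 * l := ⟨i / 2, by omega⟩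
          convert this using 1
          have b' : ¬ ((2 * l + 1) % 2 = 0) := by omega
          have c : (2 * l + 1) / 2 = l := by omega
          have c' : (2 * l) / 2 = l := by omega
          simp only [mcyc, a, a', b, b', c, c', if_true, if_false]
          ext
          · simp
          · simp; ring
        · obtain ⟨l, rfl⟩ : ∃ l, i = 2 * l + 1 := ⟨i / 2, by omega⟩
          have := this.neg
          convert this using 1
          have b0 : ¬ ((2 * l + 1) % 2 = 0) := by omega
          have b' : (2 * l + 1 + 1) % 2 = 0 := by omega
          have c : (2 * l + 1) / 2 = l := by omega
          have c' : (2 * l + 1 + 1) / 2 = l + 1 := by omega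
          simp only [mcyc, a, a', b0, b', c, c', if_true, if_false]
          ext
          · simp
          · simp; ring
      · push Not at hz
        obtain ⟨j, hj, rfl⟩ := hf y (fun z a b => hz z a b) hyδ hy
        by_cases hjr : j < r
        · simpa using hB2 false j hjr
        · have := hB2 true (j - r) (by omega)
          rw [if_pos rfl, Nat.sub_add_cancel (by omega)] at this
          exact this
  · have := (hB1 (2 * (h + 1)) (by omega)).neg
    rw [Nat.mod_self] at this
    convert this using 1
    have a : ¬ (0 = 2 * (h + 1)) := by omega
    simp [mcyc]

def pp (I : ℕ) : ℕ := padicValNat 2 I % 2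

lemma pp_two {I : ℕ} (h : 1 ≤ I) : pp (2 * I) ≠ pp I := by
  unfold pp
  rw [padicValNat.mul (by omega) (by omega), padicValNat.self (by omega)]
  omega

lemma pp_lt (I : ℕ) : pp I < 2 := Nat.mod_lt _ (by omega)

def del (h J : ℕ) : ℤ := h + 1 + pp J

def kap (k h J : ℕ) : ℤ := if J % 2 = 0 then del h (J / 2) else -del h ((2 * k + 1 - J) / 2)

lemma natCast_ne {K a : ℕ} (h0 : 0 < a) (h1 : a < K ∨ (K < a ∧ a < 2 * K)) : (a : ZMod K) ≠ 0 := by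
  rw [Ne, ZMod.natCast_eq_zero_iff]
  rintro ⟨c, rfl⟩
  rcases h1 with h1 | ⟨h1, h2⟩
  · have : c < 1 := by nlinarith
    interval_cases c; omega
  · have : c < 2 := by nlinarith
    interval_cases c <;> omega

theorem multi_all (k : ℕ) {N r h : ℕ} [NeZero N] (hr : 1 ≤ r)
    (hN : N = 2 * r + 2 * h + 3) :
    ∃ B : Fin k × (Bool × Bool × (ZMod (2 * k + 1) × ZMod N)) →
        Blk (ZMod (2 * k + 1) × ZMod N) (2 * (h + 1) + 1) r,
      ∀ D : ZMod (2 * k + 1) × ZMod N, D.1 ≠ 0 → CC B D := by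
  have key : ∀ i : Fin k, ∃ B : Bool × Bool × (ZMod (2 * k + 1) × ZMod N) →
      Blk (ZMod (2 * k + 1) × ZMod N) (2 * (h + 1) + 1) r,
      (∀ y : ZMod N, y ≠ kap k h (i + 1) → CC B (((2 * (i + 1) : ℕ) : ZMod (2 * k + 1)), y)) ∧
      CC B (((2 * (i + 1) : ℕ) : ZMod (2 * k + 1)) + ((2 * (i + 1) : ℕ) : ZMod (2 * k + 1)),
        (del h (i + 1) : ZMod N)) := by
    intro i
    have hi := i.2
    have p1 := pp_lt (i + 1)
    have p2 := pp_lt ((i + 1) / 2)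
    have p3 := pp_lt ((2 * k + 1 - (i + 1)) / 2)
    apply multi_one (by omega) hr hN
    · exact natCast_ne (by omega) (by omega)
    · rw [← Nat.cast_add]
      exact natCast_ne (by omega) (by omega)
    · unfold del; omega
    · unfold del; omega
    · unfold kap del
      split_ifs with hp
      · left
        have := @pp_two ((i + 1) / 2) (by omega)
        rw [show 2 * (((i : ℕ) + 1) / 2) = i + 1 by omega] at this
        omega
      · right; omega
  choose B hB1 hB2 using key
  let BB : Fin k × (Bool × Bool × (ZMod (2 * k + 1) × ZMod N)) →
        Blk (ZMod (2 * k + 1) × ZMod N) (2 * (h + 1) + 1) r := fun x => B x.1 x.2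
  have lift : ∀ i D, CC (B i) D → CC BB D := by
    intro i D hD u a b
    obtain ⟨x, hx⟩ := hD u a b
    exact ⟨(i, x), hx⟩
  have even : ∀ J y, 1 ≤ J → J ≤ k → CC BB (((2 * J : ℕ) : ZMod (2 * k + 1)), y) := by
    intro J y hJ hJk
    obtain ⟨i, rfl⟩ : ∃ i, J = i + 1 := ⟨J - 1, by omega⟩
    by_cases hy : y = kap k h (i + 1)
    · subst hy
      unfold kap
      split_ifs with hp
      · have := hB2 ⟨(i + 1) / 2 - 1, by omega⟩
        simp only at this
        rw [show (i + 1) / 2 - 1 + 1 = (i + 1) / 2 by omega, ← Nat.cast_add,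
          show 2 * ((i + 1) / 2) + 2 * ((i + 1) / 2) = 2 * (i + 1) by omega] at this
        exact lift _ _ this
      · have := (hB2 ⟨(2 * k + 1 - (i + 1)) / 2 - 1, by omega⟩).neg
        simp only at this
        rw [show (2 * k + 1 - (i + 1)) / 2 - 1 + 1 = (2 * k + 1 - (i + 1)) / 2 by omega,
          ← Nat.cast_add] at this
        have h2 := lift _ _ this
        convert h2 using 1
        ext
        · simp only [Prod.fst_neg]
          rw [eq_neg_iff_add_eq_zero, ← Nat.cast_add, ZMod.natCast_eq_zero_iff]
          exact ⟨2, by omega⟩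
        · simp
    · exact lift ⟨i, by omega⟩ _ (hB1 ⟨i, by omega⟩ y hy)
  refine ⟨BB, ?_⟩
  rintro ⟨x, y⟩ hx
  have hv : x.val ≠ 0 := by rwa [Ne, ZMod.val_eq_zero]
  have hlt := x.val_lt
  rcases Nat.mod_two_eq_zero_or_one x.val with hp | hp
  · have := even (x.val / 2) y (by omega) (by omega)
    rwa [show 2 * (x.val / 2) = x.val by omega, ZMod.natCast_zmod_val] at this
  · have := (even ((2 * k + 1 - x.val) / 2) (-y) (by omega) (by omega)).neg
    convert this using 1
    ext
    · simp only [Prod.fst_neg]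
      rw [eq_neg_iff_add_eq_zero]
      nth_rewrite 1 [← ZMod.natCast_zmod_val x]
      rw [← Nat.cast_add, ZMod.natCast_eq_zero_iff]
      exact ⟨1, by omega⟩
    · simp

theorem assemble (k : ℕ) {r q n s : ℕ} (hr : 1 ≤ r) (hq : 1 ≤ q)
    (hn : n = s + 2 * r + (2 * q + 1)) (hk : n = (2 * k + 1) * (2 * r + (2 * q + 1))) :
    HOPSolution n s (r + 1) (fun i => if (i : ℕ) < r then 2 else 2 * q + 1) := by
  obtain ⟨V, ι, _, _, B0, hV, hι, hB0⟩ := core_all hq hr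
  obtain ⟨h, rfl⟩ : ∃ h, q = h + 1 := ⟨q - 1, by omega⟩
  obtain ⟨N, hN⟩ : ∃ N, N = 2 * r + (2 * (h + 1) + 1) := ⟨_, rfl⟩
  rw [← hN] at hV hk
  have : NeZero N := ⟨by omega⟩
  let e : V ≃ ZMod N := Fintype.equivOfCardEq (by rw [hV, ZMod.card])
  obtain ⟨B1, hB1⟩ := multi_all k (N := N) (h := h) hr (by omega)
  let g : ZMod (2 * k + 1) → V → ZMod (2 * k + 1) × ZMod N := fun c x => (c, e x)
  have hg : ∀ c, Function.Injective (g c) := fun c x y hxy => e.injective (Prod.ext_iff.1 hxy).2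
  have e2 : ZMod (2 * k + 1) × ZMod N ≃ Fin n := Fintype.equivFinOfCardEq (by
    rw [Fintype.card_prod, ZMod.card, ZMod.card, hk])
  refine Blk.solution (ι := (ZMod (2 * k + 1) × ι) ⊕
      (Fin k × (Bool × Bool × (ZMod (2 * k + 1) × ZMod N)))) e2 (by omega) hn ?_
    (Sum.elim (fun x => (B0 x.2).map (g x.1) (hg x.1)) B1) ?_
  · simp only [Fintype.card_sum, Fintype.card_prod, ZMod.card, hι, Fintype.card_fin,
      Fintype.card_bool, ← hN]
    obtain ⟨M, rfl⟩ : ∃ M, N = M + 1 := ⟨N - 1, by omega⟩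
    have : 2 * r + 2 * (h + 1) = M := by omega
    have h2 : n - 1 = (2 * k + 1) * M + 2 * k := by rw [hk, mul_add]; omega
    rw [this, h2, hk]
    ring
  · rintro ⟨u1, u2⟩ ⟨w1, w2⟩ a b huw
    by_cases h1 : u1 = w1
    · subst h1
      have : e.symm u2 ≠ e.symm w2 := by
        intro hh; apply huw; rw [e.symm.injective hh]
      obtain ⟨x, hx⟩ := hB0 _ _ a b this
      refine ⟨Sum.inl (u1, x), ?_⟩
      rcases hx with hx | hx
      · left; simpa [g] using hx.map (hg u1)
      · right; simpa [g] using hx.map (hg u1)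
    · obtain ⟨x, hx⟩ := hB1 ((w1, w2) - (u1, u2)) (by simpa [sub_eq_zero] using Ne.symm h1)
        (u1, u2) a b
      rw [add_sub_cancel] at hx
      exact ⟨Sum.inr x, hx⟩

theorem hop_final (s r m n : ℕ) (hr : 1 ≤ r) (hm : 3 ≤ m)
    (hmodd : Odd m) (hn : n = s + 2 * r + m)
    (hcong : n ≡ 2 * r + m [MOD 2 * (2 * r + m)]) :
    HOPSolution n s (r + 1) (fun i => if (i : ℕ) < r then 2 else m) := by
  obtain ⟨q, rfl⟩ := hmodd
  obtain ⟨k, hk⟩ := (Nat.modEq_iff_dvd' (by omega)).1 hcong.symm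
  refine assemble k hr (by omega) hn ?_
  have : n = 2 * (2 * r + (2 * q + 1)) * k + (2 * r + (2 * q + 1)) := by omega
  rw [this]; ring

end part10

/-- Corollary 5.5(ii): if `s ≥ 0`, `r ≥ 1`, `m ≥ 3` is odd, `n = s + 2r + m` and
`n ≡ 2r + m (mod 2(2r + m))`, then `HOP(2^⟨s⟩, 4^⟨r⟩, 2m)` has a solution. -/
theorem hop_four_tables_mod_half (s r m n : ℕ) (hr : 1 ≤ r) (hm : 3 ≤ m)
    (hmodd : Odd m) (hn : n = s + 2 * r + m)
    (hcong : n ≡ 2 * r + m [MOD 2 * (2 * r + m)]) :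
    HOPSolution n s (r + 1) (fun i => if (i : ℕ) < r then 2 else m) := by
  exact hop_final s r m n hr hm hmodd hn hcong
end

section
/- Let m ≥ 3 and k ≥ 1 be integers, let n = 2(m+2)k + 1 and s = n − (m + 2). Then HOP(2^⟨s⟩, 4, 2m) has a solution, i.e., HOP(2^⟨s⟩, 2m_1, 2m_2) has a solution with (m_1, m_2) = (2, m) (tables of sizes 4 and 2m). (In the paper this is stated as: 4K_n^• admits an HOP (C_2, C_m)-decomposition, which by the paper's Theorem 3.2 is equivalent to the stated HOP solution.) -/
/-- Even case of the cycle design. -/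
theorem design_even (h k : ℕ) (hh : 1 ≤ h) :
    ∃ v D : ℕ → ℕ → ℤ,
      (∀ i < k, ∀ r < 2 * h + 2, 0 ≤ v i r ∧ v i r ≤ ((2 * h + 2 + 2) * k : ℕ)) ∧
      (∀ i < k, ∀ r < 2 * h + 2, ∀ r' < 2 * h + 2, v i r = v i r' → r = r') ∧
      (∀ i < k, ∀ r < 2 * h + 2, 1 ≤ D i r ∧ D i r ≤ ((2 * h + 2 + 2) * k : ℕ)) ∧
      (∀ i < k, ∀ r < 2 * h + 1, v i (r + 1) - v i r = D i r ∨ v i (r + 1) - v i r = - D i r) ∧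
      (∀ i < k, v i (2 * h + 1) - v i 0 = D i (2 * h + 1)) ∧
      (∀ i < k, ∀ i' < k, ∀ r < 2 * h + 2, ∀ r' < 2 * h + 2,
        D i r = D i' r' → i = i' ∧ r = r') := by
  obtain ⟨h', hh'⟩ : ∃ h' : ℕ, h' = h + 1 - h % 2 := ⟨_, rfl⟩
  refine ⟨fun i r => if r % 2 = 0 then ((r / 2 + (if r ≥ h' then 1 else 0) : ℕ) : ℤ)
      else (((2 * h + 2 + 2) * i : ℕ) : ℤ) + 2 * h + 3 - (r / 2 : ℕ) -
        (if r = 2 * h + 1 ∧ h % 2 = 0 then 1 else 0),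
    fun i r => (((2 * h + 2 + 2) * i : ℕ) : ℤ) + 2 * h + 3 -
      (if r = 2 * h + 1 then (h' : ℤ) else if r = 2 * h ∧ h % 2 = 0 then 2 * h + 2 else
        if r ≥ h' then (r : ℤ) + 1 else r), ?_, ?_, ?_, ?_, ?_, ?_⟩
  · intro i hi r hr
    dsimp only
    have : (2 * h + 2 + 2) * (i + 1) ≤ (2 * h + 2 + 2) * k := Nat.mul_le_mul_left _ hi
    rw [mul_add] at this
    generalize (2 * h + 2 + 2) * i = c at *
    generalize (2 * h + 2 + 2) * k = L at *
    split_ifs <;> first | omega | contradiction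
  · intro i hi r hr r' hr'
    dsimp only
    generalize (2 * h + 2 + 2) * i = c at *
    split_ifs <;> first | omega | contradiction
  · intro i hi r hr
    dsimp only
    have : (2 * h + 2 + 2) * (i + 1) ≤ (2 * h + 2 + 2) * k := Nat.mul_le_mul_left _ hi
    rw [mul_add] at this
    generalize (2 * h + 2 + 2) * i = c at *
    generalize (2 * h + 2 + 2) * k = L at *
    split_ifs <;> first | omega | contradiction
  · intro i hi r hr
    dsimp only
    generalize (2 * h + 2 + 2) * i = c at *
    split_ifs <;> first | omega | contradiction
  · intro i hi
    dsimp only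
    generalize (2 * h + 2 + 2) * i = c at *
    split_ifs <;> first | omega | contradiction
  · intro i hi i' hi' r hr r' hr'
    dsimp only
    have key : i < i' ∨ i' < i ∨ i = i' := by omega
    rcases key with key | key | key
    · have : (2 * h + 2 + 2) * (i + 1) ≤ (2 * h + 2 + 2) * i' := Nat.mul_le_mul_left _ key
      rw [mul_add] at this
      generalize (2 * h + 2 + 2) * i = c at *
      generalize (2 * h + 2 + 2) * i' = c' at *
      split_ifs <;> first | omega | contradiction
    · have : (2 * h + 2 + 2) * (i' + 1) ≤ (2 * h + 2 + 2) * i := Nat.mul_le_mul_left _ key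
      rw [mul_add] at this
      generalize (2 * h + 2 + 2) * i = c at *
      generalize (2 * h + 2 + 2) * i' = c' at *
      split_ifs <;> first | omega | contradiction
    · subst key
      generalize (2 * h + 2 + 2) * i = c at *
      split_ifs <;> first | omega | contradiction

set_option maxHeartbeats 8000000 in
/-- Odd case of the cycle design. -/
theorem design_odd (h k : ℕ) (hh : 1 ≤ h) :
    ∃ v D : ℕ → ℕ → ℤ,
      (∀ i < k, ∀ r < 2 * h + 1, 0 ≤ v i r ∧ v i r ≤ ((2 * h + 1 + 2) * k : ℕ)) ∧
      (∀ i < k, ∀ r < 2 * h + 1, ∀ r' < 2 * h + 1, v i r = v i r' → r = r') ∧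
      (∀ i < k, ∀ r < 2 * h + 1, 1 ≤ D i r ∧ D i r ≤ ((2 * h + 1 + 2) * k : ℕ)) ∧
      (∀ i < k, ∀ r < 2 * h, v i (r + 1) - v i r = D i r ∨ v i (r + 1) - v i r = - D i r) ∧
      (∀ i < k, v i (2 * h) - v i 0 = D i (2 * h)) ∧
      (∀ i < k, ∀ i' < k, ∀ r < 2 * h + 1, ∀ r' < 2 * h + 1,
        D i r = D i' r' → i = i' ∧ r = r') := by
  obtain ⟨g, rfl⟩ : ∃ g, h = g + 1 := ⟨h - 1, by omega⟩
  -- the pair number `p`, and lower element of the pair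
  obtain ⟨u, hu⟩ : ∃ u : ℕ → ℕ, ∀ p, (2 * p + 2 ≤ g + 1 ∧ u p = 2 * p + 1) ∨
      (g + 1 < 2 * p + 2 ∧ u p = g + 1 + 2 * k + 2 * (p - (g + 1) / 2)) :=
    ⟨fun p => if 2 * p + 2 ≤ g + 1 then 2 * p + 1 else g + 1 + 2 * k + 2 * (p - (g + 1) / 2),
      fun p => by dsimp only; split_ifs <;> first | omega | contradiction⟩
  have hL : (2 * (g + 1) + 1 + 2) * k = 2 * (g * k) + 5 * k := by ring
  rw [hL]
  have hK : ∀ i < k, g * i + g ≤ g * k := fun i hi => by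
    have := Nat.mul_le_mul_left g hi
    rwa [Nat.succ_eq_add_one, mul_add, mul_one] at this
  refine ⟨fun i r => if r = 0 then 0 else if r = 1 then 2 * ((g * k : ℕ) : ℤ) + 4 * k + i + 1
      else if r % 2 = 0 then 2 * i + 1 + (r / 2 : ℕ)
      else 2 * i + 2 + (r / 2 : ℕ) + (u (g * i + (g - r / 2)) : ℤ),
    fun i r => if r = 0 then 2 * ((g * k : ℕ) : ℤ) + 4 * k + i + 1 else
      if r = 1 then 2 * ((g * k : ℕ) : ℤ) + 4 * k - i - 1 else
      if r = 2 * (g + 1) then 2 * i + 2 + g else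
      if r % 2 = 0 then (u (g * i + (g - r / 2)) : ℤ) + 1 else (u (g * i + (g - r / 2)) : ℤ),
      ?_, ?_, ?_, ?_, ?_, ?_⟩
  · intro i hi r hr
    dsimp only
    have h1 := hK i hi
    have h2 := hu (g * i + (g - r / 2))
    generalize u (g * i + (g - r / 2)) = U at *
    generalize g * i = c at *
    generalize g * k = K at *
    split_ifs <;> first | omega | contradiction
  · intro i hi r hr r' hr'
    dsimp only
    have h1 := hK i hi
    have h2 := hu (g * i + (g - r / 2))
    have h2' := hu (g * i + (g - r' / 2))
    have h3 : r / 2 = r' / 2 → u (g * i + (g - r / 2)) = u (g * i + (g - r' / 2)) := by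
      intro h; rw [h]
    generalize u (g * i + (g - r / 2)) = U at *
    generalize u (g * i + (g - r' / 2)) = U' at *
    generalize g * i = c at *
    generalize g * k = K at *
    split_ifs <;> first | omega | contradiction
  · intro i hi r hr
    dsimp only
    have h1 := hK i hi
    have h2 := hu (g * i + (g - r / 2))
    generalize u (g * i + (g - r / 2)) = U at *
    generalize g * i = c at *
    generalize g * k = K at *
    split_ifs <;> first | omega | contradiction
  · intro i hi r hr
    dsimp only
    have h1 := hK i hi
    have h2 := hu (g * i + (g - r / 2))
    have h2' := hu (g * i + (g - (r + 1) / 2))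
    have h3 : r / 2 = (r + 1) / 2 →
        u (g * i + (g - r / 2)) = u (g * i + (g - (r + 1) / 2)) := by
      intro h; rw [h]
    generalize u (g * i + (g - r / 2)) = U at *
    generalize u (g * i + (g - (r + 1) / 2)) = U' at *
    generalize g * i = c at *
    generalize g * k = K at *
    split_ifs <;> first | omega | contradiction
  · intro i hi
    dsimp only
    split_ifs <;> first | omega | contradiction
  · intro i hi i' hi' r hr r' hr'
    dsimp only
    have h1 := hK i hi
    have h1' := hK i' hi'
    have h2 := hu (g * i + (g - r / 2))
    have h2' := hu (g * i' + (g - r' / 2))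
    have key : i < i' ∨ i' < i ∨ i = i' := by omega
    rcases key with key | key | key
    · have := hK
      have : g * (i + 1) ≤ g * i' := Nat.mul_le_mul_left _ key
      rw [mul_add] at this
      generalize u (g * i + (g - r / 2)) = U at *
      generalize u (g * i' + (g - r' / 2)) = U' at *
      generalize g * i = c at *
      generalize g * i' = c' at *
      generalize g * k = K at *
      split_ifs <;> first | omega | contradiction
    · have : g * (i' + 1) ≤ g * i := Nat.mul_le_mul_left _ key
      rw [mul_add] at this
      generalize u (g * i + (g - r / 2)) = U at *
      generalize u (g * i' + (g - r' / 2)) = U' at *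
      generalize g * i = c at *
      generalize g * i' = c' at *
      generalize g * k = K at *
      split_ifs <;> first | omega | contradiction
    · subst key
      generalize u (g * i + (g - r / 2)) = U at *
      generalize u (g * i + (g - r' / 2)) = U' at *
      generalize g * i = c at *
      generalize g * k = K at *
      split_ifs <;> first | omega | contradiction

/-- The cycle design: `k` cycles of length `m` whose differences are pairwise distinct. -/
theorem design (m k : ℕ) (hm : 3 ≤ m) :
    ∃ v D : ℕ → ℕ → ℤ,
      (∀ i < k, ∀ r < m, 0 ≤ v i r ∧ v i r ≤ ((m + 2) * k : ℕ)) ∧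
      (∀ i < k, ∀ r < m, ∀ r' < m, v i r = v i r' → r = r') ∧
      (∀ i < k, ∀ r < m, 1 ≤ D i r ∧ D i r ≤ ((m + 2) * k : ℕ)) ∧
      (∀ i < k, ∀ r < m, v i ((r + 1) % m) - v i r = D i r ∨
        v i ((r + 1) % m) - v i r = - D i r) ∧
      (∀ i < k, ∀ i' < k, ∀ r < m, ∀ r' < m, D i r = D i' r' → i = i' ∧ r = r') := by
  rcases Nat.even_or_odd' m with ⟨g, rfl | rfl⟩
  · obtain ⟨h, rfl⟩ : ∃ h, g = h + 1 := ⟨g - 1, by omega⟩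
    obtain ⟨v, D, h1, h2, h3, h4, h5, h6⟩ := design_even h k (by omega)
    refine ⟨v, D, h1, h2, h3, ?_, h6⟩
    intro i hi r hr
    rcases Nat.lt_or_ge r (2 * h + 1) with hr' | hr'
    · rw [Nat.mod_eq_of_lt (by omega)]
      exact h4 i hi r hr'
    · have : r = 2 * h + 1 := by omega
      subst this
      have := h5 i hi
      rw [show 2 * h + 1 + 1 = 2 * (h + 1) by ring, Nat.mod_self]
      omega
  · obtain ⟨v, D, h1, h2, h3, h4, h5, h6⟩ := design_odd g k (by omega)
    refine ⟨v, D, h1, h2, h3, ?_, h6⟩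
    intro i hi r hr
    rcases Nat.lt_or_ge r (2 * g) with hr' | hr'
    · rw [Nat.mod_eq_of_lt (by omega)]
      exact h4 i hi r hr'
    · have : r = 2 * g := by omega
      subst this
      have := h5 i hi
      rw [Nat.mod_self]
      omega

theorem factor_exists {n s t : ℕ} (m : Fin t → ℕ) (hm : ∀ i, 2 ≤ m i)
    (X : Fin t → ℕ → Fin n) (A : Fin t → ℕ → Fin 2)
    (hinj : ∀ i r i' r', r < m i → r' < m i' → X i r = X i' r' → i = i' ∧ r = r')
    (hs : s + ∑ i, m i = n) :
    ∃ F : HOPFactor n s t m, ∀ e, ¬ IsIEdge e → (e ∈ F.edges ↔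
      ∃ i, ∃ r < m i, e = s((X i r, A i r + 1),
        (X i ((r + 1) % m i), A i ((r + 1) % m i)))) := by
  classical
  have hne : ∀ i, NeZero (2 * m i) := fun i => ⟨by have := hm i; omega⟩
  -- the couples on the cycles
  let S : Finset (Fin n) := Finset.univ.image (fun x : (i : Fin t) × Fin (m i) => X x.1 x.2)
  have hS : S.card = ∑ i, m i := by
    rw [Finset.card_image_of_injective]
    · simp
    · rintro ⟨i, r⟩ ⟨i', r'⟩ h
      obtain ⟨h1, h2⟩ := hinj i r i' r' r.2 r'.2 h
      subst h1
      have : r = r' := Fin.ext h2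
      subst this
      rfl
  have hSc : (Sᶜ).card = s := by
    rw [Finset.card_compl, hS, Fintype.card_fin]; omega
  let eq := (Sᶜ).equivFinOfCardEq hSc
  have val_succ : ∀ i (j : ZMod (2 * m i)), (j + 1).val =
      if j.val + 1 = 2 * m i then 0 else j.val + 1 := by
    intro i j
    have := hm i
    have h1 := ZMod.val_lt j
    rw [ZMod.val_add, ZMod.val_one_eq_one_mod, Nat.add_mod_mod]
    split_ifs with h
    · rw [h, Nat.mod_self]
    · exact Nat.mod_eq_of_lt (by omega)
  let cyc : (i : Fin t) → ZMod (2 * m i) → HOPVertex n := fun i j =>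
    (X i (j.val / 2), A i (j.val / 2) + if j.val % 2 = 0 then 0 else 1)
  have heven : ∀ (i : Fin t) (j : ZMod (2 * m i)),
      j.val % 2 = 0 → cyc i (j + 1) = HOPspouse (cyc i j) := by
    intro i j hj
    have h1 := ZMod.val_lt j
    have h2 : (j + 1).val = j.val + 1 := by
      rw [val_succ, if_neg (by omega)]
    have h3 : (j.val + 1) / 2 = j.val / 2 := by omega
    have h4 : ¬ (j.val + 1) % 2 = 0 := by omega
    simp only [cyc, HOPspouse, h2, h3, hj, if_neg h4, if_true, add_zero]
  have hodd : ∀ (i : Fin t) (j : ZMod (2 * m i)), j.val % 2 = 1 →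
      cyc i j = (X i (j.val / 2), A i (j.val / 2) + 1) ∧
      cyc i (j + 1) = (X i ((j.val / 2 + 1) % m i), A i ((j.val / 2 + 1) % m i)) := by
    intro i j hj
    have h1 := ZMod.val_lt j
    have h4 : ¬ (j.val) % 2 = 0 := by omega
    refine ⟨by simp only [cyc, if_neg h4], ?_⟩
    have h5 : (j + 1).val % 2 = 0 ∧ (j + 1).val / 2 = (j.val / 2 + 1) % m i := by
      rw [val_succ]
      split_ifs with h
      · have : j.val / 2 + 1 = m i := by omega
        rw [this, Nat.mod_self]; simp
      · rw [Nat.mod_eq_of_lt (a := j.val / 2 + 1) (by omega)]; omega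
    simp only [cyc, h5.1, h5.2, if_true, add_zero]
  refine ⟨⟨fun a => ((eq.symm a : Fin n), 0), cyc, heven, ?_, ?_⟩, ?_⟩
  · intro i j hj
    obtain ⟨h1, h2⟩ := hodd i j hj
    have hlt := ZMod.val_lt j
    have := hm i
    rw [h1, h2]
    rintro ⟨v, hv⟩
    have hX : X i (j.val / 2) = X i ((j.val / 2 + 1) % m i) := by
      rw [Sym2.eq_iff] at hv
      rcases hv with ⟨ha, hb⟩ | ⟨ha, hb⟩
      · exact (congrArg Prod.fst ha).trans (congrArg Prod.fst hb).symm
      · exact (congrArg Prod.fst ha).trans (congrArg Prod.fst hb).symm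
    have := (hinj _ _ _ _ (by omega) (Nat.mod_lt _ (by omega)) hX).2
    rcases Nat.lt_or_ge (j.val / 2 + 1) (m i) with h | h
    · rw [Nat.mod_eq_of_lt h] at this; omega
    · have h' : j.val / 2 + 1 = m i := by omega
      rw [h', Nat.mod_self] at this; omega
  · rw [Fintype.bijective_iff_surjective_and_card]
    constructor
    · rintro ⟨c, b⟩
      by_cases hc : c ∈ S
      · obtain ⟨⟨i, r⟩, -, rfl⟩ := Finset.mem_image.1 hc
        have hr := r.2
        have hd : A i r = b ∨ A i r + 1 = b := by
          generalize A i r = a; revert a b; decide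
        rcases hd with hd | hd
        · refine ⟨Sum.inr ⟨i, ((2 * r : ℕ) : ZMod (2 * m i))⟩, ?_⟩
          have hv : ((2 * r : ℕ) : ZMod (2 * m i)).val = 2 * r :=
            ZMod.val_cast_of_lt (by omega)
          simp only [Sum.elim_inr, cyc, hv]
          simp [hd]
        · refine ⟨Sum.inr ⟨i, ((2 * r + 1 : ℕ) : ZMod (2 * m i))⟩, ?_⟩
          have hv : ((2 * r + 1 : ℕ) : ZMod (2 * m i)).val = 2 * r + 1 :=
            ZMod.val_cast_of_lt (by omega)
          have h2 : (2 * (r : ℕ) + 1) / 2 = r := by omega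
          have h3 : ¬ (2 * (r : ℕ) + 1) % 2 = 0 := by omega
          simp only [Sum.elim_inr, cyc, hv, h2, if_neg h3]
          simp [hd]
      · refine ⟨Sum.inl (eq ⟨c, by simpa using hc⟩, b), ?_⟩
        have hb : b = 0 ∨ b = 1 := by revert b; decide
        rcases hb with rfl | rfl <;> simp [HOPspouse]
    · simp only [Fintype.card_sum, Fintype.card_prod, Fintype.card_fin, Fintype.card_sigma,
        ZMod.card]
      rw [← Finset.mul_sum, ← hs]
      ring
  · intro e he
    constructor
    · rintro (⟨a, rfl⟩ | ⟨i, j, rfl⟩)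
      · exact absurd ⟨_, rfl⟩ he
      · have hlt := ZMod.val_lt j
        rcases Nat.mod_two_eq_zero_or_one j.val with hj | hj
        · refine absurd ⟨cyc i j, ?_⟩ he
          rw [← heven i j hj]
        · refine ⟨i, j.val / 2, by omega, ?_⟩
          rw [← (hodd i j hj).1, ← (hodd i j hj).2]
    · rintro ⟨i, r, hr, rfl⟩
      refine Or.inr ⟨i, ((2 * r + 1 : ℕ) : ZMod (2 * m i)), ?_⟩
      have hv : ((2 * r + 1 : ℕ) : ZMod (2 * m i)).val = 2 * r + 1 :=
        ZMod.val_cast_of_lt (by omega)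
      have h2 : (2 * r + 1) / 2 = r := by omega
      obtain ⟨h3, h4⟩ := hodd i ((2 * r + 1 : ℕ) : ZMod (2 * m i)) (by rw [hv]; omega)
      rw [hv, h2] at h3 h4
      change _ = s(cyc i _, cyc i _)
      rw [h3, h4]

/-- Orientations of the couples on the long cycle, in copy `pq`. -/
def hopCol (m r : ℕ) (pq : Fin 2 × Fin 2) : Fin 2 :=
  if r + 1 = m ∧ m % 2 = 1 then pq.1 + pq.2 else if r % 2 = 0 then pq.1 else pq.2

theorem hopCol_bij (m r : ℕ) (hm : 3 ≤ m) (hr : r < m) (a b : Fin 2) :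
    ∃! pq, a = hopCol m r pq + 1 ∧ b = hopCol m ((r + 1) % m) pq := by
  have h1 : (r + 1) % m = if r + 1 = m then 0 else r + 1 := by
    split_ifs with h
    · rw [h, Nat.mod_self]
    · exact Nat.mod_eq_of_lt (by omega)
  have key : (∀ pq, hopCol m r pq = pq.1 ∧ hopCol m ((r + 1) % m) pq = pq.2) ∨
      (∀ pq, hopCol m r pq = pq.2 ∧ hopCol m ((r + 1) % m) pq = pq.1) ∨
      (∀ pq, hopCol m r pq = pq.2 ∧ hopCol m ((r + 1) % m) pq = pq.1 + pq.2) ∨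
      (∀ pq, hopCol m r pq = pq.1 + pq.2 ∧ hopCol m ((r + 1) % m) pq = pq.1) := by
    rw [h1]
    unfold hopCol
    split_ifs <;> first | omega | simp
  rcases key with key | key | key | key <;> simp only [key, ExistsUnique] <;> revert a b <;> decide

/-- Every nonzero residue modulo `2L+1` is `±d` for `1 ≤ d ≤ L`. -/
theorem residue_rep (L : ℕ) (δ : ZMod (2 * L + 1)) (h : δ ≠ 0) :
    ∃ d : ℕ, 1 ≤ d ∧ d ≤ L ∧ (δ = d ∨ δ = -d) := by
  refine ⟨δ.valMinAbs.natAbs, ?_, ?_, ?_⟩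
  · rw [Nat.one_le_iff_ne_zero]
    simpa using h
  · have := ZMod.natAbs_valMinAbs_le δ; omega
  · rcases Int.natAbs_eq δ.valMinAbs with h | h
    · left
      have h2 := congrArg (Int.cast : ℤ → ZMod (2 * L + 1)) h
      rwa [ZMod.coe_valMinAbs, Int.cast_natCast] at h2
    · right
      have h2 := congrArg (Int.cast : ℤ → ZMod (2 * L + 1)) h
      rwa [ZMod.coe_valMinAbs, Int.cast_neg, Int.cast_natCast] at h2

theorem zmod_int_small (n : ℕ) (a : ℤ) (h : (a : ZMod n) = 0) (h1 : -n < a) (h2 : a < n) :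
    a = 0 := by
  rw [ZMod.intCast_zmod_eq_zero_iff_dvd] at h
  exact Int.eq_zero_of_abs_lt_dvd h (by rw [abs_lt]; exact ⟨h1, h2⟩)

/-- The base system of signed differences. -/
theorem base_system (m k n : ℕ) (hm : 3 ≤ m) (hn : n = 2 * (m + 2) * k + 1) :
    ∃ (v : Fin k → ℕ → ZMod n) (E : Fin k × Fin 2 → ZMod n)
      (σ : (Fin k × Fin m) ⊕ (Fin k × Fin 2) → ZMod n),
      (∀ i, ∀ r < m, ∀ r' < m, v i r = v i r' → r = r') ∧
      (∀ i (r : Fin m), v i ((r + 1) % m) - v i r = σ (Sum.inl (i, r))) ∧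
      (∀ w, E w = σ (Sum.inr w)) ∧
      (∀ w, σ w ≠ 0) ∧
      (∀ w w', σ w = σ w' ∨ σ w = - σ w' → w = w') ∧
      (∀ δ : ZMod n, δ ≠ 0 → ∃ w, δ = σ w ∨ δ = - σ w) := by
  classical
  obtain ⟨v, D, hv, hvinj, hD, hvD, hDinj⟩ := design m k hm
  obtain ⟨L, hL⟩ : ∃ L, L = (m + 2) * k := ⟨_, rfl⟩
  have hnL : n = 2 * L + 1 := by rw [hn, hL]; ring
  rw [← hL] at hv hD
  let DD : Fin k × Fin m → ℕ := fun w => (D w.1 w.2).toNat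
  have hDD : ∀ w, ((DD w : ℕ) : ℤ) = D w.1 w.2 := fun w =>
    Int.toNat_of_nonneg (by have := (hD w.1 w.1.2 w.2 w.2.2).1; omega)
  have hDDinj : Function.Injective DD := by
    rintro ⟨i, r⟩ ⟨i', r'⟩ h
    have h' : D i r = D i' r' := by
      have h1 := hDD (i, r); have h2 := hDD (i', r'); rw [← h, h1] at h2; exact h2
    obtain ⟨h1, h2⟩ := hDinj i i.2 i' i'.2 r r.2 r' r'.2 h'
    exact Prod.ext (Fin.ext h1) (Fin.ext h2)
  let U := Finset.univ.image DD
  have hU : U ⊆ Finset.Icc 1 L := by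
    intro x hx
    obtain ⟨w, -, rfl⟩ := Finset.mem_image.1 hx
    have h1 := hDD w
    have h2 := hD w.1 w.1.2 w.2 w.2.2
    rw [Finset.mem_Icc]; omega
  have hUc : (Finset.Icc 1 L \ U).card = Fintype.card (Fin k × Fin 2) := by
    rw [Finset.card_sdiff_of_subset hU, Finset.card_image_of_injective _ hDDinj]
    simp only [Nat.card_Icc, Finset.card_univ, Fintype.card_prod, Fintype.card_fin]
    rw [hL, add_mul, Nat.add_sub_cancel, mul_comm m k, Nat.add_sub_cancel_left, mul_comm]
  let eq : ↥(Finset.Icc 1 L \ U) ≃ Fin k × Fin 2 :=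
    Fintype.equivOfCardEq (by rw [Fintype.card_coe, hUc])
  -- absolute differences
  let T : (Fin k × Fin m) ⊕ (Fin k × Fin 2) → ℕ :=
    Sum.elim DD (fun w => ((eq.symm w : ↥(Finset.Icc 1 L \ U)) : ℕ))
  have hTr : ∀ w, 1 ≤ T w ∧ T w ≤ L := by
    rintro (w | w)
    · exact Finset.mem_Icc.1 (hU (Finset.mem_image_of_mem DD (Finset.mem_univ w)))
    · exact Finset.mem_Icc.1 (Finset.mem_sdiff.1 (eq.symm w).2).1
  have hTinj : ∀ w w', T w = T w' → w = w' := by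
    have hne : ∀ w w', T (Sum.inl w) ≠ T (Sum.inr w') := by
      intro w w' h
      apply (Finset.mem_sdiff.1 (eq.symm w').2).2
      change T (Sum.inr w') ∈ U
      rw [← h]
      exact Finset.mem_image_of_mem DD (Finset.mem_univ w)
    rintro (w | w) (w' | w') h
    · rw [hDDinj h]
    · exact absurd h (hne _ _)
    · exact absurd h.symm (hne _ _)
    · rw [eq.symm.injective (Subtype.ext h)]
  have hTsurj : ∀ d, 1 ≤ d → d ≤ L → ∃ w, T w = d := by
    intro d h1 h2
    by_cases hd : d ∈ U
    · obtain ⟨w, -, hw⟩ := Finset.mem_image.1 hd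
      exact ⟨Sum.inl w, hw⟩
    · refine ⟨Sum.inr (eq ⟨d, Finset.mem_sdiff.2 ⟨Finset.mem_Icc.2 ⟨h1, h2⟩, hd⟩⟩), ?_⟩
      simp [T]
  let σ : (Fin k × Fin m) ⊕ (Fin k × Fin 2) → ZMod n :=
    Sum.elim (fun w => ((v w.1 ((w.2 + 1) % m) - v w.1 w.2 : ℤ) : ZMod n))
      (fun w => (T (Sum.inr w) : ZMod n))
  have hσT : ∀ w, σ w = (T w : ZMod n) ∨ σ w = -(T w : ZMod n) := by
    rintro (w | w)
    · have h1 : ((T (Sum.inl w) : ℕ) : ZMod n) = ((D w.1 w.2 : ℤ) : ZMod n) := by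
        rw [← hDD w, Int.cast_natCast]; rfl
      rw [h1]
      rcases hvD w.1 w.1.2 w.2 w.2.2 with h | h
      · left; simp only [σ, Sum.elim_inl, h]
      · right; simp only [σ, Sum.elim_inl, h, Int.cast_neg]
    · left; rfl
  have hTT : ∀ w w', (T w : ZMod n) = T w' ∨ (T w : ZMod n) = - T w' → w = w' := by
    intro w w' h
    have h1 := hTr w
    have h2 := hTr w'
    rcases h with h | h
    · apply hTinj
      have := zmod_int_small n ((T w : ℤ) - T w') (by push_cast; exact sub_eq_zero.2 h)
        (by omega) (by omega)
      omega
    · have := zmod_int_small n ((T w : ℤ) + T w') (by push_cast; rw [h]; ring)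
        (by omega) (by omega)
      omega
  refine ⟨fun i r => ((v i r : ℤ) : ZMod n), fun w => (T (Sum.inr w) : ZMod n), σ,
    ?_, ?_, ?_, ?_, ?_, ?_⟩
  · intro i r hr r' hr' h
    apply hvinj i i.2 r hr r' hr'
    have h1 := hv i i.2 r hr
    have h2 := hv i i.2 r' hr'
    have := zmod_int_small n (v i r - v i r') (by push_cast; exact sub_eq_zero.2 h)
        (by omega) (by omega)
    omega
  · intro i r
    simp only [σ, Sum.elim_inl, Int.cast_sub]
  · intro w; rfl
  · intro w h
    have h1 := hTr w
    have h0 : (T w : ZMod n) = 0 := by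
      rcases hσT w with h' | h'
      · rw [← h', h]
      · rw [h] at h'; exact (neg_eq_zero.1 h'.symm)
    have := zmod_int_small n (T w) (by push_cast; exact h0) (by omega) (by omega)
    omega
  · intro w w' h
    apply hTT
    rcases hσT w with h1 | h1 <;> rcases hσT w' with h2 | h2 <;> rw [h1, h2] at h
    · exact h
    · rw [neg_neg] at h; exact h.symm
    · rw [neg_inj, neg_eq_iff_eq_neg] at h; exact h.symm
    · rw [neg_inj, neg_inj] at h; exact h
  · intro δ hδ
    subst hnL
    obtain ⟨d, h1, h2, h3⟩ := residue_rep L δ hδ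
    obtain ⟨w, rfl⟩ := hTsurj d h1 h2
    refine ⟨w, ?_⟩
    rcases hσT w with h4 | h4 <;> rw [h4]
    · exact h3
    · rw [neg_neg]; exact h3.symm

theorem avoid (n m : ℕ) [NeZero n] (hmn : 2 * m < n) (f : ℕ → ZMod n) (d : ZMod n) :
    ∃ y, ∀ r < m, f r ≠ y ∧ f r ≠ y + d := by
  classical
  by_contra! hcon
  have : (Finset.univ : Finset (ZMod n)) ⊆
      (Finset.range m).image f ∪ (Finset.range m).image (fun r => f r - d) := by
    intro y _
    obtain ⟨r, hr, h⟩ := hcon y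
    rw [Finset.mem_union, Finset.mem_image, Finset.mem_image]
    by_cases hf : f r = y
    · exact Or.inl ⟨r, Finset.mem_range.2 hr, hf⟩
    · exact Or.inr ⟨r, Finset.mem_range.2 hr, by rw [h hf]; ring⟩
  have h1 := Finset.card_le_card this
  have h2 := Finset.card_union_le ((Finset.range m).image f)
    ((Finset.range m).image (fun r => f r - d))
  have h3 : ((Finset.range m).image f).card ≤ m :=
    Finset.card_image_le.trans (by simp)
  have h4 : ((Finset.range m).image (fun r => f r - d)).card ≤ m :=
    Finset.card_image_le.trans (by simp)
  rw [Finset.card_univ, ZMod.card] at h1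
  omega

/-- Lemma 5.1: for `m ≥ 3`, `k ≥ 1`, `n = 2(m+2)k + 1` and `s = n - (m+2)`,
`HOP(2^⟨s⟩, 4, 2m)` has a solution. -/
theorem hop_C2_Cm_mod_one (m k n s : ℕ) (hm : 3 ≤ m) (hk : 1 ≤ k)
    (hn : n = 2 * (m + 2) * k + 1) (hs : s = n - (m + 2)) :
    HOPSolution n s 2 ![2, m] := by
  classical
  obtain ⟨v, E, σ, hvinj, hvσ, hEσ, hσ0, hσinj, hσsurj⟩ := base_system m k n hm hn
  have hkm : (m + 2) * 1 ≤ (m + 2) * k := Nat.mul_le_mul_left _ hk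
  have hn2 : n = 2 * ((m + 2) * k) + 1 := by rw [hn]; ring
  haveI : NeZero n := ⟨by omega⟩
  let ε : ZMod n ≃ Fin n := (ZMod.finEquiv n).symm.toEquiv
  choose Y hY using fun (i : Fin k) (p : Fin 2) => avoid n m (by omega) (v i) (E (i, p))
  let J := Fin k × (Fin 2 × Fin 2) × ZMod n
  let X : J → Fin 2 → ℕ → ZMod n := fun j c r =>
    if c = 0 then (if r = 0 then Y j.1 j.2.1.1 + j.2.2
      else Y j.1 j.2.1.1 + E (j.1, j.2.1.1) + j.2.2)
    else v j.1 r + j.2.2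
  let A : J → Fin 2 → ℕ → Fin 2 := fun j c r =>
    if c = 0 then (if r = 0 then 0 else j.2.1.2) else hopCol m r j.2.1
  have hE0 : ∀ w, E w ≠ 0 := fun w => by rw [hEσ]; exact hσ0 _
  have hfac : ∀ j : J, ∃ F : HOPFactor n s 2 ![2, m], ∀ e, ¬ IsIEdge e → (e ∈ F.edges ↔
      ∃ c, ∃ r < (![2, m] : Fin 2 → ℕ) c, e = s((ε (X j c r), A j c r + 1),
        (ε (X j c ((r + 1) % (![2, m] : Fin 2 → ℕ) c)),
          A j c ((r + 1) % (![2, m] : Fin 2 → ℕ) c)))) := by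
    rintro ⟨i, ⟨p, q⟩, t⟩
    refine factor_exists ![2, m] ?_ (fun c r => ε (X (i, (p, q), t) c r)) (A (i, (p, q), t)) ?_ ?_
    · rw [Fin.forall_fin_two]; simp; omega
    · intro c r c' r' hr hr' h
      have h := ε.injective h
      have hall : ∀ c : Fin 2, c = 0 ∨ c = 1 := by decide
      have hc : c = 0 ∨ c = 1 := hall c
      have hc' : c' = 0 ∨ c' = 1 := hall c'
      rcases hc with rfl | rfl <;> rcases hc' with rfl | rfl
      · refine ⟨rfl, ?_⟩
        simp at hr hr'
        simp only [X, if_true] at h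
        by_contra hrr
        split_ifs at h with h1 h2 h2
        · omega
        · exact hE0 (i, p) (by linear_combination -h)
        · exact hE0 (i, p) (by linear_combination h)
        · omega
      · exfalso
        simp at hr hr'
        simp only [X, if_true, one_ne_zero, if_false] at h
        have h3 := hY i p r' hr'
        split_ifs at h
        · exact h3.1 (by linear_combination -h)
        · exact h3.2 (by linear_combination -h)
      · exfalso
        simp at hr hr'
        simp only [X, if_true, one_ne_zero, if_false] at h
        have h3 := hY i p r hr
        split_ifs at h
        · exact h3.1 (by linear_combination h)
        · exact h3.2 (by linear_combination h)
      · refine ⟨rfl, ?_⟩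
        simp at hr hr'
        simp only [X, one_ne_zero, if_false] at h
        exact hvinj i r hr r' hr' (by linear_combination h)
    · simp [Fin.sum_univ_two]; omega
  choose F hF using hfac
  -- oriented edges
  let Dart : J → (ZMod n × Fin 2) → (ZMod n × Fin 2) → Prop := fun j P Q =>
    (∃ r : Fin m, P = (v j.1 r + j.2.2, hopCol m r j.2.1 + 1) ∧
      Q = (v j.1 ((r + 1) % m) + j.2.2, hopCol m ((r + 1) % m) j.2.1)) ∨
    (∃ b : Fin 2, P = (Y j.1 j.2.1.1 + j.2.2, b) ∧
      Q = (Y j.1 j.2.1.1 + E (j.1, j.2.1.1) + j.2.2, j.2.1.2 + b + 1))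
  have hpair : ∀ (x y : ZMod n) (a b : Fin 2) (P : ZMod n × Fin 2),
      (ε P.1, P.2) = (ε x, a) ↔ P = (x, a) := by
    intro x y a b P
    rw [Prod.ext_iff, Prod.ext_iff]
    simp
  have hsym : ∀ (P Q : ZMod n × Fin 2) (x y : ZMod n) (a b : Fin 2),
      s(((ε P.1, P.2) : HOPVertex n), (ε Q.1, Q.2)) = s((ε x, a), (ε y, b)) ↔
        (P = (x, a) ∧ Q = (y, b)) ∨ (P = (y, b) ∧ Q = (x, a)) := by
    intro P Q x y a b
    rw [Sym2.eq_iff]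
    simp only [Prod.ext_iff, EmbeddingLike.apply_eq_iff_eq]
  have hedge : ∀ (j : J) (P Q : ZMod n × Fin 2),
      ¬ IsIEdge s(((ε P.1, P.2) : HOPVertex n), (ε Q.1, Q.2)) →
      (s(((ε P.1, P.2) : HOPVertex n), (ε Q.1, Q.2)) ∈ (F j).edges ↔
        Dart j P Q ∨ Dart j Q P) := by
    rintro ⟨i, ⟨p, q⟩, t⟩ P Q hI
    rw [hF _ _ hI, Fin.exists_fin_two]
    simp only [Matrix.cons_val_zero, Matrix.cons_val_one, hsym]
    constructor
    · rintro (⟨r, hr, h⟩ | ⟨r, hr, h⟩)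
      · have hr' : r = 0 ∨ r = 1 := by omega
        rcases hr' with rfl | rfl
        · simp [X, A] at h
          rcases h with h | h
          · exact Or.inl (Or.inr ⟨1, h.1, by rw [h.2, add_assoc q]; simp⟩)
          · exact Or.inr (Or.inr ⟨1, h.2, by rw [h.1, add_assoc q]; simp⟩)
        · simp [X, A] at h
          rcases h with h | h
          · exact Or.inr (Or.inr ⟨0, h.2, by rw [h.1]; simp⟩)
          · exact Or.inl (Or.inr ⟨0, h.1, by rw [h.2]; simp⟩)
      · simp only [X, A, one_ne_zero, if_false] at h
        rcases h with h | h
        · exact Or.inl (Or.inl ⟨⟨r, hr⟩, h⟩)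
        · exact Or.inr (Or.inl ⟨⟨r, hr⟩, h.2, h.1⟩)
    · have h2 : ∀ b : Fin 2, b = 0 ∨ b = 1 := by decide
      have h11 : ∀ q : Fin 2, q + 1 + 1 = q := by decide
      rintro ((⟨r, h⟩ | ⟨b, h⟩) | (⟨r, h⟩ | ⟨b, h⟩))
      · exact Or.inr ⟨r, r.2, Or.inl h⟩
      · rcases h2 b with rfl | rfl
        · exact Or.inl ⟨1, by omega, Or.inr (by simpa [X, A] using h)⟩
        · exact Or.inl ⟨0, by omega, Or.inl (by simpa [X, A, h11] using h)⟩
      · exact Or.inr ⟨r, r.2, Or.inr h.symm⟩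
      · rcases h2 b with rfl | rfl
        · exact Or.inl ⟨1, by omega, Or.inl (by simpa [X, A] using h.symm)⟩
        · exact Or.inl ⟨0, by omega, Or.inr (by simpa [X, A, h11] using h.symm)⟩
  have hDσ : ∀ j P Q, Dart j P Q → ∃ w, Q.1 - P.1 = σ w := by
    rintro ⟨i, ⟨p, q⟩, t⟩ P Q (⟨r, rfl, rfl⟩ | ⟨b, rfl, rfl⟩)
    · exact ⟨_, by rw [← hvσ i r]; ring⟩
    · exact ⟨_, by rw [← hEσ (i, p)]; ring⟩
  have hDuniq : ∀ P Q w, Q.1 - P.1 = σ w → ∃! j, Dart j P Q := by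
    rintro ⟨x, a⟩ ⟨y, b⟩ (⟨i, r⟩ | ⟨i, p⟩) hw
    · obtain ⟨pq, ⟨hp1, hp2⟩, hpu⟩ := hopCol_bij m r hm r.2 a b
      dsimp only at hw
      refine ⟨(i, pq, x - v i r), Or.inl ⟨r, ?_, ?_⟩, ?_⟩
      · dsimp only; rw [← hp1]; congr 1; ring
      · dsimp only; rw [← hp2]; congr 1
        rw [← hvσ] at hw
        linear_combination hw
      · rintro ⟨i', pq', t'⟩ (⟨r', h1, h2⟩ | ⟨b', h1, h2⟩)
        · simp only [Prod.mk.injEq] at h1 h2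
          have hww := hσinj (Sum.inl (i', r')) (Sum.inl (i, r)) (Or.inl (by
            rw [← hw, ← hvσ, h1.1, h2.1]; ring))
          obtain ⟨rfl, rfl⟩ : i' = i ∧ r' = r := by simpa using hww
          have := hpu pq' ⟨h1.2, h2.2⟩
          subst this
          rw [h1.1, add_sub_cancel_left]
        · exfalso
          simp only [Prod.mk.injEq] at h1 h2
          have hww := hσinj (Sum.inr (i', pq'.1)) (Sum.inl (i, r)) (Or.inl (by
            rw [← hw, ← hEσ, h1.1, h2.1]; ring))
          simp at hww
    · dsimp only at hw
      rw [← hEσ] at hw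
      refine ⟨(i, (p, b - a - 1), x - Y i p), Or.inr ⟨a, ?_, ?_⟩, ?_⟩
      · dsimp only; congr 1; ring
      · dsimp only; congr 1
        · linear_combination hw
        · clear hw; revert a b; decide
      · rintro ⟨i', ⟨p', q'⟩, t'⟩ (⟨r', h1, h2⟩ | ⟨b', h1, h2⟩)
        · exfalso
          simp only [Prod.mk.injEq] at h1 h2
          have hww := hσinj (Sum.inl (i', r')) (Sum.inr (i, p)) (Or.inl (by
            rw [← hEσ, ← hw, ← hvσ, h1.1, h2.1]; ring))
          simp at hww
        · simp only [Prod.mk.injEq] at h1 h2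
          have hww := hσinj (Sum.inr (i', p')) (Sum.inr (i, p)) (Or.inl (by
            rw [← hEσ, ← hEσ, ← hw, h1.1, h2.1]; ring))
          obtain ⟨rfl, rfl⟩ : i' = i ∧ p' = p := by simpa using hww
          have hq : q' = b - a - 1 := by
            rw [h2.2, h1.2]; clear h1 h2; revert q' b'; decide
          rw [hq, h1.1, add_sub_cancel_left]
  have hnot : ∀ j j' P Q, Dart j P Q → ¬ Dart j' Q P := by
    intro j j' P Q h h'
    obtain ⟨w, hw⟩ := hDσ _ _ _ h
    obtain ⟨w', hw'⟩ := hDσ _ _ _ h'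
    have h1 : σ w = - σ w' := by rw [← hw, ← hw']; ring
    have h2 := hσinj w w' (Or.inr h1)
    subst h2
    -- `n` is odd, so `2 σ = 0` forces `σ = 0`
    apply hσ0 w
    have h3 : (2 : ZMod n) * σ w = 0 := by linear_combination h1
    have h4 : (2 : ZMod n) * (((m + 2) * k : ℕ) : ZMod n) = -1 := by
      have : ((2 * ((m + 2) * k) + 1 : ℕ) : ZMod n) = 0 := by rw [← hn2]; simp
      push_cast at this ⊢
      linear_combination this
    linear_combination (-(((m + 2) * k : ℕ) : ZMod n)) * h3 + σ w * h4
  have hmain : ∀ e : Sym2 (HOPVertex n), ¬ e.IsDiag → ¬ IsIEdge e →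
      ∃! j : J, e ∈ (F j).edges := by
    intro e
    induction e using Sym2.ind with
    | _ P' Q' =>
      obtain ⟨P, rfl⟩ : ∃ P : ZMod n × Fin 2, P' = (ε P.1, P.2) :=
        ⟨(ε.symm P'.1, P'.2), by simp⟩
      obtain ⟨Q, rfl⟩ : ∃ Q : ZMod n × Fin 2, Q' = (ε Q.1, Q.2) :=
        ⟨(ε.symm Q'.1, Q'.2), by simp⟩
      intro hdiag hI
      have hne : Q.1 - P.1 ≠ 0 := by
        intro h
        have h : Q.1 = P.1 := sub_eq_zero.1 h
        have h2 : ∀ a b : Fin 2, a = b ∨ b = a + 1 := by decide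
        rcases h2 P.2 Q.2 with h3 | h3
        · exact hdiag (by rw [Sym2.mk_isDiag_iff, h, h3])
        · exact hI ⟨(ε P.1, P.2), by rw [HOPspouse, h, h3]⟩
      simp only [hedge _ P Q hI]
      obtain ⟨w, hw | hw⟩ := hσsurj _ hne
      · obtain ⟨j, hj, hju⟩ := hDuniq P Q w hw
        refine ⟨j, Or.inl hj, ?_⟩
        rintro j' (h | h)
        · exact hju j' h
        · exact absurd h (hnot j j' P Q hj)
      · obtain ⟨j, hj, hju⟩ := hDuniq Q P w (by linear_combination -hw)
        refine ⟨j, Or.inr hj, ?_⟩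
        rintro j' (h | h)
        · exact absurd h (hnot j j' Q P hj)
        · exact hju j' h
  refine ⟨Fintype.card J, ?_, fun a => F ((Fintype.equivFin J).symm a), ?_⟩
  · simp only [J, Fintype.card_prod, Fintype.card_fin, ZMod.card, Fin.sum_univ_two,
      Matrix.cons_val_zero, Matrix.cons_val_one]
    rw [show n - 1 = 2 * (m + 2) * k by omega]
    ring
  · intro e h1 h2
    obtain ⟨j, hj, hju⟩ := hmain e h1 h2
    refine ⟨Fintype.equivFin J j, by simpa using hj, ?_⟩
    intro a ha
    rw [← hju _ ha]; simp
end
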